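/- Let n ≥ 3 and let (p,q) be any Schrödinger-admissible pair in dimension n. There is a constant C = C(n,p) such that for every Schwartz function g on ℝ × ℝ^n the following holds. Set h(s,x) = ⟨x⟩^{-1} (⟨∂_s⟩^{1/4} g)(s,x). Then the (untruncated) integral F(t,x) = ∫_ℝ [ e^{i(t−s)Δ} h(s,·) ](x) ds satisfies ‖F‖_{L^p_t L^q_x} ≤ C ‖g‖_{L²(ℝ×ℝ^n)}. -/

import Mathlib

open MeasureTheory ENNReal SchwartzMap

/-- The free Schrödinger evolution `(e^{itΔ}f)(x)`, given for `t ≠ 0` by the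
explicit convolution formula with the principal branch of the complex power. -/
noncomputable def schrod (n : ℕ) (t : ℝ) (f : EuclideanSpace ℝ (Fin n) → ℂ)
    (x : EuclideanSpace ℝ (Fin n)) : ℂ :=
  if t = 0 then f x
  else (4 * Real.pi * Complex.I * (t : ℂ)) ^ (-(n : ℂ) / 2) *
    ∫ y : EuclideanSpace ℝ (Fin n),
      Complex.exp (Complex.I * (‖x - y‖ : ℂ) ^ 2 / (4 * (t : ℂ))) * f y

/-- The fractional derivative `⟨∂_s⟩^a` in the time variable, i.e. the Fourier
multiplier with symbol `(1+λ²)^{a/2}`. -/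
noncomputable def fracD {n : ℕ} (a : ℝ) (g : ℝ × EuclideanSpace ℝ (Fin n) → ℂ)
    (s : ℝ) (x : EuclideanSpace ℝ (Fin n)) : ℂ :=
  (2 * Real.pi : ℂ)⁻¹ *
    ∫ lam : ℝ, Complex.exp (Complex.I * (s : ℂ) * (lam : ℂ)) *
      (((1 + lam ^ 2 : ℝ) ^ (a / 2) : ℝ) : ℂ) *
      ∫ σ : ℝ, Complex.exp (-(Complex.I * (σ : ℂ) * (lam : ℂ))) * g (σ, x)

/-- The mixed norm `‖F‖_{L^p_t L^q_x}`, with exponents in `ℝ≥0∞`. -/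
noncomputable def mixedNorm {n : ℕ} (p q : ℝ≥0∞)
    (F : ℝ → EuclideanSpace ℝ (Fin n) → ℂ) : ℝ≥0∞ :=
  if p = ⊤ then essSup (fun t => eLpNorm (F t) q volume) volume
  else (∫⁻ t : ℝ, (eLpNorm (F t) q volume) ^ p.toReal) ^ (1 / p.toReal)

section

open scoped FourierTransform

section Plancherel

variable {V : Type*} [NormedAddCommGroup V] [InnerProductSpace ℝ V] [FiniteDimensional ℝ V]
  [MeasurableSpace V] [BorelSpace V]

lemma eLpNorm_two_sq {α : Type*} {_ : MeasurableSpace α} {E : Type*} [NormedAddCommGroup E]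
    (μ : Measure α) (f : α → E) :
    eLpNorm f 2 μ ^ 2 = ∫⁻ x, ‖f x‖ₑ ^ 2 ∂μ := by
  have := eLpNorm_nnreal_pow_eq_lintegral (f := f) (μ := μ) (p := 2) (by norm_num)
  simpa using this

lemma continuous_fourier_of_integrable {f : V → ℂ} (hf : Integrable f) : Continuous (𝓕 f) :=
  VectorFourier.fourierIntegral_continuous Real.continuous_fourierChar
    (by exact continuous_inner) hf

/-- The `L²` Fourier transform agrees with the integral one on `L¹ ∩ L²`. -/
lemma fourier_toLp_ae_eq {f : V → ℂ} (hf : Integrable f) (hf2 : MemLp f 2) :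
    (𝓕 (hf2.toLp f) : Lp ℂ 2 (volume : Measure V)) =ᵐ[volume] 𝓕 f := by
  set φ := hf2.toLp f
  refine ae_eq_of_integral_contDiff_smul_eq ?_ ?_ ?_
  · exact (Lp.memLp _).locallyIntegrable (by norm_num)
  · exact (continuous_fourier_of_integrable hf).locallyIntegrable
  · intro u hu hc
    let U : 𝓢(V, ℂ) := (hc.comp_left (g := Complex.ofReal) (by simp)).toSchwartzMap
      (Complex.ofRealCLM.contDiff.comp hu)
    have hU : ∀ x, U x = (u x : ℂ) := fun x => rfl
    have h1 := DFunLike.congr_fun (Lp.fourier_toTemperedDistribution_eq φ) U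
    rw [TemperedDistribution.fourier_apply, Lp.toTemperedDistribution_apply,
      Lp.toTemperedDistribution_apply] at h1
    calc ∫ x, u x • (𝓕 φ : Lp ℂ 2 (volume : Measure V)) x
        = ∫ x, U x • (𝓕 φ : Lp ℂ 2 (volume : Measure V)) x := by simp [hU]
      _ = ∫ x, (𝓕 U) x • φ x := h1.symm
      _ = ∫ x, (𝓕 (U : V → ℂ)) x • f x := by
          refine integral_congr_ae ?_
          filter_upwards [hf2.coeFn_toLp] with x hx
          rw [hx]; rfl
      _ = ∫ x, U x • 𝓕 f x := by
          have := VectorFourier.integral_fourierIntegral_smul_eq_flip (μ := volume) (ν := volume)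
            (L := innerₗ V) Real.continuous_fourierChar (by exact continuous_inner)
            U.integrable hf
          rw [flip_innerₗ] at this
          exact this
      _ = ∫ x, u x • 𝓕 f x := by simp [hU]

/-- Plancherel on `L¹ ∩ L²`. -/
lemma lintegral_sq_fourier {f : V → ℂ} (hf : Integrable f) (hf2 : MemLp f 2) :
    ∫⁻ ξ, ‖𝓕 f ξ‖ₑ ^ 2 = ∫⁻ x, ‖f x‖ₑ ^ 2 := by
  rw [← eLpNorm_two_sq, ← eLpNorm_two_sq, ← eLpNorm_congr_ae (fourier_toLp_ae_eq hf hf2),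
    ← eLpNorm_congr_ae hf2.coeFn_toLp]
  have := Lp.norm_fourier_eq (hf2.toLp f)
  rw [Lp.norm_def, Lp.norm_def, ENNReal.toReal_eq_toReal_iff' (Lp.eLpNorm_ne_top _)
    (Lp.eLpNorm_ne_top _)] at this
  rw [this]

lemma lintegral_sq_fourierInv {f : V → ℂ} (hf : Integrable f) (hf2 : MemLp f 2) :
    ∫⁻ ξ, ‖𝓕⁻ f ξ‖ₑ ^ 2 = ∫⁻ x, ‖f x‖ₑ ^ 2 := by
  rw [← lintegral_sq_fourier hf hf2,
    ← (Measure.measurePreserving_neg (volume : Measure V)).lintegral_comp_emb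
      (MeasurableEquiv.neg V).measurableEmbedding]
  simp [Real.fourierInv_eq_fourier_neg]

end Plancherel

section Trace

lemma lintegral_mul_sq_le {α : Type*} {_ : MeasurableSpace α} (μ : Measure α) {f g : α → ℝ≥0∞}
    (hf : AEMeasurable f μ) (hg : AEMeasurable g μ) :
    (∫⁻ x, f x * g x ∂μ) ^ 2 ≤ (∫⁻ x, f x ^ 2 ∂μ) * ∫⁻ x, g x ^ 2 ∂μ := by
  have h := ENNReal.lintegral_mul_le_Lp_mul_Lq μ Real.HolderConjugate.two_two hf hg
  simp only [Pi.mul_apply] at h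
  calc _ ≤ _ := pow_le_pow_left' h 2
    _ = _ := by
      rw [mul_pow, ← ENNReal.rpow_natCast, ← ENNReal.rpow_natCast, ← ENNReal.rpow_mul,
        ← ENNReal.rpow_mul]
      norm_num

/-- Integration in polar coordinates for nonnegative functions. -/
lemma lintegral_polar {V : Type*} [NormedAddCommGroup V] [NormedSpace ℝ V]
    [FiniteDimensional ℝ V] [Nontrivial V] [MeasurableSpace V] [BorelSpace V]
    (μ : Measure V) [μ.IsAddHaarMeasure]
    {F : V → ℝ≥0∞} (hF : Measurable F) :
    ∫⁻ x, F x ∂μ = ∫⁻ ω : Metric.sphere (0 : V) 1, (∫⁻ r in Set.Ioi (0 : ℝ),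
      ENNReal.ofReal (r ^ (Module.finrank ℝ V - 1)) * F (r • (ω : V))) ∂μ.toSphere := by
  have hm : Measurable fun p : Metric.sphere (0 : V) 1 × Set.Ioi (0 : ℝ) =>
      F (p.2.1 • (p.1 : V)) := by
    apply hF.comp
    fun_prop
  calc ∫⁻ x, F x ∂μ = ∫⁻ x in ({0}ᶜ : Set V), F x ∂μ := by
        rw [restrict_compl_singleton]
    _ = ∫⁻ x : ({0}ᶜ : Set V), F x ∂(μ.comap Subtype.val) :=
        (lintegral_subtype_comap (measurableSet_singleton (0 : V)).compl F).symm
    _ = ∫⁻ x : ({0}ᶜ : Set V), F ((homeomorphUnitSphereProd V x).2.1 •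
          ((homeomorphUnitSphereProd V x).1 : V)) ∂(μ.comap Subtype.val) := by
        refine lintegral_congr fun x => ?_
        have hx : ‖(x : V)‖ ≠ 0 := norm_ne_zero_iff.2 x.2
        simp [smul_smul, hx]
    _ = ∫⁻ p, F (p.2.1 • (p.1 : V)) ∂(μ.toSphere.prod
          (Measure.volumeIoiPow (Module.finrank ℝ V - 1))) :=
        μ.measurePreserving_homeomorphUnitSphereProd.lintegral_comp hm
    _ = _ := by
        rw [lintegral_prod _ hm.aemeasurable]
        refine lintegral_congr fun ω => ?_
        rw [Measure.volumeIoiPow, lintegral_withDensity_eq_lintegral_mul _ (by fun_prop)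
          (by exact hm.comp measurable_prodMk_left)]
        exact lintegral_subtype_comap measurableSet_Ioi
          (fun r : ℝ => ENNReal.ofReal (r ^ (Module.finrank ℝ V - 1)) * F (r • (ω : V)))

lemma enorm_le_lintegral_deriv_of_tendsto_zero {F : Type*} [NormedAddCommGroup F]
    [NormedSpace ℝ F] [CompleteSpace F] {w w' : ℝ → F} (hw : ∀ r, HasDerivAt w (w' r) r)
    (hw' : Continuous w') (h0 : Filter.Tendsto w Filter.atTop (nhds 0)) (ρ : ℝ) :
    ‖w ρ‖ₑ ≤ ∫⁻ r in Set.Ioi ρ, ‖w' r‖ₑ := by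
  have h1 : ∀ᶠ R in Filter.atTop, ‖w R - w ρ‖ₑ ≤ ∫⁻ r in Set.Ioi ρ, ‖w' r‖ₑ := by
    filter_upwards [Filter.eventually_ge_atTop ρ] with R hR
    rw [← intervalIntegral.integral_eq_sub_of_hasDerivAt (fun x _ => hw x)
      (hw'.intervalIntegrable _ _), intervalIntegral.integral_of_le hR]
    exact (enorm_integral_le_lintegral_enorm _).trans
      (lintegral_mono_set Set.Ioc_subset_Ioi_self)
  have h2 : Filter.Tendsto (fun R => ‖w R - w ρ‖ₑ) Filter.atTop (nhds ‖0 - w ρ‖ₑ) :=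
    (h0.sub_const _).enorm
  simpa using le_of_tendsto h2 h1

lemma lintegral_Ioi_pow_neg {k : ℕ} (hk : 2 ≤ k) {ρ : ℝ} (hρ : 0 < ρ) :
    ∫⁻ r in Set.Ioi ρ, ENNReal.ofReal ((r ^ k)⁻¹) ≤ ENNReal.ofReal ((ρ ^ (k - 1))⁻¹) := by
  have hk' : (2 : ℝ) ≤ k := by exact_mod_cast hk
  have ha : -(k : ℝ) < -1 := by linarith
  have hpw : ∀ r ∈ Set.Ioi ρ, (r ^ k)⁻¹ = r ^ (-(k : ℝ)) := fun r hr => by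
    rw [Real.rpow_neg (hρ.trans hr).le, Real.rpow_natCast]
  rw [setLIntegral_congr_fun measurableSet_Ioi (fun r hr => by
    show _ = ENNReal.ofReal (r ^ (-(k : ℝ))); rw [hpw r hr]),
    ← ofReal_integral_eq_lintegral_ofReal (integrableOn_Ioi_rpow_of_lt ha hρ)
      ((ae_restrict_mem measurableSet_Ioi).mono fun r hr =>
        (Real.rpow_nonneg (hρ.trans hr).le _)), integral_Ioi_rpow_of_lt ha hρ]
  apply ENNReal.ofReal_le_ofReal
  have h1 : ρ ^ (-(k : ℝ) + 1) = (ρ ^ (k - 1))⁻¹ := by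
    rw [← Real.rpow_natCast, ← Real.rpow_neg hρ.le, Nat.cast_sub (by omega)]
    congr 1; push_cast; ring
  rw [h1, neg_div, ← div_neg]
  apply div_le_self (by positivity)
  linarith

variable {V : Type*} [NormedAddCommGroup V] [InnerProductSpace ℝ V] [FiniteDimensional ℝ V]
  [MeasurableSpace V] [BorelSpace V]

/-- Trace estimate on spheres for `C¹` functions vanishing at infinity. -/
lemma lintegral_sphere_le {v : V → ℂ} (hv : ContDiff ℝ 1 v)
    (h0 : Filter.Tendsto v (Filter.cocompact V) (nhds 0)) {n : ℕ} (hn : 3 ≤ n)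
    (hd : Module.finrank ℝ V = n) {ρ : ℝ} (hρ : 0 < ρ) :
    ENNReal.ofReal (ρ ^ (n - 2) * (1 + ρ)) *
      ∫⁻ ω : Metric.sphere (0 : V) 1, ‖v (ρ • (ω : V))‖ₑ ^ 2 ∂(volume : Measure V).toSphere
      ≤ (∫⁻ ξ, ‖v ξ‖ₑ ^ 2) + 2 * ∫⁻ ξ, ‖fderiv ℝ v ξ‖ₑ ^ 2 := by
  have : Nontrivial V := Module.nontrivial_of_finrank_pos (R := ℝ) (by omega)
  have hD : Continuous (fderiv ℝ v) := hv.continuous_fderiv (by norm_num)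
  have hvc := hv.continuous
  set k := n - 1 with hk
  have hray : ∀ ω : Metric.sphere (0 : V) 1, ∀ r : ℝ,
      HasDerivAt (fun r : ℝ => v (r • (ω : V))) (fderiv ℝ v (r • (ω : V)) ω) r := fun ω r => by
    have := (hv.differentiable (by norm_num) (r • (ω : V))).hasFDerivAt.comp_hasDerivAt r
      ((hasDerivAt_id r).smul_const (ω : V))
    rw [one_smul] at this
    exact this
  have hω : ∀ ω : Metric.sphere (0 : V) 1, ‖(ω : V)‖ = 1 := fun ω => by simp
  have hop : ∀ ω : Metric.sphere (0 : V) 1, ∀ ξ, ‖fderiv ℝ v ξ ω‖ ≤ ‖fderiv ℝ v ξ‖ :=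
    fun ω ξ => by simpa [hω] using (fderiv ℝ v ξ).le_opNorm ω
  have htend : ∀ ω : Metric.sphere (0 : V) 1,
      Filter.Tendsto (fun r : ℝ => v (r • (ω : V))) Filter.atTop (nhds 0) := fun ω => by
    refine h0.comp ?_
    rw [← Metric.cobounded_eq_cocompact, ← tendsto_norm_atTop_iff_cobounded]
    simpa [norm_smul, hω] using Filter.tendsto_abs_atTop_atTop
  have hcw : ∀ ω : Metric.sphere (0 : V) 1,
      Continuous (fun r : ℝ => fderiv ℝ v (r • (ω : V)) ω) := fun ω => by fun_prop
  have hlow : ∀ ω : Metric.sphere (0 : V) 1,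
      ENNReal.ofReal (ρ ^ (n - 2)) * ‖v (ρ • (ω : V))‖ₑ ^ 2 ≤
        ∫⁻ r in Set.Ioi (0 : ℝ), ENNReal.ofReal (r ^ k) * ‖fderiv ℝ v (r • (ω : V))‖ₑ ^ 2 := by
    intro ω
    have h1 : ‖v (ρ • (ω : V))‖ₑ ≤ ∫⁻ r in Set.Ioi ρ, ENNReal.ofReal (Real.sqrt ((r ^ k)⁻¹)) *
        (ENNReal.ofReal (Real.sqrt (r ^ k)) * ‖fderiv ℝ v (r • (ω : V))‖ₑ) := by
      refine (enorm_le_lintegral_deriv_of_tendsto_zero (hray ω) (hcw ω) (htend ω) ρ).trans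
        (setLIntegral_mono' measurableSet_Ioi fun r hr => ?_)
      have hr0 : 0 < r := hρ.trans hr
      rw [← mul_assoc, ← ENNReal.ofReal_mul (by positivity), ← Real.sqrt_mul (by positivity),
        inv_mul_cancel₀ (by positivity)]
      simpa [enorm_le_iff_norm_le] using hop ω _
    have h2 := (pow_le_pow_left' h1 2).trans (lintegral_mul_sq_le _ (by fun_prop) (by fun_prop))
    have e1 : ∫⁻ r in Set.Ioi ρ, ENNReal.ofReal (Real.sqrt ((r ^ k)⁻¹)) ^ 2 =
        ∫⁻ r in Set.Ioi ρ, ENNReal.ofReal ((r ^ k)⁻¹) := by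
      refine setLIntegral_congr_fun measurableSet_Ioi fun r hr => ?_
      have hr0 : 0 < r := hρ.trans hr
      rw [← ENNReal.ofReal_pow (by positivity), Real.sq_sqrt (by positivity)]
    have e2 : ∫⁻ r in Set.Ioi ρ, (ENNReal.ofReal (Real.sqrt (r ^ k)) *
        ‖fderiv ℝ v (r • (ω : V))‖ₑ) ^ 2 ≤ ∫⁻ r in Set.Ioi (0 : ℝ),
          ENNReal.ofReal (r ^ k) * ‖fderiv ℝ v (r • (ω : V))‖ₑ ^ 2 := by
      refine le_trans (setLIntegral_mono' measurableSet_Ioi fun r hr => ?_)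
        (lintegral_mono_set (Set.Ioi_subset_Ioi hρ.le))
      have hr0 : 0 < r := hρ.trans hr
      rw [mul_pow, ← ENNReal.ofReal_pow (by positivity), Real.sq_sqrt (by positivity)]
    rw [e1] at h2
    have h3 := h2.trans (mul_le_mul' (lintegral_Ioi_pow_neg (by omega) hρ) e2)
    calc _ ≤ ENNReal.ofReal (ρ ^ (n - 2)) * _ := mul_le_mul_right h3 _
      _ = _ := by
        rw [← mul_assoc, ← ENNReal.ofReal_mul (by positivity), show k - 1 = n - 2 by omega,
          mul_inv_cancel₀ (by positivity), ENNReal.ofReal_one, one_mul]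
  have hhigh : ∀ ω : Metric.sphere (0 : V) 1,
      ENNReal.ofReal (ρ ^ k) * ‖v (ρ • (ω : V))‖ₑ ^ 2 ≤
        ∫⁻ r in Set.Ioi (0 : ℝ), ENNReal.ofReal (r ^ k) *
          (‖v (r • (ω : V))‖ₑ ^ 2 + ‖fderiv ℝ v (r • (ω : V))‖ₑ ^ 2) := by
    intro ω
    have h1 := enorm_le_lintegral_deriv_of_tendsto_zero
      (w := fun r : ℝ => ‖v (r • (ω : V))‖ ^ 2)
      (fun r => (hray ω r).norm_sq) (by
        have := hcw ω
        fun_prop) (by simpa using ((htend ω).norm.pow 2)) ρ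
    have h2 : ∀ r : ℝ, ‖2 * inner ℝ (v (r • (ω : V))) (fderiv ℝ v (r • (ω : V)) ω)‖ₑ ≤
        ‖v (r • (ω : V))‖ₑ ^ 2 + ‖fderiv ℝ v (r • (ω : V))‖ₑ ^ 2 := fun r => by
      rw [← ofReal_norm, ← ofReal_norm, ← ofReal_norm, ← ENNReal.ofReal_pow (by positivity),
        ← ENNReal.ofReal_pow (by positivity), ← ENNReal.ofReal_add (by positivity) (by positivity)]
      apply ENNReal.ofReal_le_ofReal
      rw [norm_mul, Real.norm_ofNat]
      have a := norm_inner_le_norm (𝕜 := ℝ) (v (r • (ω : V))) (fderiv ℝ v (r • (ω : V)) ω)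
      have b := mul_le_mul_of_nonneg_left (hop ω (r • (ω : V))) (norm_nonneg (v (r • (ω : V))))
      nlinarith [sq_nonneg (‖v (r • (ω : V))‖ - ‖fderiv ℝ v (r • (ω : V))‖)]
    rw [enorm_pow, enorm_norm] at h1
    calc _ ≤ ENNReal.ofReal (ρ ^ k) * ∫⁻ r in Set.Ioi ρ,
            (‖v (r • (ω : V))‖ₑ ^ 2 + ‖fderiv ℝ v (r • (ω : V))‖ₑ ^ 2) :=
          mul_le_mul_right (h1.trans (lintegral_mono h2)) _
      _ = ∫⁻ r in Set.Ioi ρ, ENNReal.ofReal (ρ ^ k) *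
            (‖v (r • (ω : V))‖ₑ ^ 2 + ‖fderiv ℝ v (r • (ω : V))‖ₑ ^ 2) :=
          (lintegral_const_mul' _ _ ENNReal.ofReal_ne_top).symm
      _ ≤ ∫⁻ r in Set.Ioi ρ, ENNReal.ofReal (r ^ k) *
            (‖v (r • (ω : V))‖ₑ ^ 2 + ‖fderiv ℝ v (r • (ω : V))‖ₑ ^ 2) := by
          refine setLIntegral_mono' measurableSet_Ioi fun r hr => ?_
          have : ρ ≤ r := le_of_lt hr
          gcongr
      _ ≤ _ := lintegral_mono_set (Set.Ioi_subset_Ioi hρ.le)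
  have p1 := lintegral_polar (volume : Measure V) (F := fun ξ => ‖fderiv ℝ v ξ‖ₑ ^ 2)
    (by fun_prop)
  have p2 := lintegral_polar (volume : Measure V)
    (F := fun ξ => ‖v ξ‖ₑ ^ 2 + ‖fderiv ℝ v ξ‖ₑ ^ 2) (by fun_prop)
  rw [hd] at p1 p2
  calc _ = (∫⁻ ω : Metric.sphere (0 : V) 1, ENNReal.ofReal (ρ ^ (n - 2)) *
          ‖v (ρ • (ω : V))‖ₑ ^ 2 ∂(volume : Measure V).toSphere) +
        ∫⁻ ω : Metric.sphere (0 : V) 1, ENNReal.ofReal (ρ ^ k) *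
          ‖v (ρ • (ω : V))‖ₑ ^ 2 ∂(volume : Measure V).toSphere := by
        rw [lintegral_const_mul' _ _ ENNReal.ofReal_ne_top,
          lintegral_const_mul' _ _ ENNReal.ofReal_ne_top, ← add_mul,
          ← ENNReal.ofReal_add (by positivity) (by positivity)]
        congr 2
        rw [hk, show n - 1 = n - 2 + 1 by omega]
        ring
    _ ≤ (∫⁻ ξ, ‖fderiv ℝ v ξ‖ₑ ^ 2) + ∫⁻ ξ, (‖v ξ‖ₑ ^ 2 + ‖fderiv ℝ v ξ‖ₑ ^ 2) := by
        rw [p1, p2]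
        exact add_le_add (lintegral_mono hlow) (lintegral_mono hhigh)
    _ = _ := by
        rw [lintegral_add_left (by fun_prop)]
        ring

end Trace

section FourierTrace
variable {V : Type*} [NormedAddCommGroup V] [InnerProductSpace ℝ V]

lemma sum_enorm_sq_inner {ι : Type*} [Fintype ι] (b : OrthonormalBasis ι ℝ V) (x : V) :
    ∑ i, ‖inner ℝ x (b i)‖ₑ ^ 2 = ‖x‖ₑ ^ 2 := by
  simp_rw [← ofReal_norm, ← ENNReal.ofReal_pow (norm_nonneg _)]
  rw [← ENNReal.ofReal_sum_of_nonneg (fun _ _ => by positivity)]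
  congr 1
  exact b.sum_sq_norm_inner_left x

lemma enorm_sq_clm_le {ι : Type*} [Fintype ι] (b : OrthonormalBasis ι ℝ V) (T : V →L[ℝ] ℂ) :
    ‖T‖ₑ ^ 2 ≤ ∑ i, ‖T (b i)‖ₑ ^ 2 := by
  simp_rw [← ofReal_norm, ← ENNReal.ofReal_pow (norm_nonneg _)]
  rw [← ENNReal.ofReal_sum_of_nonneg (fun _ _ => by positivity)]
  apply ENNReal.ofReal_le_ofReal
  have h : ‖T‖ ≤ Real.sqrt (∑ i, ‖T (b i)‖ ^ 2) := by
    refine T.opNorm_le_bound (Real.sqrt_nonneg _) fun x => ?_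
    conv_lhs => rw [← b.sum_repr' x, map_sum]
    calc ‖∑ i, T (inner ℝ (b i) x • b i)‖ ≤ ∑ i, ‖T (b i)‖ * ‖inner ℝ (b i) x‖ := by
          refine (norm_sum_le _ _).trans (Finset.sum_le_sum fun i _ => ?_)
          rw [map_smul, norm_smul, mul_comm]
      _ ≤ Real.sqrt (∑ i, ‖T (b i)‖ ^ 2) * Real.sqrt (∑ i, ‖inner ℝ (b i) x‖ ^ 2) :=
          Real.sum_mul_le_sqrt_mul_sqrt _ _ _
      _ = _ := by rw [b.sum_sq_norm_inner_right x, Real.sqrt_sq (norm_nonneg _)]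
  calc ‖T‖ ^ 2 ≤ Real.sqrt (∑ i, ‖T (b i)‖ ^ 2) ^ 2 := by gcongr
    _ = _ := Real.sq_sqrt (Finset.sum_nonneg fun _ _ => by positivity)

variable [FiniteDimensional ℝ V] [MeasurableSpace V] [BorelSpace V]

lemma lintegral_sq_fderiv_fourier_le {f : V → ℂ} (hf : Integrable f)
    (hf1 : Integrable fun x => ‖x‖ * ‖f x‖) (hf2 : MemLp (fun x => ‖x‖ • f x) 2) :
    ∫⁻ ξ, ‖fderiv ℝ (𝓕 f) ξ‖ₑ ^ 2 ≤
      ENNReal.ofReal (4 * Real.pi ^ 2) * ∫⁻ x, ‖x‖ₑ ^ 2 * ‖f x‖ₑ ^ 2 := by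
  set b := stdOrthonormalBasis ℝ V
  set F : Fin (Module.finrank ℝ V) → V → ℂ := fun i x =>
    -(2 * Real.pi * Complex.I) • (inner ℝ x (b i) : ℝ) • f x with hF
  have hmeas : ∀ i, AEStronglyMeasurable (F i) := fun i =>
    ((Continuous.aestronglyMeasurable (by fun_prop : Continuous fun x : V =>
      (inner ℝ x (b i) : ℝ))).smul hf.1).const_smul (-(2 * Real.pi * Complex.I))
  have hbd : ∀ i x, ‖F i x‖ ≤ 2 * Real.pi * (‖x‖ * ‖f x‖) := fun i x => by
    simp only [hF, norm_smul, norm_neg, norm_mul, Complex.norm_I, Complex.norm_real,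
      Complex.norm_ofNat, Real.norm_eq_abs, abs_of_pos Real.pi_pos, mul_one]
    have h := norm_inner_le_norm (𝕜 := ℝ) x (b i)
    rw [b.norm_eq_one, mul_one, Real.norm_eq_abs] at h
    gcongr
  have hInt : ∀ i, Integrable (F i) := fun i =>
    (hf1.const_mul (2 * Real.pi)).mono' (hmeas i) (Filter.Eventually.of_forall (hbd i))
  have hL2 : ∀ i, MemLp (F i) 2 := fun i =>
    hf2.of_le_mul (c := 2 * Real.pi) (hmeas i) (Filter.Eventually.of_forall fun x => by
      simpa [norm_smul] using hbd i x)
  have hsm : Integrable (VectorFourier.fourierSMulRight (innerSL ℝ) f) := by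
    refine (hf1.const_mul (2 * Real.pi * ‖innerSL (E := V) ℝ‖)).mono'
      (hf.1.fourierSMulRight) (Filter.Eventually.of_forall fun x => ?_)
    exact (VectorFourier.norm_fourierSMulRight_le _ _ _).trans (le_of_eq (by ring))
  have hder : ∀ i ξ, fderiv ℝ (𝓕 f) ξ (b i) = 𝓕 (F i) ξ := fun i ξ => by
    rw [(Real.hasFDerivAt_fourier hf hf1 ξ).fderiv, Real.fourier_continuousLinearMap_apply hsm]
    congr 1
  calc ∫⁻ ξ, ‖fderiv ℝ (𝓕 f) ξ‖ₑ ^ 2 ≤ ∫⁻ ξ, ∑ i, ‖𝓕 (F i) ξ‖ₑ ^ 2 :=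
        lintegral_mono fun ξ => by
          simpa only [hder] using enorm_sq_clm_le b (fderiv ℝ (𝓕 f) ξ)
    _ = ∑ i, ∫⁻ x, ‖F i x‖ₑ ^ 2 := by
        rw [lintegral_finsetSum _ fun i _ => by
          have := continuous_fourier_of_integrable (hInt i)
          fun_prop]
        exact Finset.sum_congr rfl fun i _ => lintegral_sq_fourier (hInt i) (hL2 i)
    _ = ∫⁻ x, ∑ i, ‖F i x‖ₑ ^ 2 := by
        rw [lintegral_finsetSum' _ fun i _ => (hmeas i).enorm.pow_const 2]
    _ = ∫⁻ x, ENNReal.ofReal (4 * Real.pi ^ 2) * (‖x‖ₑ ^ 2 * ‖f x‖ₑ ^ 2) := by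
        refine lintegral_congr fun x => ?_
        have hc : ‖-(2 * Real.pi * Complex.I)‖ₑ ^ 2 = ENNReal.ofReal (4 * Real.pi ^ 2) := by
          rw [← ofReal_norm, ← ENNReal.ofReal_pow (norm_nonneg _)]
          congr 1
          simp only [norm_neg, norm_mul, Complex.norm_I, Complex.norm_real,
            Complex.norm_ofNat, Real.norm_eq_abs, abs_of_pos Real.pi_pos, mul_one]
          ring
        simp only [hF, enorm_smul, mul_pow, hc]
        rw [← Finset.mul_sum, ← Finset.sum_mul, sum_enorm_sq_inner]
    _ = _ := lintegral_const_mul' _ _ ENNReal.ofReal_ne_top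

/-- The Fourier transform of a weighted `L²` function restricts to spheres, uniformly in the
radius. -/
lemma lintegral_sphere_fourier_le {f : V → ℂ} (hf : Integrable f)
    (hf1 : Integrable fun x => ‖x‖ * ‖f x‖) (hf0 : MemLp f 2)
    (hf2 : MemLp (fun x => ‖x‖ • f x) 2) {n : ℕ} (hn : 3 ≤ n)
    (hd : Module.finrank ℝ V = n) {ρ : ℝ} (hρ : 0 < ρ) :
    ENNReal.ofReal (ρ ^ (n - 2) * (1 + ρ)) *
      ∫⁻ ω : Metric.sphere (0 : V) 1, ‖𝓕 f (ρ • (ω : V))‖ₑ ^ 2 ∂(volume : Measure V).toSphere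
      ≤ ENNReal.ofReal (8 * Real.pi ^ 2) *
        ∫⁻ x, ENNReal.ofReal (1 + ‖x‖ ^ 2) * ‖f x‖ₑ ^ 2 := by
  have hC1 : ContDiff ℝ 1 (𝓕 f) := by
    refine Real.contDiff_fourier (N := 1) fun k hk => ?_
    have : k ≤ 1 := by exact_mod_cast hk
    interval_cases k
    · simpa using hf.norm
    · simpa using hf1
  have h0 : Filter.Tendsto (𝓕 f) (Filter.cocompact V) (nhds 0) :=
    tendsto_integral_exp_inner_smul_cocompact f
  refine (lintegral_sphere_le hC1 h0 hn hd hρ).trans ?_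
  rw [lintegral_sq_fourier hf hf0]
  have hpi : 1 ≤ 8 * Real.pi ^ 2 := by nlinarith [Real.pi_gt_three]
  have hm : AEMeasurable fun x => ‖f x‖ₑ ^ 2 := hf.1.enorm.pow_const 2
  calc (∫⁻ x, ‖f x‖ₑ ^ 2) + 2 * ∫⁻ ξ, ‖fderiv ℝ (𝓕 f) ξ‖ₑ ^ 2
      ≤ ENNReal.ofReal (8 * Real.pi ^ 2) * (∫⁻ x, ‖f x‖ₑ ^ 2) + 2 *
        (ENNReal.ofReal (4 * Real.pi ^ 2) * ∫⁻ x, ‖x‖ₑ ^ 2 * ‖f x‖ₑ ^ 2) := by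
        gcongr
        · exact le_mul_of_one_le_left' (by simpa using ENNReal.ofReal_le_ofReal hpi)
        · exact lintegral_sq_fderiv_fourier_le hf hf1 hf2
    _ = ENNReal.ofReal (8 * Real.pi ^ 2) *
        ((∫⁻ x, ‖f x‖ₑ ^ 2) + ∫⁻ x, ‖x‖ₑ ^ 2 * ‖f x‖ₑ ^ 2) := by
        rw [← mul_assoc, ← ENNReal.ofReal_ofNat 2, ← ENNReal.ofReal_mul (by positivity), mul_add]
        congr 3
        ring
    _ = _ := by
        rw [← lintegral_add_left' hm]
        congr 1
        refine lintegral_congr fun x => ?_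
        rw [ENNReal.ofReal_add (by positivity) (by positivity), ENNReal.ofReal_pow (norm_nonneg _),
          ofReal_norm, ENNReal.ofReal_one]
        ring

end FourierTrace

section Gaussian
variable {V : Type*} [NormedAddCommGroup V] [InnerProductSpace ℝ V] [FiniteDimensional ℝ V]
  [MeasurableSpace V] [BorelSpace V]

lemma integral_fourier_mul_eq {f g : V → ℂ} (hf : Integrable f) (hg : Integrable g) :
    ∫ ξ, 𝓕 f ξ * g ξ = ∫ x, f x * 𝓕 g x := by
  have := VectorFourier.integral_fourierIntegral_smul_eq_flip (μ := volume) (ν := volume)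
    (L := innerₗ V) Real.continuous_fourierChar (by exact continuous_inner) hf hg
  rw [flip_innerₗ] at this
  exact this

lemma memLp_fourier {h : V → ℂ} (h1 : Integrable h) (h2 : MemLp h 2) : MemLp (𝓕 h) 2 := by
  refine ⟨(continuous_fourier_of_integrable h1).aestronglyMeasurable, ?_⟩
  refine (ENNReal.pow_lt_top_iff.1 ?_).resolve_right two_ne_zero
  rw [eLpNorm_two_sq, lintegral_sq_fourier h1 h2,
    ← eLpNorm_two_sq]
  exact ENNReal.pow_lt_top h2.2

lemma norm_fourier_le_integral_norm (f : V → ℂ) (ξ : V) : ‖𝓕 f ξ‖ ≤ ∫ x, ‖f x‖ :=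
  VectorFourier.norm_fourierIntegral_le_integral_norm _ _ _ _ _

/-- The Schrödinger-type multiplier `e^{-b|ξ|²}`, `Re b > 0`, acts by convolution with a
Gaussian. -/
lemma integral_gaussian_mul_fourier {b : ℂ} (hb : 0 < b.re) {f : V → ℂ} (hf : Integrable f)
    (x : V) :
    ∫ ξ, Complex.exp (-b * ‖ξ‖ ^ 2 + 2 * Real.pi * Complex.I * inner ℝ x ξ) * 𝓕 f ξ =
      (Real.pi / b) ^ (Module.finrank ℝ V / 2 : ℂ) *
        ∫ y, Complex.exp (-Real.pi ^ 2 * ‖x - y‖ ^ 2 / b) * f y := by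
  have h := integral_fourier_mul_eq hf
    (GaussianFourier.integrable_cexp_neg_mul_sq_norm_add hb (2 * Real.pi * Complex.I) x)
  simp_rw [fourier_gaussian_innerProductSpace' hb] at h
  rw [← integral_const_mul]
  calc _ = ∫ ξ, 𝓕 f ξ * Complex.exp (-b * ‖ξ‖ ^ 2 + 2 * Real.pi * Complex.I * inner ℝ x ξ) := by
        simp_rw [mul_comm]
    _ = _ := h
    _ = _ := by congr 1; ext y; ring

lemma norm_gaussian_kernel_le {b : ℂ} (hb : 0 < b.re) (r : ℝ) :
    ‖Complex.exp (-Real.pi ^ 2 * r ^ 2 / b)‖ ≤ 1 := by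
  rw [Complex.norm_exp, Real.exp_le_one_iff, Complex.div_re]
  have h1 : (-(Real.pi : ℂ) ^ 2 * (r : ℂ) ^ 2) = ((-(Real.pi ^ 2 * r ^ 2) : ℝ) : ℂ) := by
    push_cast; ring
  rw [h1, Complex.ofReal_re, Complex.ofReal_im, zero_mul, zero_div, add_zero]
  apply div_nonpos_of_nonpos_of_nonneg _ (Complex.normSq_nonneg _)
  exact mul_nonpos_of_nonpos_of_nonneg (by nlinarith [sq_nonneg (Real.pi * r)]) hb.le

lemma norm_cpow_half_nat (z : ℂ) (n : ℕ) :
    ‖z ^ (n / 2 : ℂ)‖ = ‖z‖ ^ (n / 2 : ℝ) := by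
  have : (n / 2 : ℂ) = ((n / 2 : ℝ) : ℂ) := by push_cast; rfl
  rw [this, Complex.norm_cpow_real]

lemma norm_integral_gaussian_mul_fourier_le {b : ℂ} (hb : 0 < b.re) {f : V → ℂ}
    (hf : Integrable f) (x : V) :
    ‖∫ ξ, Complex.exp (-b * ‖ξ‖ ^ 2 + 2 * Real.pi * Complex.I * inner ℝ x ξ) * 𝓕 f ξ‖ ≤
      (Real.pi / ‖b‖) ^ (Module.finrank ℝ V / 2 : ℝ) * ∫ y, ‖f y‖ := by
  rw [integral_gaussian_mul_fourier hb hf, norm_mul, norm_cpow_half_nat,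
    norm_div, Complex.norm_real,
    Real.norm_of_nonneg Real.pi_pos.le]
  gcongr
  refine norm_integral_le_of_norm_le hf.norm (Filter.Eventually.of_forall fun y => ?_)
  rw [norm_mul]
  exact mul_le_of_le_one_left (norm_nonneg _) (norm_gaussian_kernel_le hb _)

open ComplexConjugate in
lemma norm_integral_gaussian_bilin_le {b : ℂ} (hb : 0 < b.re) {f g : V → ℂ}
    (hf : Integrable f) (hg : Integrable g) :
    ‖∫ ξ, Complex.exp (-b * ‖ξ‖ ^ 2) * (𝓕 f ξ * conj (𝓕 g ξ))‖ ≤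
      (Real.pi / ‖b‖) ^ (Module.finrank ℝ V / 2 : ℝ) * ((∫ y, ‖f y‖) * ∫ y, ‖g y‖) := by
  set K := (Real.pi / ‖b‖) ^ (Module.finrank ℝ V / 2 : ℝ)
  have hgc := continuous_fourier_of_integrable hg
  have hk : Integrable fun ξ : V => Complex.exp (-b * ‖ξ‖ ^ 2) := by
    simpa using GaussianFourier.integrable_cexp_neg_mul_sq_norm_add hb 0 (0 : V)
  have hi : Integrable fun ξ => Complex.exp (-b * ‖ξ‖ ^ 2) * conj (𝓕 g ξ) := by
    refine hk.mul_bdd (c := ∫ x, ‖g x‖) (by fun_prop) (Filter.Eventually.of_forall fun ξ => ?_)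
    simpa using norm_fourier_le_integral_norm g ξ
  have hF : ∀ x, ‖𝓕 (fun ξ => Complex.exp (-b * ‖ξ‖ ^ 2) * conj (𝓕 g ξ)) x‖ ≤
      K * ∫ y, ‖g y‖ := fun x => by
    have hb' : 0 < (conj b).re := by simpa using hb
    have := norm_integral_gaussian_mul_fourier_le hb' hg x
    rw [Complex.norm_conj] at this
    refine le_trans (le_of_eq ?_) this
    rw [← Complex.norm_conj, Real.fourier_eq', ← integral_conj]
    congr 2 with ξ
    rw [smul_eq_mul, map_mul, ← Complex.exp_conj, map_mul (starRingEnd ℂ) (Complex.exp _),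
      ← Complex.exp_conj, ← mul_assoc, ← Complex.exp_add, Complex.conj_conj]
    congr 2
    simp [real_inner_comm]
    rw [show (starRingEnd ℂ) 2 = 2 from map_ofNat _ 2]
    ring
  calc _ = ‖∫ x, f x * 𝓕 (fun ξ => Complex.exp (-b * ‖ξ‖ ^ 2) * conj (𝓕 g ξ)) x‖ := by
        rw [← integral_fourier_mul_eq hf hi]
        congr 2 with ξ
        ring
    _ ≤ ∫ x, ‖f x‖ * (K * ∫ y, ‖g y‖) := by
        refine norm_integral_le_of_norm_le (hf.norm.mul_const _)
          (Filter.Eventually.of_forall fun y => ?_)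
        rw [norm_mul]
        gcongr
        exact hF y
    _ = _ := by rw [integral_mul_const]; ring

open ComplexConjugate in
/-- The dispersive estimate in bilinear form. -/
lemma norm_integral_oscillatory_bilin_le {τ : ℝ} (hτ : τ ≠ 0) {f g : V → ℂ}
    (hf : Integrable f) (hg : Integrable g) (hf2 : MemLp f 2) (hg2 : MemLp g 2) :
    ‖∫ ξ, Complex.exp (Complex.I * τ * ‖ξ‖ ^ 2) * (𝓕 f ξ * conj (𝓕 g ξ))‖ ≤
      (Real.pi / |τ|) ^ (Module.finrank ℝ V / 2 : ℝ) * ((∫ y, ‖f y‖) * ∫ y, ‖g y‖) := by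
  have hfc := continuous_fourier_of_integrable hf
  have hgc := continuous_fourier_of_integrable hg
  have hint : Integrable fun ξ => 𝓕 f ξ * conj (𝓕 g ξ) :=
    (memLp_fourier hf hf2).integrable_mul (memLp_fourier hg hg2).star
  set b : ℝ → ℂ := fun ε => ε - Complex.I * τ
  have hbre : ∀ ε, (b ε).re = ε := fun ε => by simp [b]
  have hlim : Filter.Tendsto (fun ε : ℝ => ∫ ξ, Complex.exp (-b ε * ‖ξ‖ ^ 2) *
      (𝓕 f ξ * conj (𝓕 g ξ))) (nhdsWithin 0 (Set.Ioi 0))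
      (nhds (∫ ξ, Complex.exp (Complex.I * τ * ‖ξ‖ ^ 2) * (𝓕 f ξ * conj (𝓕 g ξ)))) := by
    refine tendsto_integral_filter_of_dominated_convergence (fun ξ => ‖𝓕 f ξ * conj (𝓕 g ξ)‖)
      (Filter.Eventually.of_forall fun ε => by fun_prop) ?_ hint.norm
      (Filter.Eventually.of_forall fun ξ => ?_)
    · filter_upwards [self_mem_nhdsWithin] with ε hε
      refine Filter.Eventually.of_forall fun ξ => ?_
      rw [norm_mul]
      refine mul_le_of_le_one_left (norm_nonneg _) ?_
      rw [Complex.norm_exp, Real.exp_le_one_iff]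
      have : (-b ε * (‖ξ‖ : ℂ) ^ 2).re = -(ε * ‖ξ‖ ^ 2) := by
        simp [b, ← Complex.ofReal_pow]
      rw [this]
      have : (0 : ℝ) < ε := hε
      simp; positivity
    · refine Filter.Tendsto.mul_const _ ?_
      have hc : Continuous fun ε : ℝ => Complex.exp (-b ε * ‖ξ‖ ^ 2) := by
        simp only [b]; fun_prop
      have := (hc.tendsto 0).mono_left (nhdsWithin_le_nhds (s := Set.Ioi 0))
      simpa [b] using this
  have hlim2 : Filter.Tendsto (fun ε : ℝ => (Real.pi / ‖b ε‖) ^ (Module.finrank ℝ V / 2 : ℝ) *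
      ((∫ y, ‖f y‖) * ∫ y, ‖g y‖)) (nhdsWithin 0 (Set.Ioi 0))
      (nhds ((Real.pi / |τ|) ^ (Module.finrank ℝ V / 2 : ℝ) *
        ((∫ y, ‖f y‖) * ∫ y, ‖g y‖))) := by
    have hc : ContinuousAt (fun ε : ℝ => (Real.pi / ‖b ε‖) ^ (Module.finrank ℝ V / 2 : ℝ) *
      ((∫ y, ‖f y‖) * ∫ y, ‖g y‖)) 0 := by
      have : ContinuousAt (fun ε : ℝ => Real.pi / ‖b ε‖) 0 :=
        ContinuousAt.div (by fun_prop) (by simp only [b]; fun_prop) (by simpa [b] using hτ)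
      exact (this.rpow_const (Or.inr (by positivity))).mul_const _
    have := hc.tendsto.mono_left (nhdsWithin_le_nhds (s := Set.Ioi 0))
    simpa [b] using this
  refine le_of_tendsto_of_tendsto hlim.norm hlim2 ?_
  filter_upwards [self_mem_nhdsWithin] with ε hε
  exact norm_integral_gaussian_bilin_le (by rw [hbre]; exact hε) hf hg

/-- The free evolution written on the Fourier side agrees with the convolution formula. -/
lemma integral_oscillatory_mul_fourier {τ : ℝ} (hτ : τ ≠ 0) {f : V → ℂ} (hf : Integrable f)
    (hf' : Integrable (𝓕 f)) (x : V) :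
    ∫ ξ, Complex.exp (-(4 * Real.pi ^ 2 * Complex.I * τ) * ‖ξ‖ ^ 2 +
        2 * Real.pi * Complex.I * inner ℝ x ξ) * 𝓕 f ξ =
      (4 * Real.pi * Complex.I * τ) ^ (-(Module.finrank ℝ V : ℂ) / 2) *
        ∫ y, Complex.exp (Complex.I * ‖x - y‖ ^ 2 / (4 * τ)) * f y := by
  have hfc := continuous_fourier_of_integrable hf
  set b : ℝ → ℂ := fun ε => ε + 4 * Real.pi ^ 2 * Complex.I * τ
  have hbre : ∀ ε, (b ε).re = ε := fun ε => by simp [b, ← Complex.ofReal_pow]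
  have hb0 : b 0 ≠ 0 := by
    simp [b, hτ, Real.pi_ne_zero]
  have hnorm1 : ∀ z : ℂ, z.re ≤ 0 → ‖Complex.exp z‖ ≤ 1 := fun z hz => by
    rwa [Complex.norm_exp, Real.exp_le_one_iff]
  have hl1 : Filter.Tendsto (fun ε : ℝ => ∫ ξ, Complex.exp (-b ε * ‖ξ‖ ^ 2 +
      2 * Real.pi * Complex.I * inner ℝ x ξ) * 𝓕 f ξ) (nhdsWithin 0 (Set.Ioi 0))
      (nhds (∫ ξ, Complex.exp (-b 0 * ‖ξ‖ ^ 2 +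
      2 * Real.pi * Complex.I * inner ℝ x ξ) * 𝓕 f ξ)) := by
    refine tendsto_integral_filter_of_dominated_convergence (fun ξ => ‖𝓕 f ξ‖)
      (Filter.Eventually.of_forall fun ε => by fun_prop) ?_ hf'.norm
      (Filter.Eventually.of_forall fun ξ => ?_)
    · filter_upwards [self_mem_nhdsWithin] with ε hε
      refine Filter.Eventually.of_forall fun ξ => ?_
      rw [norm_mul]
      refine mul_le_of_le_one_left (norm_nonneg _) (hnorm1 _ ?_)
      have h1 : (0 : ℝ) < ε := hε
      have : (-b ε * (‖ξ‖ : ℂ) ^ 2 + 2 * Real.pi * Complex.I * inner ℝ x ξ).re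
          = -(ε * ‖ξ‖ ^ 2) := by
        simp [b, ← Complex.ofReal_pow]
      rw [this]
      simp; positivity
    · have hc : Continuous fun ε : ℝ => Complex.exp (-b ε * ‖ξ‖ ^ 2 +
          2 * Real.pi * Complex.I * inner ℝ x ξ) := by
        simp only [b]; fun_prop
      exact ((hc.tendsto 0).mono_left nhdsWithin_le_nhds).mul_const _
  have hl2 : Filter.Tendsto (fun ε : ℝ => ∫ y, Complex.exp (-Real.pi ^ 2 * ‖x - y‖ ^ 2 / b ε) * f y)
      (nhdsWithin 0 (Set.Ioi 0))
      (nhds (∫ y, Complex.exp (-Real.pi ^ 2 * ‖x - y‖ ^ 2 / b 0) * f y)) := by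
    refine tendsto_integral_filter_of_dominated_convergence (fun y => ‖f y‖)
      (Filter.Eventually.of_forall fun ε => ?_) ?_ hf.norm
      (Filter.Eventually.of_forall fun ξ => ?_)
    · exact (Continuous.aestronglyMeasurable (by fun_prop)).mul hf.1
    · filter_upwards [self_mem_nhdsWithin] with ε hε
      refine Filter.Eventually.of_forall fun ξ => ?_
      rw [norm_mul]
      exact mul_le_of_le_one_left (norm_nonneg _)
        (norm_gaussian_kernel_le (by rw [hbre]; exact hε) _)
    · have hc : ContinuousAt (fun ε : ℝ => Complex.exp (-Real.pi ^ 2 * ‖x - ξ‖ ^ 2 / b ε)) 0 := by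
        refine Complex.continuous_exp.continuousAt.comp
          (ContinuousAt.div (by fun_prop) (by simp only [b]; fun_prop) hb0)
      exact (hc.tendsto.mono_left nhdsWithin_le_nhds).mul_const _
  have hsl : (Real.pi / b 0) ∈ Complex.slitPlane := by
    rw [Complex.mem_slitPlane_iff]
    right
    have : (Real.pi / b 0 : ℂ) = ((-1 / (4 * Real.pi * τ) : ℝ) : ℂ) * Complex.I := by
      have : (Real.pi : ℂ) ≠ 0 := by exact_mod_cast Real.pi_ne_zero
      have : (τ : ℂ) ≠ 0 := by exact_mod_cast hτ
      simp only [b]; push_cast; field_simp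
      linear_combination ((4 * Real.pi ^ 2 * τ) : ℂ) * Complex.I_sq
    rw [this, Complex.im_ofReal_mul, Complex.I_im, mul_one]
    exact div_ne_zero (by norm_num) (mul_ne_zero (by positivity) hτ)
  have hl3 : Filter.Tendsto (fun ε : ℝ => (Real.pi / b ε) ^ (Module.finrank ℝ V / 2 : ℂ))
      (nhdsWithin 0 (Set.Ioi 0))
      (nhds ((Real.pi / b 0) ^ (Module.finrank ℝ V / 2 : ℂ))) := by
    have : ContinuousAt (fun ε : ℝ => (Real.pi / b ε : ℂ)) 0 :=
      ContinuousAt.div (by fun_prop) (by simp only [b]; fun_prop) hb0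
    exact ((this.cpow continuousAt_const hsl).tendsto).mono_left nhdsWithin_le_nhds
  have key := tendsto_nhds_unique (hl1.congr' (by
    filter_upwards [self_mem_nhdsWithin] with ε hε
    exact integral_gaussian_mul_fourier (by rw [hbre]; exact hε) hf x)) (hl3.mul hl2)
  have hb0' : b 0 = 4 * Real.pi ^ 2 * Complex.I * τ := by simp [b]
  have hpi : (Real.pi : ℂ) ≠ 0 := by exact_mod_cast Real.pi_ne_zero
  have hτ' : (τ : ℂ) ≠ 0 := by exact_mod_cast hτ
  rw [hb0'] at key
  rw [key]
  congr 1
  · have : (Real.pi / (4 * Real.pi ^ 2 * Complex.I * τ) : ℂ) = (4 * Real.pi * Complex.I * τ)⁻¹ := by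
      field_simp
    rw [this, Complex.inv_cpow, neg_div, Complex.cpow_neg]
    intro h
    have h2 : (4 * Real.pi * Complex.I * τ : ℂ) = ((4 * Real.pi * τ : ℝ) : ℂ) * Complex.I := by
      push_cast; ring
    rw [Complex.arg_eq_pi_iff, h2] at h
    simp at h
  · congr 2 with y
    congr 2
    field_simp
    rw [Complex.I_sq]; ring
end Gaussian

section Pairing
open ComplexConjugate

variable {S S' X : Type*} [MeasurableSpace S] [MeasurableSpace S'] [MeasurableSpace X]

/-- `∫ |F(s,·)| ds` lies in `L²`. -/
structure SqIntegrable (ν : Measure S) (μ : Measure X) (F : S → X → ℂ) : Prop where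
  meas : Measurable (Function.uncurry F)
  fin : ∫⁻ ξ, (∫⁻ s, ‖F s ξ‖ₑ ∂ν) ^ 2 ∂μ < ⊤

lemma SqIntegrable.mono_measure {ν ν' : Measure S} {μ : Measure X} {F : S → X → ℂ}
    (h : SqIntegrable ν μ F) (hν : ν' ≤ ν) : SqIntegrable ν' μ F :=
  ⟨h.meas, (lintegral_mono fun _ => by gcongr).trans_lt h.fin⟩

variable {μ : Measure X}

lemma lintegral_mul_lt_top {f g : X → ℝ≥0∞} (hf : AEMeasurable f μ) (hg : AEMeasurable g μ)
    (hf2 : ∫⁻ x, f x ^ 2 ∂μ < ⊤) (hg2 : ∫⁻ x, g x ^ 2 ∂μ < ⊤) : ∫⁻ x, f x * g x ∂μ < ⊤ :=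
  (ENNReal.pow_lt_top_iff.1 ((lintegral_mul_sq_le μ hf hg).trans_lt
    (ENNReal.mul_lt_top hf2 hg2))).resolve_right two_ne_zero

lemma enorm_integral_mul_conj_sq_le {f g : X → ℂ} (hf : Measurable f) (hg : Measurable g) :
    ‖∫ ξ, f ξ * conj (g ξ) ∂μ‖ₑ ^ 2 ≤ (∫⁻ ξ, ‖f ξ‖ₑ ^ 2 ∂μ) * ∫⁻ ξ, ‖g ξ‖ₑ ^ 2 ∂μ := by
  refine le_trans ?_ (lintegral_mul_sq_le μ hf.enorm.aemeasurable hg.enorm.aemeasurable)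
  gcongr
  refine (enorm_integral_le_lintegral_enorm _).trans (le_of_eq ?_)
  simp [enorm_mul]

variable {ν : Measure S} [SFinite ν] {F : S → X → ℂ}

lemma SqIntegrable.measurable_lintegral (hF : SqIntegrable ν μ F) :
    Measurable fun ξ => ∫⁻ s, ‖F s ξ‖ₑ ∂ν :=
  Measurable.lintegral_prod_left' (f := fun z : S × X => ‖F z.1 z.2‖ₑ) hF.meas.enorm

variable {ν' : Measure S'} [SFinite ν'] [SFinite μ] {G : S' → X → ℂ}

lemma SqIntegrable.integrable_pair (hF : SqIntegrable ν μ F) (hG : SqIntegrable ν' μ G) :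
    Integrable (fun z : (S × S') × X => F z.1.1 z.2 * conj (G z.1.2 z.2))
      ((ν.prod ν').prod μ) := by
  have hF1 : Measurable fun z : (S × S') × X => F z.1.1 z.2 :=
    hF.meas.comp (by fun_prop : Measurable fun z : (S × S') × X => (z.1.1, z.2))
  have hG1 : Measurable fun z : (S × S') × X => G z.1.2 z.2 :=
    hG.meas.comp (by fun_prop : Measurable fun z : (S × S') × X => (z.1.2, z.2))
  have hm : Measurable fun z : (S × S') × X => F z.1.1 z.2 * conj (G z.1.2 z.2) := by
    have := Complex.continuous_conj.measurable.comp hG1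
    exact hF1.mul this
  refine ⟨hm.aestronglyMeasurable, ?_⟩
  rw [hasFiniteIntegral_iff_enorm, lintegral_prod_symm _ hm.enorm.aemeasurable]
  have : ∀ ξ, ∫⁻ z : S × S', ‖F z.1 ξ * conj (G z.2 ξ)‖ₑ ∂ν.prod ν' =
      (∫⁻ s, ‖F s ξ‖ₑ ∂ν) * ∫⁻ s, ‖G s ξ‖ₑ ∂ν' := fun ξ => by
    have h1 : Measurable fun s => ‖F s ξ‖ₑ := (hF.meas.comp measurable_prodMk_right).enorm
    have h2 : Measurable fun s => ‖G s ξ‖ₑ := (hG.meas.comp measurable_prodMk_right).enorm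
    rw [← lintegral_prod_mul h1.aemeasurable h2.aemeasurable]
    simp [enorm_mul]
  simp only [this]
  exact lintegral_mul_lt_top hF.measurable_lintegral.aemeasurable
    hG.measurable_lintegral.aemeasurable hF.fin hG.fin

lemma SqIntegrable.integral_pair (hF : SqIntegrable ν μ F) (hG : SqIntegrable ν' μ G) :
    ∫ ξ, (∫ s, F s ξ ∂ν) * conj (∫ s, G s ξ ∂ν') ∂μ =
      ∫ z : S × S', ∫ ξ, F z.1 ξ * conj (G z.2 ξ) ∂μ ∂(ν.prod ν') := by
  rw [integral_integral_swap (f := fun (z : S × S') ξ => F z.1 ξ * conj (G z.2 ξ))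
    (hF.integrable_pair hG)]
  congr 1 with ξ
  rw [← integral_conj, ← integral_prod_mul]

lemma SqIntegrable.lintegral_sq_integral_le (hF : SqIntegrable ν μ F) :
    ∫⁻ ξ, ‖∫ s, F s ξ ∂ν‖ₑ ^ 2 ∂μ ≤
      ‖∫ z : S × S, ∫ ξ, F z.1 ξ * conj (F z.2 ξ) ∂μ ∂(ν.prod ν)‖ₑ := by
  rw [← hF.integral_pair hF]
  have hm : StronglyMeasurable fun ξ => ∫ s, F s ξ ∂ν :=
    StronglyMeasurable.integral_prod_left' (f := fun z : S × X => F z.1 z.2)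
      hF.meas.stronglyMeasurable
  have hle : ∫⁻ ξ, ‖∫ s, F s ξ ∂ν‖ₑ ^ 2 ∂μ < ⊤ :=
    (lintegral_mono fun ξ => by gcongr; exact enorm_integral_le_lintegral_enorm _).trans_lt hF.fin
  have e : ∀ ξ, (∫ s, F s ξ ∂ν) * conj (∫ s, F s ξ ∂ν) =
      ((‖∫ s, F s ξ ∂ν‖ ^ 2 : ℝ) : ℂ) := fun ξ => by
    rw [Complex.mul_conj, Complex.normSq_eq_norm_sq]
  simp_rw [e]
  rw [integral_complex_ofReal]
  rw [show ‖((∫ ξ, ‖∫ s, F s ξ ∂ν‖ ^ 2 ∂μ : ℝ) : ℂ)‖ₑ =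
    ENNReal.ofReal (∫ ξ, ‖∫ s, F s ξ ∂ν‖ ^ 2 ∂μ) from by
      rw [← ofReal_norm, Complex.norm_real, Real.norm_of_nonneg (integral_nonneg fun _ => by positivity)]]
  have h2 : ∀ ξ, ‖∫ s, F s ξ ∂ν‖ₑ ^ 2 = ENNReal.ofReal (‖∫ s, F s ξ ∂ν‖ ^ 2) := fun ξ => by
    rw [← ofReal_norm, ← ENNReal.ofReal_pow (norm_nonneg _)]
  rw [ofReal_integral_eq_lintegral_ofReal _ (Filter.Eventually.of_forall fun _ => by positivity)]
  · simp_rw [h2]; rfl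
  · refine ⟨(hm.norm.pow 2).aestronglyMeasurable, ?_⟩
    rw [hasFiniteIntegral_iff_ofReal (Filter.Eventually.of_forall fun _ => by positivity)]
    simpa only [h2] using hle

end Pairing

section Schur
variable {S S' : Type*} [MeasurableSpace S] [MeasurableSpace S'] {ν : Measure S}
  {ν' : Measure S'} [SFinite ν] [SFinite ν']

/-- Schur's test in bilinear form. -/
lemma schur_test {k : S × S' → ℝ≥0∞} (hk : Measurable k) {M : ℝ≥0∞}
    (h1 : ∀ t, ∫⁻ s, k (t, s) ∂ν' ≤ M) (h2 : ∀ s, ∫⁻ t, k (t, s) ∂ν ≤ M)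
    {a : S → ℝ≥0∞} {b : S' → ℝ≥0∞} (ha : Measurable a) (hb : Measurable b) :
    (∫⁻ z, k z * (a z.1 * b z.2) ∂(ν.prod ν')) ^ 2 ≤
      M ^ 2 * ((∫⁻ t, a t ^ 2 ∂ν) * ∫⁻ s, b s ^ 2 ∂ν') := by
  have hk2 : Measurable fun z => k z ^ (1 / 2 : ℝ) := hk.pow_const _
  have hsq : ∀ z, (k z ^ (1 / 2 : ℝ)) ^ 2 = k z := fun z => by
    rw [← ENNReal.rpow_natCast, ← ENNReal.rpow_mul]; norm_num
  have ha' : Measurable fun z : S × S' => a z.1 := ha.comp measurable_fst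
  have hb' : Measurable fun z : S × S' => b z.2 := hb.comp measurable_snd
  have e1 : ∫⁻ z, k z * a z.1 ^ 2 ∂(ν.prod ν') ≤ M * ∫⁻ t, a t ^ 2 ∂ν := by
    rw [lintegral_prod _ (by fun_prop),
      ← lintegral_const_mul _ (ha.pow_const 2)]
    refine lintegral_mono fun t => ?_
    dsimp only
    rw [lintegral_mul_const _ (by fun_prop)]
    gcongr
    exact h1 t
  have e2 : ∫⁻ z, k z * b z.2 ^ 2 ∂(ν.prod ν') ≤ M * ∫⁻ t, b t ^ 2 ∂ν' := by
    rw [lintegral_prod_symm _ (by fun_prop),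
      ← lintegral_const_mul _ (hb.pow_const 2)]
    refine lintegral_mono fun t => ?_
    dsimp only
    rw [lintegral_mul_const _ (by fun_prop)]
    gcongr
    exact h2 t
  calc (∫⁻ z, k z * (a z.1 * b z.2) ∂(ν.prod ν')) ^ 2
      = (∫⁻ z, (k z ^ (1 / 2 : ℝ) * a z.1) * (k z ^ (1 / 2 : ℝ) * b z.2) ∂(ν.prod ν')) ^ 2 := by
        congr 2 with z
        rw [mul_mul_mul_comm, ← sq, hsq]
    _ ≤ _ := lintegral_mul_sq_le _ (hk2.mul ha').aemeasurable (hk2.mul hb').aemeasurable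
    _ ≤ (M * ∫⁻ t, a t ^ 2 ∂ν) * (M * ∫⁻ t, b t ^ 2 ∂ν') := by
        simp_rw [mul_pow, hsq]
        gcongr
    _ = _ := by ring
end Schur

section Dyadic

lemma lintegral_enorm_rpow_neg_half_le (r : ℝ≥0∞) (hr : r ≠ ⊤) :
    ∫⁻ u : ℝ, {u : ℝ | ‖u‖ₑ ≤ r}.indicator (fun u => ‖u‖ₑ ^ (-(1 / 2) : ℝ)) u ≤
      4 * r ^ (1 / 2 : ℝ) := by
  set f : ℝ → ℝ≥0∞ := {u : ℝ | ‖u‖ₑ ≤ r}.indicator (fun u => ‖u‖ₑ ^ (-(1 / 2) : ℝ)) with hf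
  have hneg : ∀ u, f (-u) = f u := fun u => by simp [hf, Set.indicator]
  have hpos : ∫⁻ u in Set.Ioi 0, f u ≤ 2 * r ^ (1 / 2 : ℝ) := by
    have hr0 : 0 ≤ r.toReal := ENNReal.toReal_nonneg
    have e1 : ∀ u ∈ Set.Ioi (0 : ℝ), f u =
        (Set.Ioc 0 r.toReal).indicator (fun u => ENNReal.ofReal (u ^ (-(1 / 2) : ℝ))) u := by
      intro u hu
      have hu' : (0 : ℝ) < u := hu
      have h1 : ‖u‖ₑ = ENNReal.ofReal u := Real.enorm_of_nonneg hu'.le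
      have h2 : ‖u‖ₑ ≤ r ↔ u ≤ r.toReal := by
        rw [h1, ENNReal.ofReal_le_iff_le_toReal hr]
      simp only [hf, Set.indicator, Set.mem_ofPred_eq, h2, Set.mem_Ioc, hu', true_and]
      split_ifs
      · rw [h1, ENNReal.ofReal_rpow_of_pos hu']
      · rfl
    rw [setLIntegral_congr_fun measurableSet_Ioi e1]
    refine (setLIntegral_le_lintegral _ _).trans ?_
    rw [lintegral_indicator measurableSet_Ioc]
    have hi : IntervalIntegrable (fun u : ℝ => u ^ (-(1 / 2) : ℝ)) volume 0 r.toReal :=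
      intervalIntegral.intervalIntegrable_rpow' (by norm_num)
    rw [← ofReal_integral_eq_lintegral_ofReal
      ((intervalIntegrable_iff_integrableOn_Ioc_of_le hr0).1 hi)
      ((ae_restrict_iff' measurableSet_Ioc).2 (Filter.Eventually.of_forall fun u hu =>
        Real.rpow_nonneg hu.1.le _)), ← intervalIntegral.integral_of_le hr0,
      integral_rpow (Or.inl (by norm_num))]
    rw [← ENNReal.ofReal_toReal hr, ENNReal.ofReal_rpow_of_nonneg hr0 (by norm_num),
      ← ENNReal.ofReal_ofNat 2, ← ENNReal.ofReal_mul (by norm_num), ENNReal.toReal_ofReal hr0]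
    apply ENNReal.ofReal_le_ofReal
    rw [Real.zero_rpow (by norm_num)]
    norm_num
    linarith
  have hnegI : ∫⁻ u in Set.Iio 0, f u = ∫⁻ u in Set.Ioi 0, f u := by
    have := (Measure.measurePreserving_neg (volume : Measure ℝ)).setLIntegral_comp_preimage_emb
      (MeasurableEquiv.neg ℝ).measurableEmbedding f (Set.Ioi 0)
    rw [← this]
    simp [hneg]
  have : ∫⁻ u, f u = (∫⁻ u in Set.Iio 0, f u) + ∫⁻ u in Set.Ioi 0, f u := by
    rw [← lintegral_add_compl f measurableSet_Iio, Set.compl_Iio]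
    congr 1
    exact setLIntegral_congr Ioi_ae_eq_Ici.symm
  rw [this, hnegI]
  calc _ ≤ 2 * r ^ (1 / 2 : ℝ) + 2 * r ^ (1 / 2 : ℝ) := by gcongr
    _ = _ := by ring

/-- Time pairs at distance comparable to `2^j`. -/
def dyadicShell (j : ℤ) : Set (ℝ × ℝ) :=
  {z | (2 : ℝ≥0∞) ^ (j : ℝ) ≤ ‖z.1 - z.2‖ₑ ∧ ‖z.1 - z.2‖ₑ < (2 : ℝ≥0∞) ^ (j + 1 : ℝ)}

lemma measurableSet_dyadicShell (j : ℤ) : MeasurableSet (dyadicShell j) := by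
  have : Measurable fun z : ℝ × ℝ => ‖z.1 - z.2‖ₑ := by fun_prop
  exact (measurableSet_le measurable_const this).inter (measurableSet_lt this measurable_const)

lemma dyadicShell_symm (j : ℤ) (z : ℝ × ℝ) : z.swap ∈ dyadicShell j ↔ z ∈ dyadicShell j := by
  simp only [dyadicShell, Set.mem_ofPred_eq, Prod.fst_swap, Prod.snd_swap,
    ← enorm_neg (z.2 - z.1), neg_sub]

lemma pairwise_disjoint_dyadicShell : Pairwise (Function.onFun Disjoint dyadicShell) := by
  intro i j hij
  rw [Function.onFun, Set.disjoint_left]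
  rintro z ⟨h1, h2⟩ ⟨h3, h4⟩
  have hlt : ∀ {a b : ℤ}, (2 : ℝ≥0∞) ^ (a : ℝ) < (2 : ℝ≥0∞) ^ (b + 1 : ℝ) → a ≤ b :=
    fun {a b} h => by
      by_contra hab
      have : (b + 1 : ℝ) ≤ a := by exact_mod_cast (by omega : b + 1 ≤ a)
      exact absurd h (not_lt.2 (ENNReal.rpow_le_rpow_of_exponent_le (by norm_num) this))
  exact hij (le_antisymm (hlt (h1.trans_lt h4)) (hlt (h3.trans_lt h2)))

lemma iUnion_dyadicShell : ⋃ j, dyadicShell j = {z | z.1 ≠ z.2} := by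
  ext z
  simp only [Set.mem_iUnion]
  constructor
  · rintro ⟨j, h1, -⟩ h
    rw [h, sub_self, enorm_zero, nonpos_iff_eq_zero, ENNReal.rpow_eq_zero_iff] at h1
    simp at h1
  · intro h
    have h0 : ‖z.1 - z.2‖ₑ ≠ 0 := by simpa [sub_eq_zero] using h
    obtain ⟨j, hj1, hj2⟩ := ENNReal.exists_mem_Ico_zpow h0 enorm_ne_top
      (show (1 : ℝ≥0∞) < 2 by norm_num) (by norm_num)
    refine ⟨j, ?_, ?_⟩
    · rwa [ENNReal.rpow_intCast]
    · rw [← Int.cast_one, ← Int.cast_add, ENNReal.rpow_intCast]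
      exact hj2

lemma ae_ne_diag : ∀ᵐ z : ℝ × ℝ, z.1 ≠ z.2 := by
  have hm : MeasurableSet {z : ℝ × ℝ | z.1 ≠ z.2} :=
    (measurableSet_eq_fun measurable_fst measurable_snd).compl
  refine (Measure.ae_prod_iff_ae_ae hm).2 (Filter.Eventually.of_forall fun x => ?_)
  have : ∀ᵐ y : ℝ, y ≠ x := by simp [ae_iff]
  filter_upwards [this] with y hy using hy.symm

lemma volume_dyadicShell_section_le (j : ℤ) (t : ℝ) :
    volume {s | (t, s) ∈ dyadicShell j} ≤ 4 * (2 : ℝ≥0∞) ^ (j : ℝ) := by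
  have h2 : (2 : ℝ≥0∞) ^ (j + 1 : ℝ) ≠ ⊤ := ENNReal.rpow_ne_top_of_ne_zero (by simp) (by simp)
  calc volume {s | (t, s) ∈ dyadicShell j}
      ≤ volume (Metric.closedEBall t ((2 : ℝ≥0∞) ^ (j + 1 : ℝ)).toNNReal) := by
        refine measure_mono fun s hs => ?_
        rw [Metric.mem_closedEBall, edist_comm, edist_eq_enorm_sub, ENNReal.coe_toNNReal h2]
        exact hs.2.le
    _ = 2 * (2 : ℝ≥0∞) ^ (j + 1 : ℝ) := by
        rw [Real.volume_closedEBall, ENNReal.coe_toNNReal h2]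
    _ = _ := by
        rw [ENNReal.rpow_add _ _ (by simp) (by simp), ENNReal.rpow_one]; ring

end Dyadic

section DyadicPairing
open ComplexConjugate

variable {X : Type*} [MeasurableSpace X] {μ : Measure X} {F G : ℝ → X → ℂ}

/-- `⟨F(t), G(s)⟩` as a function of the pair of times `(t,s)`. -/
noncomputable def timePairing (μ : Measure X) (F G : ℝ → X → ℂ) (z : ℝ × ℝ) : ℂ :=
  ∫ ξ, F z.1 ξ * conj (G z.2 ξ) ∂μ

lemma timePairing_swap (z : ℝ × ℝ) : timePairing μ F G z.swap = conj (timePairing μ G F z) := by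
  rw [timePairing, timePairing, ← integral_conj]
  congr 1 with ξ
  simp [mul_comm]

lemma enorm_setIntegral_timePairing_symm (j : ℤ) :
    ‖∫ z in dyadicShell j, timePairing μ F G z‖ₑ =
      ‖∫ z in dyadicShell j, timePairing μ G F z‖ₑ := by
  have hp : MeasurePreserving (Prod.swap : ℝ × ℝ → ℝ × ℝ) := Measure.measurePreserving_swap
  have h := hp.setIntegral_preimage_emb MeasurableEquiv.prodComm.measurableEmbedding
    (timePairing μ F G) (dyadicShell j)
  have h2 : Prod.swap ⁻¹' dyadicShell j = dyadicShell j := by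
    ext z; exact dyadicShell_symm j z
  rw [← h, h2]
  simp_rw [timePairing_swap]
  rw [integral_conj, ← ofReal_norm, Complex.norm_conj, ofReal_norm]

lemma enorm_integral_le_tsum_dyadicShell {B : ℝ × ℝ → ℂ} (hB : Integrable B) :
    ‖∫ z, B z‖ₑ ≤ ∑' j, ‖∫ z in dyadicShell j, B z‖ₑ := by
  have h := hasSum_integral_iUnion measurableSet_dyadicShell pairwise_disjoint_dyadicShell
    (hB.integrableOn (s := ⋃ j, dyadicShell j))
  have h2 : ∫ z in ⋃ j, dyadicShell j, B z = ∫ z, B z := by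
    rw [iUnion_dyadicShell]
    conv_rhs => rw [← setIntegral_univ]
    refine setIntegral_congr_set ?_
    filter_upwards [ae_ne_diag] with z hz
    exact propext ⟨fun _ => trivial, fun _ => hz⟩
  rw [← h2, ← h.tsum_eq]
  exact enorm_tsum_le_tsum_enorm

lemma lintegral_indicator_dyadicShell_le (j : ℤ) (t : ℝ) :
    ∫⁻ s, (dyadicShell j).indicator 1 (t, s) ≤ 4 * (2 : ℝ≥0∞) ^ (j : ℝ) := by
  refine le_trans (le_of_eq ?_) (volume_dyadicShell_section_le j t)
  exact lintegral_indicator_one (measurable_prodMk_left (x := t) (measurableSet_dyadicShell j))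

lemma lintegral_indicator_dyadicShell_le' (j : ℤ) (s : ℝ) :
    ∫⁻ t, (dyadicShell j).indicator 1 (t, s) ≤ 4 * (2 : ℝ≥0∞) ^ (j : ℝ) := by
  refine le_trans (le_of_eq ?_) (lintegral_indicator_dyadicShell_le j s)
  congr 1 with t
  classical
  simp only [Set.indicator, ← dyadicShell_symm j (s, t), Prod.swap, Pi.one_apply]

lemma lintegral_dyadicShell_le (j : ℤ) {a b : ℝ → ℝ≥0∞} (ha : Measurable a) (hb : Measurable b) :
    (∫⁻ z in dyadicShell j, a z.1 * b z.2) ^ 2 ≤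
      (4 * (2 : ℝ≥0∞) ^ (j : ℝ)) ^ 2 * ((∫⁻ t, a t ^ 2) * ∫⁻ s, b s ^ 2) := by
  refine le_trans (le_of_eq ?_) (schur_test (ν := volume) (ν' := volume)
    (k := (dyadicShell j).indicator 1)
    ((measurable_const (a := (1 : ℝ≥0∞))).indicator (measurableSet_dyadicShell j))
    (lintegral_indicator_dyadicShell_le j) (lintegral_indicator_dyadicShell_le' j) ha hb)
  rw [← lintegral_indicator (measurableSet_dyadicShell j)]
  congr 2 with z
  by_cases hz : z ∈ dyadicShell j <;> simp [hz]

lemma enorm_sq_setIntegral_timePairing_le_of_dispersive (j : ℤ) {a b : ℝ → ℝ≥0∞}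
    (ha : Measurable a) (hb : Measurable b) {c : ℝ≥0∞}
    (h : ∀ z ∈ dyadicShell j, ‖timePairing μ F G z‖ₑ ≤ c * (a z.1 * b z.2)) :
    ‖∫ z in dyadicShell j, timePairing μ F G z‖ₑ ^ 2 ≤
      (c * (4 * (2 : ℝ≥0∞) ^ (j : ℝ))) ^ 2 * ((∫⁻ t, a t ^ 2) * ∫⁻ s, b s ^ 2) := by
  have h1 : ‖∫ z in dyadicShell j, timePairing μ F G z‖ₑ ≤
      c * ∫⁻ z in dyadicShell j, a z.1 * b z.2 := by
    rw [← lintegral_const_mul _ (by fun_prop)]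
    exact (enorm_integral_le_lintegral_enorm _).trans
      (setLIntegral_mono' (measurableSet_dyadicShell j) h)
  calc _ ≤ (c * ∫⁻ z in dyadicShell j, a z.1 * b z.2) ^ 2 := by gcongr
    _ ≤ c ^ 2 * ((4 * (2 : ℝ≥0∞) ^ (j : ℝ)) ^ 2 * ((∫⁻ t, a t ^ 2) * ∫⁻ s, b s ^ 2)) := by
        rw [mul_pow]; gcongr; exact lintegral_dyadicShell_le j ha hb
    _ = _ := by ring

variable [SFinite μ]

lemma integrable_timePairing (hF : SqIntegrable volume μ F) (hG : SqIntegrable volume μ G) :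
    Integrable (timePairing μ F G) :=
  (hF.integrable_pair hG).integral_prod_left

lemma lintegral_sq_setIntegral_section_le (hG : SqIntegrable volume μ G) (j : ℤ) {b : ℝ → ℝ≥0∞}
    (hb : Measurable b) {c : ℝ≥0∞}
    (h : ∀ s s', s ≠ s' → ‖timePairing μ G G (s, s')‖ₑ ≤
      c * (‖s - s'‖ₑ ^ (-(1 / 2) : ℝ) * (b s * b s'))) (t : ℝ) :
    ∫⁻ ξ, ‖∫ s in {s | (t, s) ∈ dyadicShell j}, G s ξ‖ₑ ^ 2 ∂μ ≤
      c * (8 * (2 : ℝ≥0∞) ^ (j / 2 : ℝ)) * ∫⁻ s in {s | (t, s) ∈ dyadicShell j}, b s ^ 2 := by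
  set I : Set ℝ := {s | (t, s) ∈ dyadicShell j} with hI
  have hIm : MeasurableSet I := measurable_prodMk_left (measurableSet_dyadicShell j)
  set r : ℝ≥0∞ := (2 : ℝ≥0∞) ^ (j + 2 : ℝ) with hr
  have hrtop : r ≠ ⊤ := ENNReal.rpow_ne_top_of_ne_zero (by simp) (by simp)
  set f : ℝ → ℝ≥0∞ := {u : ℝ | ‖u‖ₑ ≤ r}.indicator (fun u => ‖u‖ₑ ^ (-(1 / 2) : ℝ)) with hf
  have hfm : Measurable f := Measurable.indicator (by fun_prop)
    (measurableSet_le (by fun_prop) measurable_const)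
  have hneg : ∀ u, f (-u) = f u := fun u => by simp [hf, Set.indicator]
  have hfint : ∫⁻ u, f u ≤ 8 * (2 : ℝ≥0∞) ^ (j / 2 : ℝ) := by
    refine (lintegral_enorm_rpow_neg_half_le r hrtop).trans (le_of_eq ?_)
    rw [hr, ← ENNReal.rpow_mul, show (j + 2 : ℝ) * (1 / 2) = j / 2 + 1 by ring,
      ENNReal.rpow_add _ _ (by simp) (by simp), ENNReal.rpow_one]
    ring
  have hsub : ∀ s ∈ I, ∀ s' ∈ I, ‖s - s'‖ₑ ≤ r := fun s hs s' hs' => by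
    have h1 : ‖s - s'‖ₑ ≤ ‖t - s'‖ₑ + ‖t - s‖ₑ := by
      rw [show s - s' = (t - s') - (t - s) by ring]; exact enorm_sub_le
    refine h1.trans ((add_le_add hs'.2.le hs.2.le).trans (le_of_eq ?_))
    rw [hr, show (j + 2 : ℝ) = (j + 1) + 1 by ring, ENNReal.rpow_add (j + 1 : ℝ) 1 (by simp) (by simp),
      ENNReal.rpow_one]
    ring
  refine (hG.mono_measure Measure.restrict_le_self).lintegral_sq_integral_le.trans ?_
  rw [Measure.prod_restrict]
  have hbI : Measurable (I.indicator b) := hb.indicator hIm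
  have hk : Measurable fun z : ℝ × ℝ => f (z.1 - z.2) := hfm.comp (by fun_prop)
  have step : ‖∫ z in I ×ˢ I, timePairing μ G G z‖ₑ ≤
      c * ∫⁻ z : ℝ × ℝ, f (z.1 - z.2) * (I.indicator b z.1 * I.indicator b z.2) := by
    rw [← lintegral_const_mul _ (by fun_prop)]
    refine (enorm_integral_le_lintegral_enorm _).trans ?_
    rw [← lintegral_indicator (hIm.prod hIm)]
    refine lintegral_mono_ae ?_
    filter_upwards [ae_ne_diag] with z hz
    by_cases hzI : z ∈ I ×ˢ I
    · rw [Set.indicator_of_mem hzI, Set.indicator_of_mem hzI.1, Set.indicator_of_mem hzI.2]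
      have : f (z.1 - z.2) = ‖z.1 - z.2‖ₑ ^ (-(1 / 2) : ℝ) :=
        Set.indicator_of_mem (show z.1 - z.2 ∈ {u : ℝ | ‖u‖ₑ ≤ r} from hsub _ hzI.1 _ hzI.2) _
      rw [this]
      exact h _ _ hz
    · rw [Set.indicator_of_notMem hzI]; exact zero_le
  have schur := schur_test (ν := volume) (ν' := volume) hk (M := 8 * (2 : ℝ≥0∞) ^ (j / 2 : ℝ))
    (fun t => by rw [lintegral_sub_left_eq_self]; exact hfint)
    (fun s => by rw [lintegral_sub_right_eq_self (μ := volume) f]; exact hfint) hbI hbI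
  have hsq : ∫⁻ s, I.indicator b s ^ 2 = ∫⁻ s in I, b s ^ 2 := by
    rw [← lintegral_indicator hIm]
    congr 1 with s
    by_cases hs : s ∈ I <;> simp [hs]
  rw [hsq, ← sq, ← mul_pow] at schur
  refine step.trans ?_
  rw [mul_assoc c]
  gcongr
  exact (ENNReal.pow_le_pow_left_iff two_ne_zero).1 schur

lemma enorm_sq_setIntegral_timePairing_le_of_energy (hF : SqIntegrable volume μ F)
    (hG : SqIntegrable volume μ G) (j : ℤ) {a b : ℝ → ℝ≥0∞}
    (ha : Measurable a) (hb : Measurable b) {c c' : ℝ≥0∞} (hc : c ≠ ⊤) (hat : ∀ t, a t ≠ ⊤)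
    (hFa : ∀ t, ∫⁻ ξ, ‖F t ξ‖ₑ ^ 2 ∂μ ≤ c * a t ^ 2)
    (h : ∀ s s', s ≠ s' → ‖timePairing μ G G (s, s')‖ₑ ≤
      c' * (‖s - s'‖ₑ ^ (-(1 / 2) : ℝ) * (b s * b s'))) :
    ‖∫ z in dyadicShell j, timePairing μ F G z‖ₑ ^ 2 ≤
      c * c' * (32 * (2 : ℝ≥0∞) ^ (3 * j / 2 : ℝ)) * ((∫⁻ t, a t ^ 2) * ∫⁻ s, b s ^ 2) := by
  set I : ℝ → Set ℝ := fun t => {s | (t, s) ∈ dyadicShell j} with hI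
  have hIm : ∀ t, MeasurableSet (I t) :=
    fun t => measurable_prodMk_left (measurableSet_dyadicShell j)
  set B : ℝ → ℝ≥0∞ := fun t => ∫⁻ s in I t, b s ^ 2 with hB
  have hBeq : ∀ t, B t = ∫⁻ s, (dyadicShell j).indicator 1 (t, s) * b s ^ 2 := fun t => by
    rw [hB]
    dsimp only
    rw [← lintegral_indicator (hIm t)]
    congr 1 with s
    by_cases hs : (t, s) ∈ dyadicShell j <;> simp [hI, hs]
  have hkm : Measurable fun z : ℝ × ℝ => (dyadicShell j).indicator (1 : ℝ × ℝ → ℝ≥0∞) z :=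
    (measurable_const (a := (1 : ℝ≥0∞))).indicator (measurableSet_dyadicShell j)
  have hBm : Measurable B := by
    rw [show B = _ from funext hBeq]
    exact Measurable.lintegral_prod_right' (f := fun z : ℝ × ℝ =>
      (dyadicShell j).indicator 1 z * b z.2 ^ 2)
      (hkm.mul ((hb.comp measurable_snd).pow_const 2))
  have hBint : ∫⁻ t, B t ≤ 4 * (2 : ℝ≥0∞) ^ (j : ℝ) * ∫⁻ s, b s ^ 2 := by
    simp_rw [hBeq]
    rw [lintegral_lintegral_swap, ← lintegral_const_mul _ (hb.pow_const 2)]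
    · refine lintegral_mono fun s => ?_
      dsimp only
      have : Measurable fun t => (dyadicShell j).indicator (1 : ℝ × ℝ → ℝ≥0∞) (t, s) :=
        hkm.comp measurable_prodMk_right
      rw [lintegral_mul_const _ this]
      gcongr
      exact lintegral_indicator_dyadicShell_le' j s
    · exact (hkm.mul ((hb.comp measurable_snd).pow_const 2)).aemeasurable
  have hFm : ∀ t, Measurable (F t) := fun t => hF.meas.comp measurable_prodMk_left
  have hrow : ∀ t, ‖∫ s in I t, timePairing μ F G (t, s)‖ₑ ≤
      (c * a t ^ 2) ^ (1 / 2 : ℝ) * (c' * (8 * (2 : ℝ≥0∞) ^ (j / 2 : ℝ)) * B t) ^ (1 / 2 : ℝ) := by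
    intro t
    have hG' : SqIntegrable (volume.restrict (I t)) μ G :=
      hG.mono_measure Measure.restrict_le_self
    have hint : Integrable (fun z : ℝ × X => F t z.2 * conj (G z.1 z.2))
        ((volume.restrict (I t)).prod μ) := by
      have hm : Measurable fun z : ℝ × X => F t z.2 * conj (G z.1 z.2) :=
        ((hFm t).comp measurable_snd).mul (Complex.continuous_conj.measurable.comp hG.meas)
      refine ⟨hm.aestronglyMeasurable, ?_⟩
      rw [hasFiniteIntegral_iff_enorm, lintegral_prod_symm _ hm.enorm.aemeasurable]
      have : ∀ ξ, ∫⁻ s in I t, ‖F t ξ * conj (G s ξ)‖ₑ =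
          ‖F t ξ‖ₑ * ∫⁻ s in I t, ‖G s ξ‖ₑ := fun ξ => by
        have : Measurable fun s => ‖G s ξ‖ₑ := (hG.meas.comp measurable_prodMk_right).enorm
        rw [← lintegral_const_mul _ this]
        simp [enorm_mul]
      simp only [this]
      exact lintegral_mul_lt_top (hFm t).enorm.aemeasurable
        hG'.measurable_lintegral.aemeasurable
        ((hFa t).trans_lt (ENNReal.mul_lt_top hc.lt_top (ENNReal.pow_lt_top (hat t).lt_top)))
        hG'.fin
    have heq : ∫ s in I t, timePairing μ F G (t, s) =
        ∫ ξ, F t ξ * conj (∫ s in I t, G s ξ) ∂μ := by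
      simp only [timePairing]
      rw [integral_integral_swap hint]
      congr 1 with ξ
      rw [integral_const_mul, integral_conj]
    have hVm : Measurable fun ξ => ∫ s in I t, G s ξ :=
      (StronglyMeasurable.integral_prod_left' (f := fun z : ℝ × X => G z.1 z.2)
        hG.meas.stronglyMeasurable).measurable
    have h1 := enorm_integral_mul_conj_sq_le (μ := μ) (hFm t) hVm
    rw [← heq] at h1
    have h2 := h1.trans (mul_le_mul' (hFa t) (lintegral_sq_setIntegral_section_le hG j hb h t))
    rw [← ENNReal.mul_rpow_of_nonneg _ _ (by norm_num)]
    refine le_trans (le_of_eq ?_) (ENNReal.rpow_le_rpow h2 (by norm_num : (0 : ℝ) ≤ 1 / 2))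
    rw [← ENNReal.rpow_natCast, ← ENNReal.rpow_mul]
    norm_num
  have hint := integrable_timePairing hF hG
  have hT : ‖∫ z in dyadicShell j, timePairing μ F G z‖ₑ ≤
      ∫⁻ t, ‖∫ s in I t, timePairing μ F G (t, s)‖ₑ := by
    rw [← integral_indicator (measurableSet_dyadicShell j), Measure.volume_eq_prod,
      integral_prod _ (hint.indicator (measurableSet_dyadicShell j))]
    refine (enorm_integral_le_lintegral_enorm _).trans (le_of_eq ?_)
    congr 1 with t
    rw [← integral_indicator (hIm t)]
    rfl
  have hsq : ∀ x : ℝ≥0∞, (x ^ (1 / 2 : ℝ)) ^ 2 = x := fun x => by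
    rw [← ENNReal.rpow_natCast, ← ENNReal.rpow_mul]; norm_num
  calc _ ≤ (∫⁻ t, (c * a t ^ 2) ^ (1 / 2 : ℝ) *
        (c' * (8 * (2 : ℝ≥0∞) ^ (j / 2 : ℝ)) * B t) ^ (1 / 2 : ℝ)) ^ 2 := by
        gcongr
        exact hT.trans (lintegral_mono hrow)
    _ ≤ (∫⁻ t, c * a t ^ 2) * ∫⁻ t, c' * (8 * (2 : ℝ≥0∞) ^ (j / 2 : ℝ)) * B t := by
        refine (lintegral_mul_sq_le _ ?_ ?_).trans (le_of_eq ?_)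
        · fun_prop
        · fun_prop
        · simp_rw [hsq]
    _ ≤ (c * ∫⁻ t, a t ^ 2) * (c' * (8 * (2 : ℝ≥0∞) ^ (j / 2 : ℝ)) *
        (4 * (2 : ℝ≥0∞) ^ (j : ℝ) * ∫⁻ s, b s ^ 2)) := by
        rw [lintegral_const_mul _ (ha.pow_const 2), lintegral_const_mul _ hBm]
        gcongr
    _ = _ := by
        rw [show (3 * j / 2 : ℝ) = j / 2 + j by ring, ENNReal.rpow_add _ _ (by simp) (by simp)]
        ring

end DyadicPairing

section DyadicSummation
open ComplexConjugate

lemma two_rpow_add (x y : ℝ) : (2 : ℝ≥0∞) ^ (x + y) = 2 ^ x * 2 ^ y :=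
  ENNReal.rpow_add _ _ (by simp) (by simp)

lemma two_rpow_ne_top (x : ℝ) : (2 : ℝ≥0∞) ^ x ≠ ⊤ :=
  ENNReal.rpow_ne_top_of_ne_zero (by simp) (by simp)

lemma two_rpow_le {x y : ℝ} (h : x ≤ y) : (2 : ℝ≥0∞) ^ x ≤ 2 ^ y :=
  ENNReal.rpow_le_rpow_of_exponent_le (by norm_num) h

lemma two_rpow_pow (x : ℝ) (k : ℕ) : ((2 : ℝ≥0∞) ^ x) ^ k = 2 ^ (k * x) := by
  rw [← ENNReal.rpow_natCast, ← ENNReal.rpow_mul, mul_comm]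

lemma le_of_energy_of_dispersive {n : ℕ} (hn : 3 ≤ n) {x u m : ℝ≥0∞} {l : ℝ}
    (h1 : x ≤ 2 ^ (-l) * m)
    (h2 : x ≤ u ^ (-(n / 2) : ℝ) * (2 ^ ((l + l) * ((n - 2) / 4)) * m)) :
    x ≤ 2 ^ (-l / 2) * (u ^ (-(1 / 2) : ℝ) * m) := by
  have hn0 : (3 : ℝ) ≤ n := by exact_mod_cast hn
  have hα : (0 : ℝ) ≤ 1 / n := by positivity
  have hβ : (0 : ℝ) ≤ 1 - 1 / n := by
    rw [sub_nonneg, div_le_one (by linarith)]; linarith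
  have split : ∀ y : ℝ≥0∞, y = y ^ (1 / n : ℝ) * y ^ (1 - 1 / n : ℝ) := fun y => by
    rw [← ENNReal.rpow_add_of_nonneg _ _ hα hβ]; simp
  calc x = x ^ (1 / n : ℝ) * x ^ (1 - 1 / n : ℝ) := split x
    _ ≤ (u ^ (-(n / 2) : ℝ) * (2 ^ ((l + l) * ((n - 2) / 4)) * m)) ^ (1 / n : ℝ) *
        (2 ^ (-l) * m) ^ (1 - 1 / n : ℝ) := by gcongr
    _ = (2 ^ ((l + l) * ((n - 2) / 4) * (1 / n)) * 2 ^ (-l * (1 - 1 / n))) *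
        (u ^ (-(n / 2) * (1 / n) : ℝ) * (m ^ (1 / n : ℝ) * m ^ (1 - 1 / n : ℝ))) := by
        rw [ENNReal.mul_rpow_of_nonneg _ _ hα, ENNReal.mul_rpow_of_nonneg _ _ hα,
          ENNReal.mul_rpow_of_nonneg _ _ hβ, ← ENNReal.rpow_mul, ← ENNReal.rpow_mul,
          ← ENNReal.rpow_mul]
        ring
    _ = _ := by
        rw [← split m, ← two_rpow_add]
        congr 3
        · field_simp; ring
        · field_simp

lemma dyadic_exponent_cases {κ x y : ℝ} (hκ : 1 / 4 ≤ κ) :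
    -(2 * κ) * (x + y) ≤ -(|x| + |y|) / 10 ∨ x + y / 2 ≤ -(|x| + |y|) / 10 ∨
      y + x / 2 ≤ -(|x| + |y|) / 10 := by
  by_contra! h
  obtain ⟨h0, h1, h2⟩ := h
  have h0' : 0 ≤ x + y → -(x + y) / 2 > -(|x| + |y|) / 10 := fun hxy => by nlinarith
  rcases abs_cases x with ⟨hx, hx'⟩ | ⟨hx, hx'⟩ <;> rcases abs_cases y with ⟨hy, hy'⟩ | ⟨hy, hy'⟩ <;>
    rw [hx, hy] at h1 h2 h0' <;>
    rcases le_total 0 (x + y) with hxy | hxy <;>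
    first
      | (have := h0' hxy; linarith)
      | linarith

/-- Weights measuring the off-diagonal decay of the dyadic pieces. -/
noncomputable def dyadicWeight (x : ℤ) : ℝ≥0∞ := 2 ^ (-|(x : ℝ)| / 20)

lemma tsum_dyadicWeight_ne_top : ∑' x, dyadicWeight x ≠ ⊤ := by
  set r : ℝ≥0∞ := 2 ^ (-(1 / 20) : ℝ) with hr
  have hr1 : r < 1 := ENNReal.rpow_lt_one_of_one_lt_of_neg (by norm_num) (by norm_num)
  have hgeo : ∑' k : ℕ, r ^ k ≠ ⊤ := by
    rw [ENNReal.tsum_geometric]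
    simp [tsub_eq_zero_iff_le, hr1]
  have h1 : ∀ k : ℕ, dyadicWeight k = r ^ k := fun k => by
    rw [dyadicWeight, hr, two_rpow_pow]; congr 1; simp; ring
  have h2 : ∀ k : ℕ, dyadicWeight (-(k + 1 : ℤ)) ≤ r ^ k := fun k => by
    rw [dyadicWeight, hr, two_rpow_pow]
    apply two_rpow_le
    push_cast
    rw [abs_neg, abs_of_nonneg (by positivity)]
    linarith
  rw [tsum_of_nat_of_neg_add_one ENNReal.summable ENNReal.summable]
  refine ENNReal.add_ne_top.2 ⟨by simpa only [h1], ne_top_of_le_ne_top hgeo ?_⟩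
  exact ENNReal.tsum_le_tsum h2

lemma tsum_dyadicWeight_sub_left (l : ℤ) : ∑' j, dyadicWeight (j - l) = ∑' x, dyadicWeight x :=
  (Equiv.subRight l).tsum_eq dyadicWeight

lemma tsum_dyadicWeight_sub_right (j : ℤ) : ∑' l, dyadicWeight (j - l) = ∑' x, dyadicWeight x :=
  (Equiv.subLeft j).tsum_eq dyadicWeight

variable {X : Type*} [MeasurableSpace X] {μ : Measure X}

lemma SqIntegrable.add {ν : Measure ℝ} [SFinite ν] {F G : ℝ → X → ℂ} (hF : SqIntegrable ν μ F)
    (hG : SqIntegrable ν μ G) : SqIntegrable ν μ fun t ξ => F t ξ + G t ξ := by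
  refine ⟨hF.meas.add hG.meas, ?_⟩
  have hm := hF.measurable_lintegral
  have hm' := hG.measurable_lintegral
  calc _ ≤ ∫⁻ ξ, 4 * ((∫⁻ s, ‖F s ξ‖ₑ ∂ν) ^ 2 + (∫⁻ s, ‖G s ξ‖ₑ ∂ν) ^ 2) ∂μ := by
        refine lintegral_mono fun ξ => ?_
        have h1 : ∫⁻ s, ‖F s ξ + G s ξ‖ₑ ∂ν ≤ (∫⁻ s, ‖F s ξ‖ₑ ∂ν) + ∫⁻ s, ‖G s ξ‖ₑ ∂ν := by
          have : Measurable fun s => ‖F s ξ‖ₑ := (hF.meas.comp measurable_prodMk_right).enorm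
          rw [← lintegral_add_left this]
          exact lintegral_mono fun _ => enorm_add_le _ _
        refine (pow_le_pow_left' h1 2).trans ?_
        rcases le_total (∫⁻ s, ‖F s ξ‖ₑ ∂ν) (∫⁻ s, ‖G s ξ‖ₑ ∂ν) with h | h
        · calc _ ≤ (2 * ∫⁻ s, ‖G s ξ‖ₑ ∂ν) ^ 2 := by rw [two_mul]; gcongr
            _ = 4 * (∫⁻ s, ‖G s ξ‖ₑ ∂ν) ^ 2 := by ring
            _ ≤ _ := by gcongr; exact le_add_self
        · calc _ ≤ (2 * ∫⁻ s, ‖F s ξ‖ₑ ∂ν) ^ 2 := by rw [two_mul]; gcongr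
            _ = 4 * (∫⁻ s, ‖F s ξ‖ₑ ∂ν) ^ 2 := by ring
            _ ≤ _ := by gcongr; exact le_self_add
    _ < ⊤ := by
        rw [lintegral_const_mul _ (by fun_prop), lintegral_add_left (by fun_prop)]
        exact ENNReal.mul_lt_top (by simp) (ENNReal.add_lt_top.2 ⟨hF.fin, hG.fin⟩)

lemma SqIntegrable.finset_sum {ν : Measure ℝ} [SFinite ν] {W : ℤ → ℝ → X → ℂ}
    (hW : ∀ l, SqIntegrable ν μ (W l)) (Λ : Finset ℤ) :
    SqIntegrable ν μ fun t ξ => ∑ l ∈ Λ, W l t ξ := by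
  classical
  induction Λ using Finset.induction_on with
  | empty => exact ⟨by simp [Function.uncurry_def], by simp⟩
  | insert l Λ hl ih =>
    simp only [Finset.sum_insert hl]
    exact (hW l).add ih

variable [SFinite μ]

/-- Bilinear dyadic summation: energy and dispersive bounds for the pieces `W l` sum to an
`L²` bound. -/
theorem lintegral_sq_integral_sum_le {n : ℕ} (hn : 3 ≤ n) (Λ : Finset ℤ) {W : ℤ → ℝ → X → ℂ}
    {A : ℤ → ℝ → ℝ≥0∞} (hW : ∀ l, SqIntegrable volume μ (W l)) (hA : ∀ l, Measurable (A l))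
    (hAt : ∀ l t, A l t ≠ ⊤)
    (hE : ∀ l t, ∫⁻ ξ, ‖W l t ξ‖ₑ ^ 2 ∂μ ≤ 2 ^ (-(l : ℝ)) * A l t ^ 2)
    (hD : ∀ l m t s, t ≠ s → ‖timePairing μ (W l) (W m) (t, s)‖ₑ ≤
      ‖t - s‖ₑ ^ (-(n / 2) : ℝ) * (2 ^ (((l : ℝ) + m) * ((n - 2) / 4)) * (A l t * A m s))) :
    ∫⁻ ξ, ‖∫ t, ∑ l ∈ Λ, W l t ξ‖ₑ ^ 2 ∂μ ≤
      12 * (∑' x, dyadicWeight x) ^ 2 * ∑ l ∈ Λ, ∫⁻ t, A l t ^ 2 := by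
  have hn0 : (3 : ℝ) ≤ n := by exact_mod_cast hn
  set α : ℤ → ℝ≥0∞ := fun l => ∫⁻ t, A l t ^ 2 with hα
  set K := ∑' x, dyadicWeight x with hK
  have hWm : ∀ l t, Measurable (W l t) := fun l t => (hW l).meas.comp measurable_prodMk_left
  have hdiag : ∀ l s s', s ≠ s' → ‖timePairing μ (W l) (W l) (s, s')‖ₑ ≤
      2 ^ (-(l : ℝ) / 2) * (‖s - s'‖ₑ ^ (-(1 / 2) : ℝ) * (A l s * A l s')) := by
    intro l s s' hs
    refine le_of_energy_of_dispersive hn ?_ (hD l l s s' hs)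
    have h := (enorm_integral_mul_conj_sq_le (μ := μ) (hWm l s) (hWm l s')).trans
      (mul_le_mul' (hE l s) (hE l s'))
    refine (ENNReal.pow_le_pow_left_iff two_ne_zero).1 (h.trans (le_of_eq ?_))
    ring
  have hpiece : ∀ l m j, ‖∫ z in dyadicShell j, timePairing μ (W l) (W m) z‖ₑ ^ 2 ≤
      32 * 2 ^ (-(|((j - l : ℤ) : ℝ)| + |((j - m : ℤ) : ℝ)|) / 10) * (α l * α m) := by
    intro l m j
    have hκ : (1 / 4 : ℝ) ≤ (n - 2) / 4 := by linarith
    rcases dyadic_exponent_cases (x := ((j - l : ℤ) : ℝ)) (y := ((j - m : ℤ) : ℝ)) hκ with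
      h | h | h
    · refine (enorm_sq_setIntegral_timePairing_le_of_dispersive (F := W l) (G := W m) j
        (hA l) (hA m) (c := 2 ^ (-((j : ℝ) * (n / 2))) * 2 ^ (((l : ℝ) + m) * ((n - 2) / 4)))
        fun z hz => ?_).trans ?_
      · have hne : z.1 ≠ z.2 := by
          have : z ∈ ⋃ j, dyadicShell j := Set.mem_iUnion.2 ⟨j, hz⟩
          rwa [iUnion_dyadicShell] at this
        refine (hD l m z.1 z.2 hne).trans ?_
        rw [mul_assoc]
        gcongr
        rw [ENNReal.rpow_neg, ENNReal.rpow_neg, ENNReal.inv_le_inv, ENNReal.rpow_mul]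
        exact ENNReal.rpow_le_rpow hz.1 (by positivity)
      · refine mul_le_mul_left ?_ _
        rw [show ((2 : ℝ≥0∞) ^ (-((j : ℝ) * (n / 2))) * 2 ^ (((l : ℝ) + m) * ((n - 2) / 4)) *
          (4 * 2 ^ (j : ℝ))) ^ 2 = 16 * (2 ^ (-((j : ℝ) * (n / 2))) *
            2 ^ (((l : ℝ) + m) * ((n - 2) / 4)) * 2 ^ (j : ℝ)) ^ 2 by ring,
          ← two_rpow_add, ← two_rpow_add, two_rpow_pow]
        refine mul_le_mul' (by norm_num) (two_rpow_le (le_trans (le_of_eq ?_) h))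
        push_cast
        ring
    · refine (enorm_sq_setIntegral_timePairing_le_of_energy (hW l) (hW m) j (hA l) (hA m)
        (two_rpow_ne_top _) (hAt l) (hE l) (hdiag m)).trans ?_
      refine mul_le_mul_left ?_ _
      rw [mul_left_comm, ← two_rpow_add, ← two_rpow_add]
      refine mul_le_mul' le_rfl (two_rpow_le (le_trans (le_of_eq ?_) h))
      push_cast
      ring
    · rw [enorm_setIntegral_timePairing_symm]
      refine (enorm_sq_setIntegral_timePairing_le_of_energy (hW m) (hW l) j (hA m) (hA l)
        (two_rpow_ne_top _) (hAt m) (hE m) (hdiag l)).trans ?_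
      rw [mul_comm (∫⁻ t, A m t ^ 2)]
      refine mul_le_mul_left ?_ _
      rw [mul_left_comm, ← two_rpow_add, ← two_rpow_add]
      refine mul_le_mul' le_rfl (two_rpow_le (le_trans (le_of_eq ?_) h))
      push_cast
      ring
  have hpiece' : ∀ l m j, ‖∫ z in dyadicShell j, timePairing μ (W l) (W m) z‖ₑ ≤
      6 * (dyadicWeight (j - l) * dyadicWeight (j - m) * (α l + α m)) := by
    intro l m j
    refine (ENNReal.pow_le_pow_left_iff two_ne_zero).1 ((hpiece l m j).trans ?_)
    rw [mul_pow, mul_pow, mul_pow, dyadicWeight, dyadicWeight, two_rpow_pow, two_rpow_pow,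
      ← two_rpow_add, ← mul_assoc ((6 : ℝ≥0∞) ^ 2)]
    refine mul_le_mul' (mul_le_mul' (by norm_num) (two_rpow_le (le_of_eq ?_))) ?_
    · push_cast; ring
    · rw [sq]; exact mul_le_mul' le_self_add le_add_self
  have hlm : ∀ l m, ‖∫ z, timePairing μ (W l) (W m) z‖ₑ ≤
      6 * ∑' j, dyadicWeight (j - l) * dyadicWeight (j - m) * (α l + α m) := by
    intro l m
    rw [← ENNReal.tsum_mul_left]
    exact (enorm_integral_le_tsum_dyadicShell (integrable_timePairing (hW l) (hW m))).trans
      (ENNReal.tsum_le_tsum fun j => hpiece' l m j)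
  have hsum : ∀ᵐ z : ℝ × ℝ, timePairing μ (fun t ξ => ∑ l ∈ Λ, W l t ξ)
      (fun t ξ => ∑ l ∈ Λ, W l t ξ) z = ∑ l ∈ Λ, ∑ m ∈ Λ, timePairing μ (W l) (W m) z := by
    have : ∀ᵐ z : ℝ × ℝ, ∀ l m, Integrable (fun ξ => W l z.1 ξ * conj (W m z.2 ξ)) μ :=
      ae_all_iff.2 fun l => ae_all_iff.2 fun m => ((hW l).integrable_pair (hW m)).prod_right_ae
    filter_upwards [this] with z hz
    simp only [timePairing, map_sum, Finset.sum_mul_sum]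
    rw [integral_finsetSum _ fun l _ => integrable_finsetSum _ fun m _ => hz l m]
    refine Finset.sum_congr rfl fun l _ => ?_
    rw [integral_finsetSum _ fun m _ => hz l m]
  refine (SqIntegrable.finset_sum hW Λ).lintegral_sq_integral_le.trans ?_
  change ‖∫ z, timePairing μ (fun t ξ => ∑ l ∈ Λ, W l t ξ)
    (fun t ξ => ∑ l ∈ Λ, W l t ξ) z‖ₑ ≤ _
  rw [integral_congr_ae hsum, integral_finsetSum _ fun l _ => integrable_finsetSum _ fun m _ =>
    integrable_timePairing (hW l) (hW m)]
  have hbound : ‖∑ l ∈ Λ, ∫ z, ∑ m ∈ Λ, timePairing μ (W l) (W m) z‖ₑ ≤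
      ∑ l ∈ Λ, ∑ m ∈ Λ, 6 * ∑' j, dyadicWeight (j - l) * dyadicWeight (j - m) * (α l + α m) := by
    refine (enorm_sum_le _ _).trans (Finset.sum_le_sum fun l _ => ?_)
    rw [integral_finsetSum _ fun m _ => integrable_timePairing (hW l) (hW m)]
    exact (enorm_sum_le _ _).trans (Finset.sum_le_sum fun m _ => hlm l m)
  refine hbound.trans ?_
  have hhalf : ∀ l, ∑ m ∈ Λ, ∑' j, dyadicWeight (j - l) * dyadicWeight (j - m) ≤ K ^ 2 := by
    intro l
    calc _ ≤ ∑' m, ∑' j, dyadicWeight (j - l) * dyadicWeight (j - m) := ENNReal.sum_le_tsum _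
      _ = ∑' j, dyadicWeight (j - l) * ∑' m, dyadicWeight (j - m) := by
          rw [ENNReal.tsum_comm]; simp_rw [ENNReal.tsum_mul_left]
      _ = K ^ 2 := by
          simp_rw [tsum_dyadicWeight_sub_right, ENNReal.tsum_mul_right,
            tsum_dyadicWeight_sub_left, ← hK, sq]
  have hcomm : ∀ l m, ∑' j, dyadicWeight (j - l) * dyadicWeight (j - m) =
      ∑' j, dyadicWeight (j - m) * dyadicWeight (j - l) := fun l m => by simp_rw [mul_comm]
  have hA1 : ∑ l ∈ Λ, ∑ m ∈ Λ, (∑' j, dyadicWeight (j - l) * dyadicWeight (j - m)) * α l ≤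
      K ^ 2 * ∑ l ∈ Λ, α l := by
    rw [Finset.mul_sum]
    refine Finset.sum_le_sum fun l _ => ?_
    rw [← Finset.sum_mul]
    gcongr
    exact hhalf l
  have hA2 : ∑ l ∈ Λ, ∑ m ∈ Λ, (∑' j, dyadicWeight (j - l) * dyadicWeight (j - m)) * α m ≤
      K ^ 2 * ∑ l ∈ Λ, α l := by
    rw [Finset.sum_comm]
    simp_rw [fun l m => hcomm l m]
    exact hA1
  simp_rw [ENNReal.tsum_mul_right, mul_add, Finset.sum_add_distrib, ← Finset.mul_sum]
  calc _ ≤ 6 * (K ^ 2 * ∑ l ∈ Λ, α l) + 6 * (K ^ 2 * ∑ l ∈ Λ, α l) := by gcongr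
    _ = _ := by ring

end DyadicSummation

section Atoms

variable {Y : Type*} [MeasurableSpace Y] (ν : Measure Y) (σ ρ : ℝ) (u : Y → ℝ≥0∞)

/-- The distribution function of `u` at dyadic heights. -/
noncomputable def dyadicDistr (k : ℤ) : ℝ≥0∞ := ν {y | (2 : ℝ≥0∞) ^ (k : ℝ) ≤ u y}

/-- The dyadic heights at which the superlevel set of `u` has measure about `2 ^ (σ l)`. -/
def atomLevels (l : ℤ) : Set ℤ :=
  {k | (2 : ℝ≥0∞) ^ (σ * l) ≤ dyadicDistr ν u k ∧ dyadicDistr ν u k < 2 ^ (σ * (l + 1))}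

/-- The support of the `l`-th atom of `u`. -/
def atomSet (l : ℤ) : Set Y :=
  {y | ∃ k ∈ atomLevels ν σ u l, (2 : ℝ≥0∞) ^ (k : ℝ) ≤ u y ∧ u y < 2 ^ (k + 1 : ℝ)}

open Classical in
/-- The `ρ`-th power of the size of the `l`-th atom of `u`. -/
noncomputable def atomMass (l : ℤ) : ℝ≥0∞ :=
  ∑' k : ℤ, if k ∈ atomLevels ν σ u l then 2 ^ (k * ρ : ℝ) * dyadicDistr ν u k else 0

variable {ν σ ρ u}

lemma measure_atomSet_le (l : ℤ) : ν (atomSet ν σ u l) ≤ 2 ^ (σ * (l + 1)) := by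
  have hsub : atomSet ν σ u l ⊆
      ⋃ k ∈ atomLevels ν σ u l, {y | (2 : ℝ≥0∞) ^ (k : ℝ) ≤ u y} := by
    rintro y ⟨k, hk, hy, -⟩
    exact Set.mem_biUnion hk hy
  refine (measure_mono hsub).trans ?_
  rw [measure_biUnion_eq_iSup (Set.to_countable _)]
  · exact iSup₂_le fun k hk => hk.2.le
  · intro k hk k' hk'
    rcases le_total k k' with h | h
    · exact ⟨k, hk, le_rfl, fun y hy => (two_rpow_le (by exact_mod_cast h)).trans hy⟩
    · exact ⟨k', hk', fun y hy => (two_rpow_le (by exact_mod_cast h)).trans hy, le_rfl⟩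

lemma le_of_mem_atomSet (hρ : 0 < ρ) {l : ℤ} {y : Y} (hy : y ∈ atomSet ν σ u l) :
    u y ≤ 2 * (2 ^ (-(σ * l / ρ)) * atomMass ν σ ρ u l ^ (1 / ρ)) := by
  classical
  obtain ⟨k, hk, -, hy⟩ := hy
  have h1 : (2 : ℝ≥0∞) ^ (k * ρ : ℝ) * 2 ^ (σ * l) ≤ atomMass ν σ ρ u l :=
    calc _ ≤ (2 : ℝ≥0∞) ^ (k * ρ : ℝ) * dyadicDistr ν u k := by gcongr; exact hk.1
      _ = if k ∈ atomLevels ν σ u l then 2 ^ (k * ρ : ℝ) * dyadicDistr ν u k else 0 := by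
          rw [if_pos hk]
      _ ≤ _ := ENNReal.le_tsum (f := fun k : ℤ => if k ∈ atomLevels ν σ u l then
          (2 : ℝ≥0∞) ^ (k * ρ : ℝ) * dyadicDistr ν u k else 0) k
  have h2 : (2 : ℝ≥0∞) ^ (k + σ * l / ρ : ℝ) ≤ atomMass ν σ ρ u l ^ (1 / ρ) := by
    refine le_trans (le_of_eq ?_) (ENNReal.rpow_le_rpow h1 (by positivity : 0 ≤ 1 / ρ))
    rw [← two_rpow_add, ← ENNReal.rpow_mul]
    congr 1
    field_simp
  calc u y ≤ 2 ^ (k + 1 : ℝ) := hy.le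
    _ = 2 * (2 ^ (-(σ * l / ρ)) * 2 ^ (k + σ * l / ρ : ℝ)) := by
        rw [← two_rpow_add, two_rpow_add, ENNReal.rpow_one, mul_comm]
        congr 2
        ring
    _ ≤ _ := by gcongr

lemma eq_of_mem_dyadic {v : ℝ≥0∞} {σ : ℝ} (hσ : 0 < σ) {k k' : ℤ}
    (h : (2 : ℝ≥0∞) ^ (σ * k) ≤ v) (h1 : v < 2 ^ (σ * (k + 1)))
    (h' : (2 : ℝ≥0∞) ^ (σ * k') ≤ v) (h1' : v < 2 ^ (σ * (k' + 1))) : k = k' := by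
  have key : ∀ {a b : ℤ}, (2 : ℝ≥0∞) ^ (σ * a) ≤ v → v < 2 ^ (σ * (b + 1)) → a ≤ b := by
    intro a b ha hb
    by_contra! hab
    have hab' : (b : ℝ) + 1 ≤ a := by exact_mod_cast hab
    exact absurd hb (not_lt.2 ((two_rpow_le (by gcongr)).trans ha))
  exact le_antisymm (key h h1') (key h' h1)

lemma exists_mem_dyadic {v : ℝ≥0∞} {σ : ℝ} (hσ : 0 < σ) (h0 : v ≠ 0) (h1 : v ≠ ⊤) :
    ∃ k : ℤ, (2 : ℝ≥0∞) ^ (σ * k) ≤ v ∧ v < 2 ^ (σ * (k + 1)) := by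
  obtain ⟨k, hk⟩ := ENNReal.exists_mem_Ico_zpow (y := 2 ^ σ) h0 h1
    (ENNReal.one_lt_rpow (by norm_num) hσ) (two_rpow_ne_top σ)
  refine ⟨k, ?_⟩
  rw [← ENNReal.rpow_intCast, ← ENNReal.rpow_intCast, ← ENNReal.rpow_mul, ← ENNReal.rpow_mul] at hk
  simpa using hk

lemma eq_of_mem_atomSet (hσ : 0 < σ) {l l' : ℤ} {y : Y} (h : y ∈ atomSet ν σ u l)
    (h' : y ∈ atomSet ν σ u l') : l = l' := by
  obtain ⟨k, hk, h1, h2⟩ := h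
  obtain ⟨k', hk', h1', h2'⟩ := h'
  have : k = k' := eq_of_mem_dyadic (σ := 1) one_pos (by simpa using h1) (by simpa using h2)
    (by simpa using h1') (by simpa using h2')
  subst this
  exact eq_of_mem_dyadic hσ hk.1 hk.2 hk'.1 hk'.2

lemma tsum_two_rpow_le (hρ : 1 ≤ ρ) (v : ℝ≥0∞) :
    ∑' k : ℤ, (2 : ℝ≥0∞) ^ (k * ρ : ℝ) * (Set.Ici ((2 : ℝ≥0∞) ^ (k : ℝ))).indicator 1 v ≤
      2 * v ^ ρ := by
  have hρ0 : 0 < ρ := by linarith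
  rcases eq_or_ne v 0 with rfl | h0
  · refine le_of_eq_of_le (ENNReal.tsum_eq_zero.2 fun k => ?_) zero_le
    rw [Set.indicator_of_notMem, mul_zero]
    simpa using (ENNReal.rpow_pos (p := (k : ℝ)) two_pos (by simp)).ne'
  rcases eq_or_ne v ⊤ with rfl | h1
  · simp [ENNReal.top_rpow_of_pos hρ0]
  obtain ⟨K, hK, hK'⟩ := exists_mem_dyadic one_pos h0 h1
  rw [one_mul] at hK hK'
  rw [← (Equiv.subLeft K).tsum_eq, tsum_of_nat_of_neg_add_one ENNReal.summable ENNReal.summable]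
  have hneg : ∀ i : ℕ, (Set.Ici ((2 : ℝ≥0∞) ^ (((Equiv.subLeft K) (-((i : ℤ) + 1)) : ℤ) : ℝ))).indicator
      (1 : ℝ≥0∞ → ℝ≥0∞) v = 0 := fun i => by
    refine Set.indicator_of_notMem (fun h => ?_) _
    refine absurd hK' (not_lt.2 ((two_rpow_le ?_).trans h))
    simp only [Equiv.subLeft_apply]
    push_cast
    have : (0 : ℝ) ≤ i := i.cast_nonneg
    linarith
  simp only [hneg, mul_zero, tsum_zero, add_zero]
  calc _ ≤ ∑' i : ℕ, v ^ ρ * (2⁻¹ : ℝ≥0∞) ^ i := by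
        refine ENNReal.tsum_le_tsum fun i => ?_
        have hle : (Set.Ici ((2 : ℝ≥0∞) ^ (((Equiv.subLeft K) (i : ℤ) : ℤ) : ℝ))).indicator
            (1 : ℝ≥0∞ → ℝ≥0∞) v ≤ 1 :=
          Set.indicator_apply_le' (fun _ => le_rfl) fun _ => zero_le_one
        refine (mul_le_mul' le_rfl hle).trans ?_
        rw [mul_one]
        have : (2⁻¹ : ℝ≥0∞) ^ i = 2 ^ (-(i : ℝ)) := by
          rw [ENNReal.rpow_neg, ENNReal.rpow_natCast, ENNReal.inv_pow]
        rw [this]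
        calc (2 : ℝ≥0∞) ^ ((((Equiv.subLeft K) (i : ℤ) : ℤ) : ℝ) * ρ)
            ≤ 2 ^ (K * ρ + -(i : ℝ)) := by
              apply two_rpow_le
              simp only [Equiv.subLeft_apply]
              push_cast
              nlinarith [(Nat.cast_nonneg i : (0 : ℝ) ≤ i)]
          _ ≤ _ := by
              rw [two_rpow_add, ENNReal.rpow_mul]
              gcongr
    _ = 2 * v ^ ρ := by
        rw [ENNReal.tsum_mul_left, ENNReal.tsum_geometric, mul_comm]
        simp

lemma tsum_atomMass_le (hσ : 0 < σ) (hρ : 1 ≤ ρ) (hu : Measurable u) :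
    ∑' l, atomMass ν σ ρ u l ≤ 2 * ∫⁻ y, u y ^ ρ ∂ν := by
  classical
  simp only [atomMass]
  rw [ENNReal.tsum_comm]
  have hS : ∀ k : ℤ, MeasurableSet {y | (2 : ℝ≥0∞) ^ (k : ℝ) ≤ u y} :=
    fun k => measurableSet_le measurable_const hu
  calc _ ≤ ∑' k : ℤ, (2 : ℝ≥0∞) ^ (k * ρ : ℝ) * dyadicDistr ν u k := by
        refine ENNReal.tsum_le_tsum fun k => ?_
        by_cases h : ∃ l, k ∈ atomLevels ν σ u l
        · obtain ⟨l, hl⟩ := h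
          rw [tsum_eq_single l, if_pos hl]
          intro l' hl'
          rw [if_neg]
          exact fun h' => hl' (eq_of_mem_dyadic hσ h'.1 h'.2 hl.1 hl.2)
        · push Not at h
          simp [h]
    _ = ∫⁻ y, ∑' k : ℤ, (2 : ℝ≥0∞) ^ (k * ρ : ℝ) *
        (Set.Ici ((2 : ℝ≥0∞) ^ (k : ℝ))).indicator 1 (u y) ∂ν := by
        rw [lintegral_tsum]
        · congr 1 with k
          rw [lintegral_const_mul, dyadicDistr]
          · congr 1
            exact (lintegral_indicator_one (hS k)).symm
          · exact (measurable_one.indicator measurableSet_Ici).comp hu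
        · exact fun k => (((measurable_one.indicator measurableSet_Ici).comp hu).const_mul _).aemeasurable
    _ ≤ ∫⁻ y, 2 * u y ^ ρ ∂ν := lintegral_mono fun y => tsum_two_rpow_le hρ _
    _ = _ := by rw [lintegral_const_mul _ (by fun_prop)]

lemma dyadicDistr_ne_top (hρ : 0 < ρ) (hu : Measurable u) (hfin : ∫⁻ y, u y ^ ρ ∂ν ≠ ⊤) (k : ℤ) :
    dyadicDistr ν u k ≠ ⊤ := by
  have h := mul_meas_ge_le_lintegral (μ := ν) (hu.pow_const ρ) ((2 : ℝ≥0∞) ^ (k * ρ : ℝ))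
  have hsub : dyadicDistr ν u k ≤ ν {y | (2 : ℝ≥0∞) ^ (k * ρ : ℝ) ≤ u y ^ ρ} := by
    refine measure_mono fun y hy => ?_
    rw [Set.mem_ofPred_eq, ENNReal.rpow_mul]
    exact ENNReal.rpow_le_rpow hy hρ.le
  intro htop
  rw [htop, top_le_iff] at hsub
  rw [hsub, ENNReal.mul_top (by simp)] at h
  exact hfin (top_le_iff.1 h)

lemma ae_exists_mem_atomSet (hσ : 0 < σ) (hρ : 0 < ρ) (hu : Measurable u) (hut : ∀ y, u y ≠ ⊤)
    (hfin : ∫⁻ y, u y ^ ρ ∂ν ≠ ⊤) : ∀ᵐ y ∂ν, u y ≠ 0 → ∃ l, y ∈ atomSet ν σ u l := by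
  have h0 : ∀ᵐ y ∂ν, ∀ k : ℤ, dyadicDistr ν u k = 0 → ¬ (2 : ℝ≥0∞) ^ (k : ℝ) ≤ u y := by
    rw [ae_all_iff]
    intro k
    by_cases hk : dyadicDistr ν u k = 0
    · filter_upwards [measure_eq_zero_iff_ae_notMem.1 hk] with y hy _
      exact hy
    · exact Filter.Eventually.of_forall fun y h => absurd h hk
  filter_upwards [h0] with y hy hy0
  obtain ⟨k, hk, hk'⟩ := exists_mem_dyadic one_pos hy0 (hut y)
  rw [one_mul] at hk hk'
  obtain ⟨l, hl⟩ := exists_mem_dyadic hσ (fun h => hy k h hk) (dyadicDistr_ne_top hρ hu hfin k)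
  exact ⟨l, k, hl, hk, hk'⟩

lemma measurable_dyadicDistr [SFinite ν] {u : ℝ → Y → ℝ≥0∞} (hu : Measurable (Function.uncurry u)) (k : ℤ) :
    Measurable fun t => dyadicDistr ν (u t) k :=
  measurable_measure_prodMk_left (s := {z : ℝ × Y | (2 : ℝ≥0∞) ^ (k : ℝ) ≤ Function.uncurry u z})
    (measurableSet_le measurable_const hu)

lemma measurableSet_mem_atomLevels [SFinite ν] {u : ℝ → Y → ℝ≥0∞}
    (hu : Measurable (Function.uncurry u)) (l k : ℤ) :
    MeasurableSet {t | k ∈ atomLevels ν σ (u t) l} :=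
  (measurableSet_le measurable_const (measurable_dyadicDistr hu k)).inter
    (measurableSet_lt (measurable_dyadicDistr hu k) measurable_const)

lemma measurable_atomMass [SFinite ν] {u : ℝ → Y → ℝ≥0∞} (hu : Measurable (Function.uncurry u))
    (l : ℤ) : Measurable fun t => atomMass ν σ ρ (u t) l := by
  classical
  refine Measurable.tsum fun k => ?_
  exact Measurable.ite (measurableSet_mem_atomLevels hu l k)
    ((measurable_dyadicDistr hu k).const_mul _) measurable_const

lemma measurableSet_atomSet_prod [SFinite ν] {u : ℝ → Y → ℝ≥0∞}
    (hu : Measurable (Function.uncurry u)) (l : ℤ) :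
    MeasurableSet {z : ℝ × Y | z.2 ∈ atomSet ν σ (u z.1) l} := by
  have : {z : ℝ × Y | z.2 ∈ atomSet ν σ (u z.1) l} = ⋃ k : ℤ,
      (Prod.fst ⁻¹' {t | k ∈ atomLevels ν σ (u t) l}) ∩
        {z | (2 : ℝ≥0∞) ^ (k : ℝ) ≤ Function.uncurry u z ∧
          Function.uncurry u z < 2 ^ (k + 1 : ℝ)} := by
    ext z
    simp [atomSet, Function.uncurry]
  rw [this]
  exact MeasurableSet.iUnion fun k => (measurable_fst (measurableSet_mem_atomLevels hu l k)).inter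
    ((measurableSet_le measurable_const hu).inter (measurableSet_lt hu measurable_const))

end Atoms

section Bilinear
open ComplexConjugate

variable {V : Type*} [NormedAddCommGroup V] [MeasurableSpace V]

/-- Bounded measurable space-time functions of bounded support. -/
structure IsTame (G : ℝ → V → ℂ) : Prop where
  meas : Measurable (Function.uncurry G)
  bdd : ∃ N : NNReal, ∀ t x, ‖G t x‖ ≤ N ∧ (G t x ≠ 0 → ‖t‖ ≤ N ∧ ‖x‖ ≤ N)

namespace IsTame

variable {G : ℝ → V → ℂ}

lemma measurable_section (hG : IsTame G) (t : ℝ) : Measurable (G t) :=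
  hG.meas.comp measurable_prodMk_left

lemma indicator (hG : IsTame G) {S : ℝ → Set V} (hS : MeasurableSet {z : ℝ × V | z.2 ∈ S z.1}) :
    IsTame fun t => (S t).indicator (G t) := by
  classical
  refine ⟨?_, ?_⟩
  · convert hG.meas.indicator hS using 1
    ext z
    simp [Set.indicator, Function.uncurry]
  · obtain ⟨N, hN⟩ := hG.bdd
    refine ⟨N, fun t x => ?_⟩
    by_cases hx : x ∈ S t
    · simpa [hx] using hN t x
    · simp [hx]

variable [InnerProductSpace ℝ V] [FiniteDimensional ℝ V] [BorelSpace V]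

lemma exists_lintegral_rpow_le (hG : IsTame G) {p : ℝ} (hp : 0 < p) :
    ∃ c : ℝ≥0∞, c ≠ ⊤ ∧ ∃ N : ℝ, ∀ t, ∫⁻ x, ‖G t x‖ₑ ^ p ≤
      (Metric.closedBall (0 : ℝ) N).indicator (fun _ => c) t := by
  obtain ⟨N, hN⟩ := hG.bdd
  refine ⟨(N : ℝ≥0∞) ^ p * volume (Metric.closedBall (0 : V) N),
    ENNReal.mul_ne_top (by simp [hp.le]) measure_closedBall_lt_top.ne, N, fun t => ?_⟩
  by_cases ht : t ∈ Metric.closedBall (0 : ℝ) N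
  · rw [Set.indicator_of_mem ht, ← lintegral_indicator_const Metric.isClosed_closedBall.measurableSet]
    refine lintegral_mono fun x => ?_
    by_cases hx : x ∈ Metric.closedBall (0 : V) N
    · rw [Set.indicator_of_mem hx]
      refine ENNReal.rpow_le_rpow ?_ hp.le
      rw [← ofReal_norm, ← ENNReal.ofReal_coe_nnreal]
      exact ENNReal.ofReal_le_ofReal (hN t x).1
    · have : G t x = 0 := by
        by_contra h
        exact hx (by simpa using ((hN t x).2 h).2)
      simp [this, hp]
  · have : ∀ x, G t x = 0 := fun x => by
      by_contra h
      exact ht (by simpa using ((hN t x).2 h).1)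
    simp [this, hp]

lemma lintegral_rpow_ne_top (hG : IsTame G) {p : ℝ} (hp : 0 < p) (t : ℝ) :
    ∫⁻ x, ‖G t x‖ₑ ^ p ≠ ⊤ := by
  obtain ⟨c, hc, N, h⟩ := hG.exists_lintegral_rpow_le hp
  exact ne_top_of_le_ne_top hc ((h t).trans (Set.indicator_le_self' (fun _ _ => zero_le) t))

lemma integrable_section (hG : IsTame G) (t : ℝ) : Integrable (G t) := by
  refine ⟨(hG.measurable_section t).aestronglyMeasurable, ?_⟩
  simpa [hasFiniteIntegral_iff_enorm] using (hG.lintegral_rpow_ne_top one_pos t).lt_top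

lemma memLp_section (hG : IsTame G) (t : ℝ) : MemLp (G t) 2 := by
  refine ⟨(hG.measurable_section t).aestronglyMeasurable, ?_⟩
  have h := (hG.lintegral_rpow_ne_top two_pos t).lt_top
  simp only [ENNReal.rpow_two] at h
  rw [← eLpNorm_two_sq] at h
  exact (ENNReal.pow_lt_top_iff.1 h).resolve_right two_ne_zero

lemma integrable (hG : IsTame G) : Integrable (Function.uncurry G) := by
  refine ⟨hG.meas.aestronglyMeasurable, ?_⟩
  obtain ⟨c, hc, N, h⟩ := hG.exists_lintegral_rpow_le one_pos
  rw [hasFiniteIntegral_iff_enorm, Measure.volume_eq_prod, lintegral_prod _ hG.meas.enorm.aemeasurable]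
  simp only [ENNReal.rpow_one] at h
  refine (lintegral_mono h).trans_lt ?_
  rw [lintegral_indicator_const Metric.isClosed_closedBall.measurableSet]
  exact ENNReal.mul_lt_top hc.lt_top measure_closedBall_lt_top

end IsTame

variable [InnerProductSpace ℝ V] [FiniteDimensional ℝ V] [BorelSpace V]

/-- The profile `e^{-itΔ} G(t)` on the Fourier side. -/
noncomputable def fourierProfile (G : ℝ → V → ℂ) (t : ℝ) (ξ : V) : ℂ :=
  Complex.exp (Complex.I * (4 * Real.pi ^ 2 * t : ℝ) * (‖ξ‖ : ℂ) ^ 2) * 𝓕 (G t) ξ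

lemma norm_exp_I_mul_mul_sq (a b : ℝ) : ‖Complex.exp (Complex.I * (a : ℂ) * (b : ℂ) ^ 2)‖ = 1 := by
  rw [show Complex.I * (a : ℂ) * (b : ℂ) ^ 2 = ((a * b ^ 2 : ℝ) : ℂ) * Complex.I by push_cast; ring]
  exact Complex.norm_exp_ofReal_mul_I _

lemma enorm_fourierProfile (G : ℝ → V → ℂ) (t : ℝ) (ξ : V) :
    ‖fourierProfile G t ξ‖ₑ = ‖𝓕 (G t) ξ‖ₑ := by
  rw [fourierProfile, enorm_mul, ← ofReal_norm, norm_exp_I_mul_mul_sq]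
  simp

lemma IsTame.measurable_fourierProfile {G : ℝ → V → ℂ} (hG : IsTame G) :
    Measurable (Function.uncurry (fourierProfile G)) := by
  have h1 : StronglyMeasurable fun z : ℝ × V => ∫ x, Complex.exp (↑(-2 * Real.pi * inner ℝ x z.2) *
      Complex.I) • G z.1 x := by
    refine StronglyMeasurable.integral_prod_right' (f := fun w : (ℝ × V) × V =>
      Complex.exp (↑(-2 * Real.pi * inner ℝ w.2 w.1.2) * Complex.I) • G w.1.1 w.2) ?_
    simp only [smul_eq_mul]
    refine Measurable.stronglyMeasurable ?_
    refine Measurable.mul ?_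
      (hG.meas.comp (by fun_prop : Measurable fun w : (ℝ × V) × V => (w.1.1, w.2)))
    exact Continuous.measurable (by fun_prop)
  have h2 : Function.uncurry (fourierProfile G) = fun z : ℝ × V =>
      Complex.exp (Complex.I * (4 * Real.pi ^ 2 * z.1 : ℝ) * (‖z.2‖ : ℂ) ^ 2) *
      ∫ x, Complex.exp (↑(-2 * Real.pi * inner ℝ x z.2) * Complex.I) • G z.1 x := by
    ext z
    simp only [Function.uncurry, fourierProfile, Real.fourier_eq']
  rw [h2]
  refine Measurable.mul ?_ h1.measurable
  exact Continuous.measurable (by fun_prop)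

lemma IsTame.sqIntegrable_fourierProfile {G : ℝ → V → ℂ} (hG : IsTame G) :
    SqIntegrable volume volume (fourierProfile G) := by
  refine ⟨hG.measurable_fourierProfile, ?_⟩
  obtain ⟨c, hc, N, h⟩ := hG.exists_lintegral_rpow_le two_pos
  set B := Metric.closedBall (0 : ℝ) N with hB
  have hBm : MeasurableSet B := Metric.isClosed_closedBall.measurableSet
  have hW := hG.measurable_fourierProfile.enorm
  have h2 : ∀ t, ∫⁻ ξ, ‖fourierProfile G t ξ‖ₑ ^ 2 = ∫⁻ x, ‖G t x‖ₑ ^ 2 := fun t => by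
    simp_rw [enorm_fourierProfile]
    exact lintegral_sq_fourier (hG.integrable_section t) (hG.memLp_section t)
  obtain ⟨N', hN'⟩ := hG.bdd
  set B' := Metric.closedBall (0 : ℝ) N' with hB'
  have hB'm : MeasurableSet B' := Metric.isClosed_closedBall.measurableSet
  have hzero : ∀ t, t ∉ B' → ∀ ξ, fourierProfile G t ξ = 0 := fun t ht ξ => by
    have : G t = 0 := by
      ext x
      by_contra hx
      exact ht (by simpa [hB'] using ((hN' t x).2 hx).1)
    simp [fourierProfile, this, Real.fourier_eq']
  calc _ ≤ ∫⁻ ξ, volume B' * ∫⁻ t, ‖fourierProfile G t ξ‖ₑ ^ 2 := by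
        refine lintegral_mono fun ξ => ?_
        have hm : Measurable fun t => ‖fourierProfile G t ξ‖ₑ :=
          (hG.measurable_fourierProfile.comp (measurable_prodMk_right (y := ξ))).enorm
        have hm1 : AEMeasurable (B'.indicator (1 : ℝ → ℝ≥0∞)) :=
          (measurable_one.indicator hB'm).aemeasurable
        have := lintegral_mul_sq_le volume hm1 hm.aemeasurable
        refine le_trans (le_of_eq ?_) (this.trans (le_of_eq ?_))
        · congr 2 with t
          by_cases ht : t ∈ B'
          · simp [ht]
          · simp [ht, hzero t ht]
        · congr 1
          rw [← lintegral_indicator_one hB'm]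
          congr 1 with t
          by_cases ht : t ∈ B' <;> simp [ht]
    _ = volume B' * ∫⁻ t, ∫⁻ x, ‖G t x‖ₑ ^ 2 := by
        rw [lintegral_const_mul, lintegral_lintegral_swap]
        · simp_rw [h2]
        · exact ((hW.comp measurable_swap).pow_const 2).aemeasurable
        · exact Measurable.lintegral_prod_left' (f := fun z : ℝ × V => ‖fourierProfile G z.1 z.2‖ₑ ^ 2)
            (hW.pow_const 2)
    _ < ⊤ := by
        refine ENNReal.mul_lt_top measure_closedBall_lt_top ?_
        simp only [ENNReal.rpow_two] at h
        refine (lintegral_mono h).trans_lt ?_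
        rw [lintegral_indicator_const hBm]
        exact ENNReal.mul_lt_top hc.lt_top measure_closedBall_lt_top

lemma IsTame.enorm_timePairing_le {G H : ℝ → V → ℂ} (hG : IsTame G) (hH : IsTame H) {n : ℕ}
    (hn : Module.finrank ℝ V = n) {t s : ℝ} (hts : t ≠ s) :
    ‖timePairing volume (fourierProfile G) (fourierProfile H) (t, s)‖ₑ ≤
      ‖t - s‖ₑ ^ (-(n / 2) : ℝ) * ((∫⁻ x, ‖G t x‖ₑ) * ∫⁻ x, ‖H s x‖ₑ) := by
  have hts' : t - s ≠ 0 := sub_ne_zero.2 hts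
  set τ : ℝ := 4 * Real.pi ^ 2 * (t - s) with hτ
  have hpi := Real.pi_pos
  have hτ0 : τ ≠ 0 := by positivity
  have h := norm_integral_oscillatory_bilin_le hτ0 (hG.integrable_section t) (hH.integrable_section s)
    (hG.memLp_section t) (hH.memLp_section s)
  have heq : timePairing volume (fourierProfile G) (fourierProfile H) (t, s) =
      ∫ ξ, Complex.exp (Complex.I * τ * (‖ξ‖ : ℂ) ^ 2) * (𝓕 (G t) ξ * conj (𝓕 (H s) ξ)) := by
    rw [timePairing]
    congr 1 with ξ
    rw [fourierProfile, fourierProfile, map_mul, ← Complex.exp_conj]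
    rw [mul_mul_mul_comm, ← Complex.exp_add]
    congr 2
    simp only [map_mul, map_pow, Complex.conj_I, Complex.conj_ofReal, hτ]
    push_cast
    ring
  rw [heq, ← ofReal_norm]
  have hint : ∀ {f : V → ℂ}, Integrable f → ENNReal.ofReal (∫ x, ‖f x‖) = ∫⁻ x, ‖f x‖ₑ := fun hf => by
    rw [ofReal_integral_eq_lintegral_ofReal hf.norm (Filter.Eventually.of_forall fun _ => norm_nonneg _)]
    simp
  rw [← hint (hG.integrable_section t), ← hint (hH.integrable_section s),
    ← ENNReal.ofReal_mul (integral_nonneg fun _ => norm_nonneg _), ← ofReal_norm,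
    ENNReal.ofReal_rpow_of_pos (norm_pos_iff.2 hts'), ← ENNReal.ofReal_mul (by positivity)]
  refine ENNReal.ofReal_le_ofReal (h.trans ?_)
  gcongr
  rw [hn, Real.rpow_neg (norm_nonneg _), ← Real.inv_rpow (norm_nonneg _)]
  refine Real.rpow_le_rpow (by positivity) ?_ (by positivity)
  rw [hτ, abs_mul, abs_of_pos (by positivity : 0 < 4 * Real.pi ^ 2), Real.norm_eq_abs,
    div_le_iff₀ (by positivity)]
  have : (0 : ℝ) < |t - s| := abs_pos.2 hts'
  rw [show |t - s|⁻¹ * (4 * Real.pi ^ 2 * |t - s|) = 4 * Real.pi ^ 2 by field_simp]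
  nlinarith [Real.pi_gt_three]

end Bilinear

section AtomicBilinear
open ComplexConjugate

lemma sum_rpow_le_rpow_sum {ι : Type*} (s : Finset ι) (a : ι → ℝ≥0∞) {p : ℝ} (hp : 1 ≤ p) :
    ∑ i ∈ s, a i ^ p ≤ (∑ i ∈ s, a i) ^ p := by
  classical
  induction s using Finset.induction_on with
  | empty => simp
  | insert i s hi ih =>
    rw [Finset.sum_insert hi, Finset.sum_insert hi]
    exact (add_le_add le_rfl ih).trans (ENNReal.add_rpow_le_rpow_add _ _ hp)

variable {V : Type*} [NormedAddCommGroup V] [MeasurableSpace V]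

/-- The dual endpoint exponent `2n/(n+2)`. -/
noncomputable def dualExp (n : ℕ) : ℝ := 2 * n / (n + 2)

lemma one_le_dualExp {n : ℕ} (hn : 3 ≤ n) : 1 ≤ dualExp n := by
  have hn0 : (3 : ℝ) ≤ n := by exact_mod_cast hn
  rw [dualExp, le_div_iff₀ (by linarith)]
  linarith

lemma dualExp_le_two {n : ℕ} : dualExp n ≤ 2 := by
  have hn0 : (0 : ℝ) ≤ n := n.cast_nonneg
  rw [dualExp, div_le_iff₀ (by linarith)]
  linarith

variable [InnerProductSpace ℝ V] [FiniteDimensional ℝ V] [BorelSpace V]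

/-- The `l`-th atom of `G(t)`. -/
noncomputable def atomPiece (n : ℕ) (G : ℝ → V → ℂ) (l : ℤ) (t : ℝ) : V → ℂ :=
  (atomSet volume (n / 2) (fun x => ‖G t x‖ₑ) l).indicator (G t)

/-- The size of the `l`-th atom of `G(t)`. -/
noncomputable def atomSize (n : ℕ) (G : ℝ → V → ℂ) (l : ℤ) (t : ℝ) : ℝ≥0∞ :=
  2 ^ (n / 2 + 1 : ℝ) *
    atomMass volume (n / 2) (dualExp n) (fun x => ‖G t x‖ₑ) l ^ (1 / dualExp n)

variable {n : ℕ} {G : ℝ → V → ℂ}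

lemma IsTame.isTame_atomPiece (hG : IsTame G) (l : ℤ) : IsTame (atomPiece n G l) :=
  hG.indicator (measurableSet_atomSet_prod (u := fun t x => ‖G t x‖ₑ) hG.meas.enorm l)

lemma IsTame.measurableSet_atomSet (hG : IsTame G) (l : ℤ) (t : ℝ) :
    MeasurableSet (atomSet volume (n / 2) (fun x => ‖G t x‖ₑ) l) :=
  measurable_prodMk_left (x := t)
    (measurableSet_atomSet_prod (u := fun t x => ‖G t x‖ₑ) hG.meas.enorm l)

lemma enorm_atomPiece_le (hn : 3 ≤ n) (l : ℤ) (t : ℝ) (x : V) :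
    ‖atomPiece n G l t x‖ₑ ≤ (atomSet volume (n / 2) (fun x => ‖G t x‖ₑ) l).indicator (fun _ =>
      2 ^ (-(n / 2 : ℝ) - l * ((n + 2) / 4)) * atomSize n G l t) x := by
  have hn0 : (3 : ℝ) ≤ n := by exact_mod_cast hn
  by_cases hx : x ∈ atomSet volume (n / 2) (fun x => ‖G t x‖ₑ) l
  · rw [atomPiece, Set.indicator_of_mem hx, Set.indicator_of_mem hx]
    refine (le_of_mem_atomSet (ρ := dualExp n) (by linarith [one_le_dualExp hn]) hx).trans ?_
    rw [atomSize, ← mul_assoc, ← mul_assoc, ← two_rpow_add]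
    refine mul_le_mul' (le_of_eq ?_) le_rfl
    conv_lhs => rw [← ENNReal.rpow_one 2, ENNReal.rpow_one, ← ENNReal.rpow_one 2, ← ENNReal.rpow_mul,
      ← two_rpow_add]
    congr 1
    rw [dualExp]
    field_simp
    ring
  · simp [atomPiece, hx]

lemma IsTame.lintegral_enorm_atomPiece_le (hG : IsTame G) (hn : 3 ≤ n) (l : ℤ) (t : ℝ) :
    ∫⁻ x, ‖atomPiece n G l t x‖ₑ ≤ 2 ^ (l * ((n - 2) / 4) : ℝ) * atomSize n G l t := by
  refine (lintegral_mono (enorm_atomPiece_le hn l t)).trans ?_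
  rw [lintegral_indicator_const (hG.measurableSet_atomSet l t)]
  refine (mul_le_mul' le_rfl (measure_atomSet_le l)).trans (le_of_eq ?_)
  rw [mul_right_comm, ← two_rpow_add]
  congr 2
  ring

lemma IsTame.lintegral_sq_atomPiece_le (hG : IsTame G) (hn : 3 ≤ n) (l : ℤ) (t : ℝ) :
    ∫⁻ x, ‖atomPiece n G l t x‖ₑ ^ 2 ≤ 2 ^ (-(l : ℝ)) * atomSize n G l t ^ 2 := by
  have hn0 : (3 : ℝ) ≤ n := by exact_mod_cast hn
  have h : ∀ x, ‖atomPiece n G l t x‖ₑ ^ 2 ≤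
      (atomSet volume (n / 2) (fun x => ‖G t x‖ₑ) l).indicator (fun _ =>
      (2 ^ (-(n / 2 : ℝ) - l * ((n + 2) / 4)) * atomSize n G l t) ^ 2) x := fun x => by
    refine (pow_le_pow_left' (enorm_atomPiece_le hn l t x) 2).trans (le_of_eq ?_)
    by_cases hx : x ∈ atomSet volume (n / 2) (fun x => ‖G t x‖ₑ) l <;> simp [hx]
  refine (lintegral_mono h).trans ?_
  rw [lintegral_indicator_const (hG.measurableSet_atomSet l t)]
  refine (mul_le_mul' le_rfl (measure_atomSet_le l)).trans ?_
  rw [mul_pow, mul_right_comm, two_rpow_pow, ← two_rpow_add]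
  refine mul_le_mul' (two_rpow_le ?_) le_rfl
  push_cast
  linarith

lemma IsTame.atomMass_sum_le (hG : IsTame G) (hn : 3 ≤ n) (Λ : Finset ℤ) (t : ℝ) :
    ∑ l ∈ Λ, atomMass volume (n / 2) (dualExp n) (fun x => ‖G t x‖ₑ) l ≤
      2 * ∫⁻ x, ‖G t x‖ₑ ^ dualExp n := by
  have hn0 : (3 : ℝ) ≤ n := by exact_mod_cast hn
  exact (ENNReal.sum_le_tsum _).trans
    (tsum_atomMass_le (by linarith) (one_le_dualExp hn) (hG.measurable_section t).enorm)

lemma IsTame.measurable_atomSize (hG : IsTame G) (l : ℤ) : Measurable (atomSize n G l) :=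
  ((measurable_atomMass (u := fun t x => ‖G t x‖ₑ) hG.meas.enorm l).pow_const _).const_mul _

lemma IsTame.atomSize_ne_top (hG : IsTame G) (hn : 3 ≤ n) (l : ℤ) (t : ℝ) :
    atomSize n G l t ≠ ⊤ := by
  have hρ := one_le_dualExp hn
  have h := hG.atomMass_sum_le hn {l} t
  rw [Finset.sum_singleton] at h
  refine ENNReal.mul_ne_top (two_rpow_ne_top _) (ENNReal.rpow_ne_top_of_nonneg (by positivity)
    (ne_top_of_le_ne_top (ENNReal.mul_ne_top (by simp) ?_) h))
  exact hG.lintegral_rpow_ne_top (by linarith) t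

lemma IsTame.sum_lintegral_atomSize_le (hG : IsTame G) (hn : 3 ≤ n) (Λ : Finset ℤ) :
    ∑ l ∈ Λ, ∫⁻ t, atomSize n G l t ^ 2 ≤
      2 ^ (n + 4 : ℝ) * ∫⁻ t, (∫⁻ x, ‖G t x‖ₑ ^ dualExp n) ^ (2 / dualExp n) := by
  have hρ := one_le_dualExp hn
  have hρ2 := dualExp_le_two (n := n)
  rw [← lintegral_finsetSum _ fun l _ => (hG.measurable_atomSize l).pow_const 2,
    ← lintegral_const_mul' _ _ (two_rpow_ne_top _)]
  refine lintegral_mono fun t => ?_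
  have h1 : ∀ l, atomSize n G l t ^ 2 = 2 ^ (n + 2 : ℝ) *
      atomMass volume (n / 2) (dualExp n) (fun x => ‖G t x‖ₑ) l ^ (2 / dualExp n) := fun l => by
    rw [atomSize, mul_pow, two_rpow_pow, ← ENNReal.rpow_natCast (_ ^ (1 / dualExp n)),
      ← ENNReal.rpow_mul]
    congr 2
    · push_cast; ring
    · push_cast; ring
  simp_rw [h1, ← Finset.mul_sum]
  calc _ ≤ 2 ^ (n + 2 : ℝ) * (2 * ∫⁻ x, ‖G t x‖ₑ ^ dualExp n) ^ (2 / dualExp n) := by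
        gcongr
        refine (sum_rpow_le_rpow_sum Λ _ ?_).trans
          (ENNReal.rpow_le_rpow (hG.atomMass_sum_le hn Λ t) (by positivity))
        rw [le_div_iff₀ (by linarith)]
        linarith
    _ ≤ _ := by
        rw [ENNReal.mul_rpow_of_nonneg _ _ (by positivity), ← mul_assoc, ← two_rpow_add]
        refine mul_le_mul' (two_rpow_le ?_) le_rfl
        have : 2 / dualExp n ≤ 2 := by rw [div_le_iff₀ (by linarith)]; linarith
        linarith

/-- The absolute constant in the dual endpoint estimate. -/
noncomputable def dualConst (n : ℕ) : ℝ≥0∞ :=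
  12 * (∑' x, dyadicWeight x) ^ 2 * 2 ^ (n + 4 : ℝ)

lemma dualConst_ne_top (n : ℕ) : dualConst n ≠ ⊤ :=
  ENNReal.mul_ne_top (ENNReal.mul_ne_top (by simp) (ENNReal.pow_ne_top tsum_dyadicWeight_ne_top))
    (two_rpow_ne_top _)

lemma IsTame.lintegral_sq_integral_sum_atomPiece_le (hG : IsTame G) (hn : 3 ≤ n)
    (hV : Module.finrank ℝ V = n) (Λ : Finset ℤ) :
    ∫⁻ ξ, ‖∫ t, ∑ l ∈ Λ, fourierProfile (atomPiece n G l) t ξ‖ₑ ^ 2 ≤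
      dualConst n * ∫⁻ t, (∫⁻ x, ‖G t x‖ₑ ^ dualExp n) ^ (2 / dualExp n) := by
  have hp := fun l => hG.isTame_atomPiece (n := n) l
  refine (lintegral_sq_integral_sum_le hn Λ (A := atomSize n G)
    (fun l => (hp l).sqIntegrable_fourierProfile) (fun l => hG.measurable_atomSize l)
    (fun l t => hG.atomSize_ne_top hn l t) (fun l t => ?_) (fun l m t s hts => ?_)).trans ?_
  · simp_rw [enorm_fourierProfile]
    rw [lintegral_sq_fourier ((hp l).integrable_section t) ((hp l).memLp_section t)]
    exact hG.lintegral_sq_atomPiece_le hn l t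
  · refine ((hp l).enorm_timePairing_le (hp m) hV hts).trans ?_
    refine mul_le_mul' le_rfl ((mul_le_mul' (hG.lintegral_enorm_atomPiece_le hn l t)
      (hG.lintegral_enorm_atomPiece_le hn m s)).trans (le_of_eq ?_))
    rw [mul_mul_mul_comm, ← two_rpow_add, add_mul]
  · refine (mul_le_mul' le_rfl (hG.sum_lintegral_atomSize_le hn Λ)).trans (le_of_eq ?_)
    rw [dualConst]
    ring

end AtomicBilinear

section FreeWave
open ComplexConjugate

variable {V : Type*} [NormedAddCommGroup V] [InnerProductSpace ℝ V]

/-- The space-time exponential `e^{2πi x·ξ - 4π²it|ξ|²}`. -/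
noncomputable def planeWave (t : ℝ) (x ξ : V) : ℂ :=
  Complex.exp ((2 * Real.pi * inner ℝ x ξ - 4 * Real.pi ^ 2 * t * ‖ξ‖ ^ 2 : ℝ) * Complex.I)

lemma norm_planeWave (t : ℝ) (x ξ : V) : ‖planeWave t x ξ‖ = 1 :=
  Complex.norm_exp_ofReal_mul_I _

lemma continuous_planeWave :
    Continuous fun w : (ℝ × V) × V => planeWave w.1.1 w.1.2 w.2 := by
  unfold planeWave
  fun_prop

variable [MeasurableSpace V] [FiniteDimensional ℝ V] [BorelSpace V]

/-- The free Schrödinger wave whose data has Fourier transform `φ`. -/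
noncomputable def freeWave (φ : V → ℂ) (t : ℝ) (x : V) : ℂ :=
  ∫ ξ, planeWave t x ξ * φ ξ

variable {φ : V → ℂ} {G : ℝ → V → ℂ} {n : ℕ}

lemma continuous_freeWave (hφ : Integrable φ) :
    Continuous (Function.uncurry (freeWave φ)) := by
  refine continuous_of_dominated (F := fun (z : ℝ × V) ξ => planeWave z.1 z.2 ξ * φ ξ)
    (bound := fun ξ => ‖φ ξ‖) (fun z => ?_) (fun z => ?_) hφ.norm ?_
  · exact (Continuous.aestronglyMeasurable
      (continuous_planeWave.comp (by fun_prop : Continuous fun ξ : V => (z, ξ)))).mul hφ.1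
  · exact Filter.Eventually.of_forall fun ξ => by simp [norm_planeWave]
  · exact Filter.Eventually.of_forall fun ξ =>
      (continuous_planeWave.comp (by fun_prop : Continuous fun z : ℝ × V => (z, ξ))).mul
        continuous_const

lemma norm_freeWave_le (t : ℝ) (x : V) : ‖freeWave φ t x‖ ≤ ∫ ξ, ‖φ ξ‖ := by
  refine (norm_integral_le_integral_norm _).trans (le_of_eq ?_)
  simp [norm_planeWave]

lemma conj_fourierProfile (t : ℝ) (ξ : V) :
    conj (fourierProfile G t ξ) = ∫ x, planeWave t x ξ * conj (G t x) := by
  rw [fourierProfile, Real.fourier_eq', map_mul, ← integral_conj, ← integral_const_mul]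
  congr 1 with x
  rw [smul_eq_mul, map_mul, ← Complex.exp_conj, ← Complex.exp_conj, ← mul_assoc, ← Complex.exp_add,
    planeWave]
  congr 2
  simp only [map_mul, map_pow, Complex.conj_I, Complex.conj_ofReal]
  push_cast
  ring

lemma IsTame.integrable_conj (hG : IsTame G) : Integrable fun z : ℝ × V => conj (G z.1 z.2) :=
  hG.integrable.congr' (by
    exact (Complex.continuous_conj.measurable.comp hG.meas).aestronglyMeasurable)
    (Filter.Eventually.of_forall fun z => by simp [Function.uncurry])

lemma IsTame.integrable_planeWave_mul_conj (hG : IsTame G) (ξ : V) :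
    Integrable fun z : ℝ × V => planeWave z.1 z.2 ξ * conj (G z.1 z.2) :=
  hG.integrable_conj.bdd_mul (c := 1) (Continuous.aestronglyMeasurable
    (continuous_planeWave.comp (by fun_prop : Continuous fun z : ℝ × V => (z, ξ))))
    (Filter.Eventually.of_forall fun w => (norm_planeWave _ _ _).le)

lemma IsTame.conj_integral_fourierProfile (hG : IsTame G) (ξ : V) :
    conj (∫ t, fourierProfile G t ξ) =
      ∫ z : ℝ × V, planeWave z.1 z.2 ξ * conj (G z.1 z.2) := by
  rw [← integral_conj]
  simp_rw [conj_fourierProfile]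
  rw [Measure.volume_eq_prod, integral_prod _ (hG.integrable_planeWave_mul_conj ξ)]

lemma IsTame.integrable_fourierProfile (hG : IsTame G) (ξ : V) :
    Integrable fun t => fourierProfile G t ξ := by
  have h := (hG.integrable_planeWave_mul_conj ξ).integral_prod_left
  simp_rw [← conj_fourierProfile] at h
  refine h.congr' ?_ (Filter.Eventually.of_forall fun t => by simp)
  exact (hG.measurable_fourierProfile.comp (measurable_prodMk_right (y := ξ))).aestronglyMeasurable

lemma IsTame.measurable_integral_fourierProfile (hG : IsTame G) :
    Measurable fun ξ => ∫ t, fourierProfile G t ξ :=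
  (hG.measurable_fourierProfile.stronglyMeasurable.integral_prod_left (μ := volume)).measurable

lemma IsTame.integrable_mul_conj_integral_fourierProfile (hG : IsTame G) (hφ : Integrable φ) :
    Integrable fun ξ => φ ξ * conj (∫ t, fourierProfile G t ξ) := by
  refine hφ.mul_bdd (c := ∫ z : ℝ × V, ‖conj (G z.1 z.2)‖) ?_ (Filter.Eventually.of_forall ?_)
  · exact (Complex.continuous_conj.measurable.comp
      hG.measurable_integral_fourierProfile).aestronglyMeasurable
  · intro ξ
    rw [hG.conj_integral_fourierProfile]
    refine (norm_integral_le_integral_norm _).trans (le_of_eq ?_)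
    simp [norm_planeWave]

lemma IsTame.integrable_freeWave_mul_conj (hG : IsTame G) (hφ : Integrable φ) :
    Integrable fun z : ℝ × V => freeWave φ z.1 z.2 * conj (G z.1 z.2) :=
  hG.integrable_conj.bdd_mul (continuous_freeWave hφ).aestronglyMeasurable
    (Filter.Eventually.of_forall fun z => norm_freeWave_le z.1 z.2)

lemma IsTame.integral_freeWave_mul_conj (hG : IsTame G) (hφ : Integrable φ) :
    ∫ z : ℝ × V, freeWave φ z.1 z.2 * conj (G z.1 z.2) =
      ∫ ξ, φ ξ * conj (∫ t, fourierProfile G t ξ) := by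
  have hprod : Integrable (fun w : (ℝ × V) × V =>
      planeWave w.1.1 w.1.2 w.2 * (conj (G w.1.1 w.1.2) * φ w.2)) :=
    (hG.integrable_conj.mul_prod hφ).bdd_mul (c := 1) continuous_planeWave.aestronglyMeasurable
      (Filter.Eventually.of_forall fun w => (norm_planeWave _ _ _).le)
  have h1 : ∀ z : ℝ × V, freeWave φ z.1 z.2 * conj (G z.1 z.2) =
      ∫ ξ, planeWave z.1 z.2 ξ * (conj (G z.1 z.2) * φ ξ) := fun z => by
    rw [freeWave, ← integral_mul_const]
    congr 1 with ξ
    ring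
  simp_rw [h1]
  rw [integral_integral_swap hprod]
  congr 1 with ξ
  simp_rw [← mul_assoc]
  rw [integral_mul_const, mul_comm, hG.conj_integral_fourierProfile]

lemma IsTame.enorm_integral_freeWave_mul_sum_sq_le (hG : IsTame G) (hn : 3 ≤ n)
    (hV : Module.finrank ℝ V = n) (hφ : Integrable φ) (hφm : Measurable φ) (Λ : Finset ℤ) :
    ‖∫ z : ℝ × V, freeWave φ z.1 z.2 * conj (∑ l ∈ Λ, atomPiece n G l z.1 z.2)‖ₑ ^ 2 ≤
      (∫⁻ ξ, ‖φ ξ‖ₑ ^ 2) *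
        (dualConst n * ∫⁻ t, (∫⁻ x, ‖G t x‖ₑ ^ dualExp n) ^ (2 / dualExp n)) := by
  have hp := fun l => hG.isTame_atomPiece (n := n) l
  have hsum : ∀ ξ, ∫ t, ∑ l ∈ Λ, fourierProfile (atomPiece n G l) t ξ =
      ∑ l ∈ Λ, ∫ t, fourierProfile (atomPiece n G l) t ξ := fun ξ =>
    integral_finsetSum _ fun l _ => (hp l).integrable_fourierProfile ξ
  refine le_trans (le_of_eq ?_) ((enorm_integral_mul_conj_sq_le hφm
    (g := fun ξ => ∫ t, ∑ l ∈ Λ, fourierProfile (atomPiece n G l) t ξ) ?_).trans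
    (mul_le_mul' le_rfl (hG.lintegral_sq_integral_sum_atomPiece_le hn hV Λ)))
  · simp_rw [hsum, map_sum, Finset.mul_sum]
    rw [integral_finsetSum _ fun l _ => (hp l).integrable_freeWave_mul_conj hφ,
      integral_finsetSum _ fun l _ => (hp l).integrable_mul_conj_integral_fourierProfile hφ]
    simp_rw [fun l => (hp l).integral_freeWave_mul_conj hφ]
  · simp_rw [hsum]
    exact Finset.measurable_sum _ fun l _ => (hp l).measurable_integral_fourierProfile

lemma sum_atomPiece (hn : 3 ≤ n) (Λ : Finset ℤ) (t : ℝ) (x : V) :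
    ∑ l ∈ Λ, atomPiece n G l t x =
      (⋃ l ∈ Λ, atomSet volume (n / 2) (fun x => ‖G t x‖ₑ) l).indicator (G t) x := by
  have hn0 : (3 : ℝ) ≤ n := by exact_mod_cast hn
  rw [Finset.indicator_biUnion_apply Λ _ ?_]
  · rfl
  · intro l _ m _ hlm
    rw [Function.onFun, Set.disjoint_left]
    exact fun y h h' => hlm (eq_of_mem_atomSet (by linarith) h h')

lemma IsTame.ae_exists_sum_atomPiece_eq (hG : IsTame G) (hn : 3 ≤ n) :
    ∀ᵐ z : ℝ × V, ∃ l : ℤ, ∀ Λ : Finset ℤ, l ∈ Λ →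
      ∑ l ∈ Λ, atomPiece n G l z.1 z.2 = G z.1 z.2 := by
  have hn0 : (3 : ℝ) ≤ n := by exact_mod_cast hn
  have hρ := one_le_dualExp hn
  have h : ∀ᵐ z : ℝ × V, G z.1 z.2 ≠ 0 →
      ∃ l, z.2 ∈ atomSet volume (n / 2) (fun x => ‖G z.1 x‖ₑ) l := by
    rw [Measure.volume_eq_prod]
    refine (Measure.ae_prod_iff_ae_ae ?_).2 (Filter.Eventually.of_forall fun t => ?_)
    · have : {z : ℝ × V | G z.1 z.2 ≠ 0 →
          ∃ l, z.2 ∈ atomSet volume (n / 2) (fun x => ‖G z.1 x‖ₑ) l} =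
          {z : ℝ × V | Function.uncurry G z = 0} ∪
          ⋃ l, {z | z.2 ∈ atomSet volume (n / 2) (fun x => ‖G z.1 x‖ₑ) l} := by
        ext z
        simp [Function.uncurry, imp_iff_not_or]
      rw [this]
      exact (hG.meas (measurableSet_singleton 0)).union (MeasurableSet.iUnion fun l =>
        measurableSet_atomSet_prod (u := fun t x => ‖G t x‖ₑ) hG.meas.enorm l)
    · filter_upwards [ae_exists_mem_atomSet (ν := volume) (σ := n / 2) (ρ := dualExp n)
        (u := fun x => ‖G t x‖ₑ) (by linarith) (by linarith) (hG.measurable_section t).enorm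
        (fun y => enorm_ne_top) (hG.lintegral_rpow_ne_top (by linarith) t)] with x hx h0
      exact hx (by simpa using h0)
  filter_upwards [h] with z hz
  simp_rw [sum_atomPiece hn]
  by_cases h0 : G z.1 z.2 = 0
  · exact ⟨0, fun Λ _ => by simp [h0]⟩
  · obtain ⟨l, hl⟩ := hz h0
    exact ⟨l, fun Λ hΛ => Set.indicator_of_mem (Set.mem_biUnion hΛ hl) _⟩

/-- The dual form of the endpoint Strichartz estimate. -/
lemma IsTame.enorm_integral_freeWave_mul_sq_le (hG : IsTame G) (hn : 3 ≤ n)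
    (hV : Module.finrank ℝ V = n) (hφ : Integrable φ) (hφm : Measurable φ) :
    ‖∫ z : ℝ × V, freeWave φ z.1 z.2 * conj (G z.1 z.2)‖ₑ ^ 2 ≤
      (∫⁻ ξ, ‖φ ξ‖ₑ ^ 2) *
        (dualConst n * ∫⁻ t, (∫⁻ x, ‖G t x‖ₑ ^ dualExp n) ^ (2 / dualExp n)) := by
  have hp := fun l => hG.isTame_atomPiece (n := n) l
  have hlim : Filter.Tendsto (fun Λ : Finset ℤ =>
      ∫ z : ℝ × V, freeWave φ z.1 z.2 * conj (∑ l ∈ Λ, atomPiece n G l z.1 z.2)) Filter.atTop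
      (nhds (∫ z : ℝ × V, freeWave φ z.1 z.2 * conj (G z.1 z.2))) := by
    refine tendsto_integral_filter_of_dominated_convergence
      (fun z => ‖freeWave φ z.1 z.2 * conj (G z.1 z.2)‖) ?_ ?_
      (hG.integrable_freeWave_mul_conj hφ).norm ?_
    · refine Filter.Eventually.of_forall fun Λ => ?_
      refine (continuous_freeWave hφ).aestronglyMeasurable.mul
        (Measurable.aestronglyMeasurable (Complex.continuous_conj.measurable.comp ?_))
      exact Finset.measurable_sum _ fun l _ => (hp l).meas
    · refine Filter.Eventually.of_forall fun Λ => Filter.Eventually.of_forall fun z => ?_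
      rw [norm_mul, norm_mul, RCLike.norm_conj, RCLike.norm_conj, sum_atomPiece hn]
      exact mul_le_mul_of_nonneg_left (norm_indicator_le_norm_self _ _) (norm_nonneg _)
    · filter_upwards [hG.ae_exists_sum_atomPiece_eq hn] with z ⟨l, hl⟩
      refine tendsto_const_nhds.congr' ?_
      filter_upwards [Filter.eventually_ge_atTop {l}] with Λ hΛ
      rw [hl Λ (hΛ (Finset.mem_singleton_self l))]
  refine le_of_tendsto ((ENNReal.continuous_pow 2).tendsto _ |>.comp
    ((continuous_enorm.tendsto _).comp hlim)) (Filter.Eventually.of_forall fun Λ => ?_)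
  exact hG.enorm_integral_freeWave_mul_sum_sq_le hn hV hφ hφm Λ

end FreeWave

section Duality
open ComplexConjugate

variable {V : Type*} [NormedAddCommGroup V] [InnerProductSpace ℝ V] [MeasurableSpace V]
  [FiniteDimensional ℝ V] [BorelSpace V]

/-- The `r`-th power mass of `u(t)` on the ball of radius `N`. -/
noncomputable def ballMass (u : ℝ → V → ℂ) (r : ℝ) (N : ℕ) (t : ℝ) : ℝ≥0∞ :=
  ∫⁻ x in Metric.closedBall (0 : V) N, ‖u t x‖ₑ ^ r

/-- The times at which the truncated mass is bounded below. -/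
def goodTimes (u : ℝ → V → ℂ) (r : ℝ) (N : ℕ) : Set ℝ :=
  {t | ‖t‖ ≤ N ∧ (N : ℝ≥0∞)⁻¹ ≤ ballMass u r N t}

open Classical in
/-- The extremiser of the duality between `L^r` and `L^{r'}`, truncated. -/
noncomputable def dualTest (u : ℝ → V → ℂ) (r : ℝ) (N : ℕ) (t : ℝ) (x : V) : ℂ :=
  if t ∈ goodTimes u r N ∧ ‖x‖ ≤ N then
    ((((ballMass u r N t) ^ ((2 - r) / r)).toReal * ‖u t x‖ ^ (r - 2) : ℝ) : ℂ) * u t x else 0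

variable {u : ℝ → V → ℂ} {r : ℝ} {N : ℕ}

lemma measurable_ballMass (hu : Measurable (Function.uncurry u)) :
    Measurable (ballMass u r N) := by
  have h : Measurable (Function.uncurry fun t x => ‖u t x‖ₑ ^ r) := hu.enorm.pow_const r
  exact h.lintegral_prod_right'

lemma measurableSet_goodTimes (hu : Measurable (Function.uncurry u)) :
    MeasurableSet (goodTimes u r N) :=
  (measurableSet_le measurable_norm measurable_const).inter
    (measurableSet_le measurable_const (measurable_ballMass hu))

lemma ballMass_ne_top {M : NNReal} (hM : ∀ t x, ‖u t x‖ ≤ M) (hr : 0 ≤ r) (t : ℝ) :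
    ballMass u r N t ≠ ⊤ := by
  have h : ∀ x, ‖u t x‖ₑ ^ r ≤ (M : ℝ≥0∞) ^ r := fun x => by
    refine ENNReal.rpow_le_rpow ?_ hr
    rw [← ofReal_norm, ← ENNReal.ofReal_coe_nnreal]
    exact ENNReal.ofReal_le_ofReal (hM t x)
  refine ne_top_of_le_ne_top ?_ (lintegral_mono h)
  rw [setLIntegral_const]
  exact ENNReal.mul_ne_top (ENNReal.rpow_ne_top_of_nonneg hr (by simp))
    measure_closedBall_lt_top.ne

lemma ballMass_ne_zero {t : ℝ} (ht : t ∈ goodTimes u r N) : ballMass u r N t ≠ 0 := by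
  intro h
  have := ht.2
  rw [h] at this
  simp at this

lemma rpow_ballMass_le (hr : 2 ≤ r) {t : ℝ} (ht : t ∈ goodTimes u r N) :
    ballMass u r N t ^ ((2 - r) / r) ≤ (N : ℝ≥0∞) ^ ((r - 2) / r) := by
  have h := ENNReal.rpow_le_rpow ht.2 (div_nonneg (sub_nonneg.2 hr) (by linarith) : 0 ≤ (r - 2) / r)
  rw [ENNReal.inv_rpow] at h
  rw [show (2 - r) / r = -((r - 2) / r) by ring, ENNReal.rpow_neg]
  exact ENNReal.inv_le_iff_inv_le.2 h

lemma enorm_dualTest (hr : 2 ≤ r) {t : ℝ} (ht : t ∈ goodTimes u r N) (x : V) :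
    ‖dualTest u r N t x‖ₑ = (Metric.closedBall (0 : V) N).indicator
      (fun x => ballMass u r N t ^ ((2 - r) / r) * ‖u t x‖ₑ ^ (r - 1)) x := by
  by_cases hx : ‖x‖ ≤ N
  · have h1 : ballMass u r N t ^ ((2 - r) / r) ≠ ⊤ :=
      ne_top_of_le_ne_top (ENNReal.rpow_ne_top_of_nonneg
        (div_nonneg (sub_nonneg.2 hr) (by linarith)) (by simp)) (rpow_ballMass_le hr ht)
    rw [dualTest, if_pos ⟨ht, hx⟩, Set.indicator_of_mem (by simpa using hx), enorm_mul,
      ← ofReal_norm (_ : ℂ), Complex.norm_real, Real.norm_of_nonneg (by positivity),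
      ENNReal.ofReal_mul toReal_nonneg, ENNReal.ofReal_toReal h1,
      ← ENNReal.ofReal_rpow_of_nonneg (norm_nonneg _) (by linarith), ofReal_norm, mul_assoc]
    congr 1
    conv_lhs => enter [2]; rw [← ENNReal.rpow_one ‖u t x‖ₑ]
    rw [← ENNReal.rpow_add_of_nonneg _ _ (by linarith) (by norm_num)]
    congr 1
    ring
  · rw [dualTest, if_neg (fun h => hx h.2), Set.indicator_of_notMem (by simpa using hx)]
    simp

lemma mul_conj_dualTest (t : ℝ) (x : V) :
    u t x * conj (dualTest u r N t x) = ((‖u t x‖ * ‖dualTest u r N t x‖ : ℝ) : ℂ) := by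
  rw [dualTest]
  split_ifs
  · set a : ℝ := (ballMass u r N t ^ ((2 - r) / r)).toReal * ‖u t x‖ ^ (r - 2) with ha
    have ha0 : 0 ≤ a := by positivity
    rw [map_mul, Complex.conj_ofReal, norm_mul, Complex.norm_real, Real.norm_of_nonneg ha0,
      mul_left_comm, Complex.mul_conj, Complex.normSq_eq_norm_sq]
    push_cast
    ring
  · simp

lemma isTame_dualTest {M : NNReal} (hu : Measurable (Function.uncurry u))
    (hM : ∀ t x, ‖u t x‖ ≤ M) (hr : 2 ≤ r) : IsTame (dualTest u r N) := by
  refine ⟨?_, N ⊔ ((N : NNReal) ^ ((r - 2) / r) * M ^ (r - 1)), fun t x => ⟨?_, fun h => ?_⟩⟩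
  · have h1 : MeasurableSet {z : ℝ × V | z.1 ∈ goodTimes u r N ∧ ‖z.2‖ ≤ N} :=
      (measurable_fst (measurableSet_goodTimes hu)).inter
        (measurableSet_le measurable_snd.norm measurable_const)
    refine Measurable.ite h1 ?_ measurable_const
    refine Measurable.mul (Complex.measurable_ofReal.comp (Measurable.mul ?_ ?_)) hu
    · exact (((measurable_ballMass hu).pow_const _).ennreal_toReal).comp measurable_fst
    · exact hu.norm.pow_const _
  · by_cases ht : t ∈ goodTimes u r N
    · have h2 : ‖dualTest u r N t x‖ₑ ≤
          (((N : NNReal) ^ ((r - 2) / r) * M ^ (r - 1) : NNReal) : ℝ≥0∞) := by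
        rw [enorm_dualTest hr ht]
        refine Set.indicator_apply_le' (fun _ => ?_) (fun _ => zero_le)
        have hr2 : 0 ≤ (r - 2) / r := div_nonneg (sub_nonneg.2 hr) (by linarith)
        rw [ENNReal.coe_mul, ENNReal.coe_rpow_of_nonneg _ hr2,
          ENNReal.coe_rpow_of_nonneg _ (by linarith)]
        refine mul_le_mul' (by simpa using rpow_ballMass_le hr ht)
          (ENNReal.rpow_le_rpow ?_ (by linarith))
        rw [← ofReal_norm, ← ENNReal.ofReal_coe_nnreal]
        exact ENNReal.ofReal_le_ofReal (hM t x)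
      rw [← ofReal_norm, ← ENNReal.ofReal_coe_nnreal,
        ENNReal.ofReal_le_ofReal_iff (NNReal.coe_nonneg _)] at h2
      exact h2.trans (by exact_mod_cast le_sup_right)
    · rw [dualTest, if_neg fun h => ht h.1]
      simp
  · have h' : t ∈ goodTimes u r N ∧ ‖x‖ ≤ N := by
      by_contra hc
      exact h (by rw [dualTest, if_neg hc])
    exact ⟨h'.1.1.trans (by simp), h'.2.trans (by simp)⟩

lemma lintegral_dualTest_rpow {M : NNReal} (hM : ∀ t x, ‖u t x‖ ≤ M)
    (hr : 2 ≤ r) {t : ℝ} (ht : t ∈ goodTimes u r N) :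
    (∫⁻ x, ‖dualTest u r N t x‖ₑ ^ (r / (r - 1))) ^ (2 / (r / (r - 1))) =
      ballMass u r N t ^ (2 / r) := by
  have hρ : 0 < r / (r - 1) := div_pos (by linarith) (by linarith)
  have h0 := ballMass_ne_zero ht
  have h1 := ballMass_ne_top (N := N) hM (by linarith : 0 ≤ r) t
  have h2 : ∀ x, ‖dualTest u r N t x‖ₑ ^ (r / (r - 1)) = (Metric.closedBall (0 : V) N).indicator
      (fun x => ballMass u r N t ^ ((2 - r) / (r - 1)) * ‖u t x‖ₑ ^ r) x := fun x => by
    rw [enorm_dualTest hr ht]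
    by_cases hx : x ∈ Metric.closedBall (0 : V) N
    · rw [Set.indicator_of_mem hx, Set.indicator_of_mem hx, ENNReal.mul_rpow_of_nonneg _ _ hρ.le,
        ← ENNReal.rpow_mul, ← ENNReal.rpow_mul]
      have : r - 1 ≠ 0 := by linarith
      have : r ≠ 0 := by linarith
      congr 2 <;> field_simp
    · simp only [Set.indicator_of_notMem hx, ENNReal.zero_rpow_of_pos hρ]
  simp_rw [h2]
  rw [lintegral_indicator Metric.isClosed_closedBall.measurableSet,
    lintegral_const_mul' _ _ (by simp [ENNReal.rpow_eq_top_iff, h0, h1])]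
  rw [show ∫⁻ x in Metric.closedBall (0 : V) N, ‖u t x‖ₑ ^ r = ballMass u r N t ^ (1 : ℝ) by
    rw [ENNReal.rpow_one]; rfl, ← ENNReal.rpow_add _ _ h0 h1, ← ENNReal.rpow_mul]
  congr 1
  have : r - 1 ≠ 0 := by linarith
  have : r ≠ 0 := by linarith
  field_simp
  ring

lemma lintegral_mul_dualTest {M : NNReal} (hM : ∀ t x, ‖u t x‖ ≤ M)
    (hr : 2 ≤ r) {t : ℝ} (ht : t ∈ goodTimes u r N) :
    ∫⁻ x, ‖u t x‖ₑ * ‖dualTest u r N t x‖ₑ = ballMass u r N t ^ (2 / r) := by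
  have h0 := ballMass_ne_zero ht
  have h1 := ballMass_ne_top (N := N) hM (by linarith : 0 ≤ r) t
  have h2 : ∀ x, ‖u t x‖ₑ * ‖dualTest u r N t x‖ₑ = (Metric.closedBall (0 : V) N).indicator
      (fun x => ballMass u r N t ^ ((2 - r) / r) * ‖u t x‖ₑ ^ r) x := fun x => by
    rw [enorm_dualTest hr ht]
    by_cases hx : x ∈ Metric.closedBall (0 : V) N
    · rw [Set.indicator_of_mem hx, Set.indicator_of_mem hx, mul_left_comm]
      congr 1
      conv_lhs => enter [1]; rw [← ENNReal.rpow_one ‖u t x‖ₑ]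
      rw [← ENNReal.rpow_add_of_nonneg _ _ (by norm_num) (by linarith)]
      congr 1
      ring
    · simp only [Set.indicator_of_notMem hx, mul_zero]
  simp_rw [h2]
  rw [lintegral_indicator Metric.isClosed_closedBall.measurableSet,
    lintegral_const_mul' _ _ (by simp [ENNReal.rpow_eq_top_iff, h0, h1])]
  rw [show ∫⁻ x in Metric.closedBall (0 : V) N, ‖u t x‖ₑ ^ r = ballMass u r N t ^ (1 : ℝ) by
    rw [ENNReal.rpow_one]; rfl, ← ENNReal.rpow_add _ _ h0 h1]
  congr 1
  have : r ≠ 0 := by linarith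
  field_simp
  ring

lemma dualTest_eq_zero {t : ℝ} (ht : t ∉ goodTimes u r N) (x : V) : dualTest u r N t x = 0 :=
  if_neg fun h => ht h.1

lemma lintegral_goodTimes_le {M : NNReal} {D : ℝ≥0∞} (hu : Measurable (Function.uncurry u))
    (hM : ∀ t x, ‖u t x‖ ≤ M) (hr : 2 ≤ r)
    (hD : ∀ G : ℝ → V → ℂ, IsTame G → ‖∫ z : ℝ × V, u z.1 z.2 * conj (G z.1 z.2)‖ₑ ^ 2 ≤
      D * ∫⁻ t, (∫⁻ x, ‖G t x‖ₑ ^ (r / (r - 1))) ^ (2 / (r / (r - 1)))) :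
    ∫⁻ t, (goodTimes u r N).indicator (fun t => ballMass u r N t ^ (2 / r)) t ≤ D := by
  have hρ : 0 < r / (r - 1) := div_pos (by linarith) (by linarith)
  have hG := isTame_dualTest (N := N) hu hM hr
  set J := ∫⁻ t, (goodTimes u r N).indicator (fun t => ballMass u r N t ^ (2 / r)) t with hJ
  have hi : Integrable fun z : ℝ × V => ‖u z.1 z.2‖ * ‖dualTest u r N z.1 z.2‖ :=
    hG.integrable.norm.bdd_mul (c := M) hu.norm.aestronglyMeasurable
      (Filter.Eventually.of_forall fun z => by simpa using hM z.1 z.2)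
  have h1 : ‖∫ z : ℝ × V, u z.1 z.2 * conj (dualTest u r N z.1 z.2)‖ₑ = J := by
    simp_rw [mul_conj_dualTest]
    rw [integral_complex_ofReal, ← ofReal_norm, Complex.norm_real,
      Real.norm_of_nonneg (integral_nonneg fun z => by positivity),
      ofReal_integral_eq_lintegral_ofReal hi (Filter.Eventually.of_forall fun z => by positivity)]
    simp_rw [ENNReal.ofReal_mul (norm_nonneg _), ofReal_norm]
    have hm : Measurable fun z : ℝ × V => ‖u z.1 z.2‖ₑ * ‖dualTest u r N z.1 z.2‖ₑ :=
      hu.enorm.mul hG.meas.enorm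
    rw [Measure.volume_eq_prod, lintegral_prod _ hm.aemeasurable, hJ]
    congr 1 with t
    by_cases ht : t ∈ goodTimes u r N
    · rw [Set.indicator_of_mem ht, ← lintegral_mul_dualTest hM hr ht]
    · simp [Set.indicator_of_notMem ht, dualTest_eq_zero ht]
  have h2 : ∫⁻ t, (∫⁻ x, ‖dualTest u r N t x‖ₑ ^ (r / (r - 1))) ^ (2 / (r / (r - 1))) = J := by
    rw [hJ]
    congr 1 with t
    by_cases ht : t ∈ goodTimes u r N
    · rw [Set.indicator_of_mem ht, ← lintegral_dualTest_rpow hM hr ht]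
    · have h2ρ : 0 < 2 / (r / (r - 1)) := by positivity
      simp only [Set.indicator_of_notMem ht, dualTest_eq_zero ht, enorm_zero,
        ENNReal.zero_rpow_of_pos hρ, lintegral_zero, ENNReal.zero_rpow_of_pos h2ρ]
  have h3 := hD _ hG
  rw [h1, h2] at h3
  have hJt : J ≠ ⊤ := by
    rw [← h1]
    exact enorm_ne_top
  by_cases hJ0 : J = 0
  · simp [hJ0]
  · rwa [sq, ENNReal.mul_le_mul_iff_left hJ0 hJt] at h3

lemma tendsto_ballMass (hu : Measurable (Function.uncurry u)) (t : ℝ) :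
    Filter.Tendsto (fun N => ballMass u r N t) Filter.atTop (nhds (∫⁻ x, ‖u t x‖ₑ ^ r)) := by
  have hm : Measurable fun x => ‖u t x‖ₑ ^ r :=
    (hu.comp (measurable_prodMk_left (x := t))).enorm.pow_const r
  have h : ∀ N, ballMass u r N t =
      ∫⁻ x, (Metric.closedBall (0 : V) N).indicator (fun x => ‖u t x‖ₑ ^ r) x := fun N =>
    (lintegral_indicator Metric.isClosed_closedBall.measurableSet _).symm
  simp_rw [h]
  refine lintegral_tendsto_of_tendsto_of_monotone
    (fun N => (hm.indicator Metric.isClosed_closedBall.measurableSet).aemeasurable)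
    (Filter.Eventually.of_forall fun x N N' hN => ?_) (Filter.Eventually.of_forall fun x => ?_)
  · exact Set.indicator_le_indicator_of_subset
      (Metric.closedBall_subset_closedBall (by exact_mod_cast hN)) (fun _ => zero_le) x
  · refine tendsto_const_nhds.congr' ?_
    filter_upwards [Filter.eventually_ge_atTop ⌈‖x‖⌉₊] with N hN
    rw [Set.indicator_of_mem]
    simpa using Nat.ceil_le.1 hN

/-- Duality: a bilinear bound against tame functions controls the `L²_t L^r_x` norm. -/
lemma lintegral_rpow_le_of_dual {M : NNReal} {D : ℝ≥0∞} (hu : Measurable (Function.uncurry u))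
    (hM : ∀ t x, ‖u t x‖ ≤ M) (hr : 2 ≤ r)
    (hD : ∀ G : ℝ → V → ℂ, IsTame G → ‖∫ z : ℝ × V, u z.1 z.2 * conj (G z.1 z.2)‖ₑ ^ 2 ≤
      D * ∫⁻ t, (∫⁻ x, ‖G t x‖ₑ ^ (r / (r - 1))) ^ (2 / (r / (r - 1)))) :
    ∫⁻ t, (∫⁻ x, ‖u t x‖ₑ ^ r) ^ (2 / r) ≤ D := by
  have hr0 : 0 < 2 / r := div_pos two_pos (by linarith)
  calc _ ≤ ∫⁻ t, Filter.liminf (fun N => (goodTimes u r N).indicator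
          (fun t => ballMass u r N t ^ (2 / r)) t) Filter.atTop := by
        refine lintegral_mono fun t => ?_
        by_cases h0 : ∫⁻ x, ‖u t x‖ₑ ^ r = 0
        · simp [h0, hr0]
        have hlim := tendsto_ballMass (r := r) hu t
        refine le_of_eq (Filter.Tendsto.liminf_eq ?_).symm
        refine Filter.Tendsto.congr' ?_ (((ENNReal.continuous_rpow_const).tendsto _).comp hlim)
        filter_upwards [ENNReal.tendsto_inv_nat_nhds_zero.eventually_lt hlim
          (pos_iff_ne_zero.2 h0), Filter.eventually_ge_atTop ⌈‖t‖⌉₊] with N hN hN'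
        have ht : t ∈ goodTimes u r N := ⟨Nat.ceil_le.1 hN', hN.le⟩
        rw [Set.indicator_of_mem ht]
        rfl
    _ ≤ Filter.liminf (fun N => ∫⁻ t, (goodTimes u r N).indicator
          (fun t => ballMass u r N t ^ (2 / r)) t) Filter.atTop :=
        lintegral_liminf_le fun N =>
          ((measurable_ballMass hu).pow_const _).indicator (measurableSet_goodTimes hu)
    _ ≤ Filter.liminf (fun _ : ℕ => D) Filter.atTop :=
        Filter.liminf_le_liminf (Filter.Eventually.of_forall fun N =>
          lintegral_goodTimes_le hu hM hr hD)
    _ = D := Filter.liminf_const D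

/-- The endpoint Strichartz exponent `2n/(n-2)`. -/
noncomputable def endExp (n : ℕ) : ℝ := 2 * n / (n - 2)

lemma two_lt_endExp {n : ℕ} (hn : 3 ≤ n) : 2 < endExp n := by
  have hn0 : (3 : ℝ) ≤ n := by exact_mod_cast hn
  rw [endExp, lt_div_iff₀ (by linarith)]
  linarith

lemma endExp_div {n : ℕ} (hn : 3 ≤ n) : endExp n / (endExp n - 1) = dualExp n := by
  have hn0 : (3 : ℝ) ≤ n := by exact_mod_cast hn
  have h1 : (n : ℝ) - 2 ≠ 0 := by linarith
  have h2 : (n : ℝ) + 2 ≠ 0 := by linarith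
  have h3 : endExp n - 1 ≠ 0 := by linarith [two_lt_endExp hn]
  rw [div_eq_iff h3, endExp, dualExp]
  field_simp
  ring

/-- The endpoint Strichartz estimate. -/
lemma lintegral_freeWave_endpoint_le {n : ℕ} (hn : 3 ≤ n) (hV : Module.finrank ℝ V = n)
    {φ : V → ℂ} (hφ : Integrable φ) (hφm : Measurable φ) :
    ∫⁻ t, (∫⁻ x, ‖freeWave φ t x‖ₑ ^ endExp n) ^ (2 / endExp n) ≤
      dualConst n * ∫⁻ ξ, ‖φ ξ‖ₑ ^ 2 := by
  refine lintegral_rpow_le_of_dual (M := ⟨∫ ξ, ‖φ ξ‖, integral_nonneg fun _ => norm_nonneg _⟩)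
    (continuous_freeWave hφ).measurable (fun t x => norm_freeWave_le t x) (two_lt_endExp hn).le
    fun G hG => ?_
  rw [endExp_div hn]
  refine (hG.enorm_integral_freeWave_mul_sq_le hn hV hφ hφm).trans (le_of_eq ?_)
  ring

end Duality

section Strichartz

variable {V : Type*} [NormedAddCommGroup V] [InnerProductSpace ℝ V] [MeasurableSpace V]
  [FiniteDimensional ℝ V] [BorelSpace V] {φ : V → ℂ}

lemma lintegral_sq_freeWave (hφ : Integrable φ) (hφ2 : MemLp φ 2) (t : ℝ) :
    ∫⁻ x, ‖freeWave φ t x‖ₑ ^ 2 = ∫⁻ ξ, ‖φ ξ‖ₑ ^ 2 := by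
  set ψ : V → ℂ := fun ξ => planeWave t 0 ξ * φ ξ with hψ
  have hc : Continuous fun ξ : V => planeWave t 0 ξ :=
    continuous_planeWave.comp (by fun_prop : Continuous fun ξ : V => ((t, (0 : V)), ξ))
  have hψm : AEStronglyMeasurable ψ volume := hc.aestronglyMeasurable.mul hφ.1
  have hn : ∀ ξ, ‖φ ξ‖ = ‖ψ ξ‖ := fun ξ => by simp [hψ, norm_planeWave]
  have h1 : ∀ x, freeWave φ t x = 𝓕⁻ ψ x := fun x => by
    rw [freeWave, Real.fourierInv_eq']
    congr 1 with ξ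
    rw [hψ, smul_eq_mul, ← mul_assoc, planeWave, planeWave, ← Complex.exp_add, inner_zero_left,
      real_inner_comm]
    congr 2
    push_cast
    ring
  simp_rw [h1]
  rw [lintegral_sq_fourierInv (hφ.congr' hψm (Filter.Eventually.of_forall hn))
    (hφ2.congr_norm hψm (Filter.Eventually.of_forall hn))]
  simp [hψ, ← ofReal_norm, norm_planeWave]

lemma lintegral_rpow_interpolate {X : Type*} [MeasurableSpace X] (μ : Measure X) {f : X → ℝ≥0∞}
    (hf : AEMeasurable f μ) {Q r b : ℝ} (hr : 0 ≤ r) (hb0 : 0 ≤ b) (hb1 : b ≤ 1)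
    (hQ : Q = 2 * (1 - b) + r * b) :
    ∫⁻ x, f x ^ Q ∂μ ≤ (∫⁻ x, f x ^ 2 ∂μ) ^ (1 - b) * (∫⁻ x, f x ^ r ∂μ) ^ b := by
  have h := ENNReal.lintegral_mul_norm_pow_le (μ := μ) (hf.pow_const (2 : ℕ)) (hf.pow_const r)
    (sub_nonneg.2 hb1) hb0 (by ring)
  refine le_trans (le_of_eq ?_) h
  congr 1 with x
  rw [← ENNReal.rpow_natCast, ← ENNReal.rpow_mul, ← ENNReal.rpow_mul,
    ← ENNReal.rpow_add_of_nonneg _ _ (by simpa using hb1) (by positivity), hQ]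
  norm_num

lemma lintegral_freeWave_rpow_le {n : ℕ} (hn : 3 ≤ n) (hV : Module.finrank ℝ V = n)
    (hφ : Integrable φ) (hφm : Measurable φ) (hφ2 : MemLp φ 2) {P Q : ℝ} (hP : 2 ≤ P) (hQ : 2 < Q)
    (hPQ : 2 / P + n / Q = n / 2) :
    ∫⁻ t, (∫⁻ x, ‖freeWave φ t x‖ₑ ^ Q) ^ (P / Q) ≤
      dualConst n * (∫⁻ ξ, ‖φ ξ‖ₑ ^ 2) ^ (P / 2) := by
  have hn0 : (3 : ℝ) ≤ n := by exact_mod_cast hn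
  have hr := two_lt_endExp hn
  set r := endExp n with hrdef
  set Φ := ∫⁻ ξ, ‖φ ξ‖ₑ ^ 2 with hΦ
  have hrel : P * (n * (Q - 2)) = 4 * Q := by
    field_simp at hPQ
    linarith
  have hQr : n * (Q - 2) ≤ 2 * Q := by nlinarith
  have hrn : r - 2 = 4 / (n - 2) := by
    have : (n : ℝ) - 2 ≠ 0 := by linarith
    rw [hrdef, endExp]
    field_simp
    ring
  set b := (Q - 2) / (r - 2) with hb
  have hb0 : 0 ≤ b := div_nonneg (by linarith) (by linarith)
  have hb1 : b ≤ 1 := by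
    rw [hb, div_le_one (by linarith), hrn, le_div_iff₀ (by linarith)]
    linarith
  have hQb : Q = 2 * (1 - b) + r * b := by
    have : b * (r - 2) = Q - 2 := div_mul_cancel₀ _ (by linarith)
    linarith
  have hbP : b * (P / Q) = 2 / r := by
    have h1 : (n : ℝ) - 2 ≠ 0 := by linarith
    have h2 : P = 4 * Q / (n * (Q - 2)) := by
      rw [_root_.eq_div_iff (by nlinarith)]
      exact hrel
    have h3 : Q - 2 ≠ 0 := by linarith
    rw [hb, hrn, h2, hrdef, endExp]
    field_simp
  have haP : (1 - b) * (P / Q) = P / 2 - 1 := by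
    have h1 : P / Q * Q = P := div_mul_cancel₀ _ (by linarith)
    have h2 : 2 / r * r = 2 := div_mul_cancel₀ _ (by linarith)
    have h3 : P / Q * Q = 2 * ((1 - b) * (P / Q)) + r * (b * (P / Q)) := by
      calc P / Q * Q = P / Q * (2 * (1 - b) + r * b) := by rw [← hQb]
        _ = _ := by ring
    rw [hbP] at h3
    linarith
  have hcont := continuous_freeWave hφ
  calc _ ≤ ∫⁻ t, Φ ^ (P / 2 - 1) * (∫⁻ x, ‖freeWave φ t x‖ₑ ^ r) ^ (2 / r) := by
        refine lintegral_mono fun t => ?_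
        have hm : Measurable fun x => ‖freeWave φ t x‖ₑ :=
          (hcont.comp (by fun_prop : Continuous fun x : V => (t, x))).enorm.measurable
        have h := lintegral_rpow_interpolate volume hm.aemeasurable (by linarith) hb0 hb1 hQb
        rw [lintegral_sq_freeWave hφ hφ2] at h
        refine (ENNReal.rpow_le_rpow h (by positivity : 0 ≤ P / Q)).trans (le_of_eq ?_)
        rw [ENNReal.mul_rpow_of_nonneg _ _ (by positivity), ← ENNReal.rpow_mul, ← ENNReal.rpow_mul,
          haP, hbP]
    _ ≤ Φ ^ (P / 2 - 1) * (dualConst n * Φ) := by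
        have hm : Measurable fun t => (∫⁻ x, ‖freeWave φ t x‖ₑ ^ r) ^ (2 / r) :=
          ((hcont.measurable.enorm.pow_const r).lintegral_prod_right').pow_const _
        rw [lintegral_const_mul _ hm]
        exact mul_le_mul' le_rfl (lintegral_freeWave_endpoint_le hn hV hφ hφm)
    _ = _ := by
        rw [mul_left_comm]
        congr 1
        conv_lhs => enter [2]; rw [← ENNReal.rpow_one Φ]
        rw [← ENNReal.rpow_add_of_nonneg _ _ (by linarith) (by norm_num)]
        congr 1
        ring

/-- The homogeneous Strichartz estimate for every admissible pair. -/
lemma mixedNorm_freeWave_le {n : ℕ} (hn : 3 ≤ n) {p q : ℝ≥0∞} (hp : 2 ≤ p) (hq : 2 ≤ q)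
    (hpq : 2 / p + (n : ℝ≥0∞) / q = (n : ℝ≥0∞) / 2) {φ : EuclideanSpace ℝ (Fin n) → ℂ}
    (hφ : Integrable φ) (hφm : Measurable φ) (hφ2 : MemLp φ 2) :
    mixedNorm p q (freeWave φ) ≤
      dualConst n ^ (1 / p.toReal) * (∫⁻ ξ, ‖φ ξ‖ₑ ^ 2) ^ (1 / 2 : ℝ) := by
  have hn0 : (3 : ℝ) ≤ n := by exact_mod_cast hn
  have hn1 : (n : ℝ≥0∞) ≠ 0 := by exact_mod_cast (by omega : n ≠ 0)
  have hq0 : q ≠ 0 := fun h => by simp [h] at hq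
  by_cases hpt : p = ⊤
  · subst hpt
    have hq2 : q = 2 := by
      rw [ENNReal.div_top, zero_add, div_eq_mul_inv, div_eq_mul_inv,
        ENNReal.mul_right_inj hn1 (ENNReal.natCast_ne_top n)] at hpq
      exact inv_injective hpq
    subst hq2
    rw [mixedNorm, if_pos rfl]
    refine essSup_le_of_ae_le _ (Filter.Eventually.of_forall fun t => ?_)
    beta_reduce
    rw [ENNReal.toReal_top, _root_.div_zero, ENNReal.rpow_zero, one_mul]
    rw [← lintegral_sq_freeWave hφ hφ2 t, eLpNorm_eq_lintegral_rpow_enorm_toReal (by simp) (by simp)]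
    simp
  have hp0 : p ≠ 0 := fun h => by simp [h] at hp
  have hP : 2 ≤ p.toReal := by simpa using ENNReal.toReal_mono hpt hp
  have hqt : q ≠ ⊤ := by
    rintro rfl
    have h := congrArg ENNReal.toReal hpq
    rw [ENNReal.div_top, add_zero, ENNReal.toReal_div, ENNReal.toReal_div] at h
    simp only [ENNReal.toReal_ofNat, ENNReal.toReal_natCast] at h
    have : 2 / p.toReal ≤ 1 := by
      rw [div_le_one (by linarith)]
      exact hP
    linarith
  have hPQ : 2 / p.toReal + n / q.toReal = n / 2 := by
    have := congrArg ENNReal.toReal hpq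
    rw [ENNReal.toReal_add (ENNReal.div_ne_top (by simp) hp0) (ENNReal.div_ne_top (by simp) hq0)]
      at this
    simpa using this
  have hQ : 2 < q.toReal := by
    have h2 : 2 ≤ q.toReal := by simpa using ENNReal.toReal_mono hqt hq
    refine lt_of_le_of_ne h2 fun h => ?_
    rw [← h] at hPQ
    have : 0 < 2 / p.toReal := by positivity
    linarith
  rw [mixedNorm, if_neg hpt]
  have h1 : ∀ t, eLpNorm (freeWave φ t) q volume ^ p.toReal =
      (∫⁻ x, ‖freeWave φ t x‖ₑ ^ q.toReal) ^ (p.toReal / q.toReal) := fun t => by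
    rw [eLpNorm_eq_lintegral_rpow_enorm_toReal hq0 hqt, ← ENNReal.rpow_mul, one_div_mul_eq_div]
  simp_rw [h1]
  refine (ENNReal.rpow_le_rpow (lintegral_freeWave_rpow_le hn (by simp) hφ hφm hφ2 hP hQ hPQ)
    (by positivity)).trans (le_of_eq ?_)
  rw [ENNReal.mul_rpow_of_nonneg _ _ (by positivity), ← ENNReal.rpow_mul]
  congr 2
  field_simp

end Strichartz

namespace SchwartzMap

variable {A B : Type*} [NormedAddCommGroup A] [NormedAddCommGroup B]

lemma antilipschitzWith_prodMk_left (b : B) : AntilipschitzWith 1 fun a : A => (a, b) :=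
  AntilipschitzWith.of_le_mul_dist fun x y => by simp [Prod.dist_eq]

lemma antilipschitzWith_prodMk_right (a : A) : AntilipschitzWith 1 fun b : B => (a, b) :=
  AntilipschitzWith.of_le_mul_dist fun x y => by simp [Prod.dist_eq]

variable [InnerProductSpace ℝ A] [InnerProductSpace ℝ B]

lemma hasTemperateGrowth_prodMk_left (b : B) :
    (fun a : A => (a, b)).HasTemperateGrowth := by
  have h : (fun a : A => (a, b)) = fun a => ContinuousLinearMap.inl ℝ A B a + (0, b) := by
    ext a <;> simp
  rw [h]
  exact (ContinuousLinearMap.inl ℝ A B).hasTemperateGrowth.add (.const _)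

lemma hasTemperateGrowth_prodMk_right (a : A) :
    (fun b : B => (a, b)).HasTemperateGrowth := by
  have h : (fun b : B => (a, b)) = fun b => ContinuousLinearMap.inr ℝ A B b + (a, 0) := by
    ext b <;> simp
  rw [h]
  exact (ContinuousLinearMap.inr ℝ A B).hasTemperateGrowth.add (.const _)

/-- The slice `a ↦ K (a, b)` of a Schwartz function of two variables. -/
noncomputable def sliceLeft (K : 𝓢(A × B, ℂ)) (b : B) : 𝓢(A, ℂ) :=
  compCLMOfAntilipschitz ℂ (hasTemperateGrowth_prodMk_left b) (antilipschitzWith_prodMk_left b) K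

/-- The slice `b ↦ K (a, b)` of a Schwartz function of two variables. -/
noncomputable def sliceRight (K : 𝓢(A × B, ℂ)) (a : A) : 𝓢(B, ℂ) :=
  compCLMOfAntilipschitz ℂ (hasTemperateGrowth_prodMk_right a) (antilipschitzWith_prodMk_right a) K

@[simp] lemma sliceLeft_apply (K : 𝓢(A × B, ℂ)) (a : A) (b : B) : sliceLeft K b a = K (a, b) := rfl

/-- The Schwartz function `(b, a) ↦ K (a, b)`. -/
noncomputable def prodSwap (K : 𝓢(A × B, ℂ)) : 𝓢(B × A, ℂ) :=
  compCLMOfContinuousLinearEquiv ℂ (ContinuousLinearEquiv.prodComm ℝ B A) K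

lemma prodSwap_apply (K : 𝓢(A × B, ℂ)) (a : A) (b : B) : prodSwap K (b, a) = K (a, b) := rfl

variable [FiniteDimensional ℝ A] [MeasurableSpace A] [BorelSpace A]

lemma integrable_bound_left (K : 𝓢(A × B, ℂ)) :
    ∃ u : A → ℝ, Integrable u ∧ ∀ a b, ‖K (a, b)‖ ≤ u a := by
  obtain ⟨C, hC⟩ : ∃ C : ℝ, ∀ z : A × B,
      (1 + ‖z‖) ^ (Module.finrank ℝ A + 1) * ‖K z‖ ≤ C := by
    have h := one_add_le_sup_seminorm_apply (𝕜 := ℂ) (m := (Module.finrank ℝ A + 1, 0)) le_rfl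
      le_rfl K
    simp only [norm_iteratedFDeriv_zero] at h
    exact ⟨_, h⟩
  refine ⟨fun a => C * (1 + ‖a‖) ^ (-((Module.finrank ℝ A + 1 : ℕ) : ℝ)),
    (integrable_one_add_norm (by push_cast; linarith)).const_mul C, fun a b => ?_⟩
  beta_reduce
  rw [Real.rpow_neg (by positivity), Real.rpow_natCast, ← _root_.div_eq_mul_inv,
    le_div_iff₀ (by positivity), mul_comm]
  refine le_trans ?_ (hC (a, b))
  gcongr
  exact le_max_left _ _

lemma continuous_fourier_sliceLeft (K : 𝓢(A × B, ℂ)) (α : A) :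
    Continuous fun b => 𝓕 (fun a => K (a, b)) α := by
  obtain ⟨u, hu, hK⟩ := integrable_bound_left K
  simp_rw [Real.fourier_eq']
  refine continuous_of_dominated (bound := u) (fun b => ?_) (fun b => ?_) hu ?_
  · exact Continuous.aestronglyMeasurable (by fun_prop)
  · refine Filter.Eventually.of_forall fun a => ?_
    rw [norm_smul, Complex.norm_exp_ofReal_mul_I, one_mul]
    exact hK a b
  · exact Filter.Eventually.of_forall fun a => by fun_prop

variable [FiniteDimensional ℝ B] [MeasurableSpace B] [BorelSpace B]

/-- The Fourier transform of a Schwartz function on a product of Euclidean spaces. -/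
noncomputable def fourierProd (K : 𝓢(A × B, ℂ)) : 𝓢(A × B, ℂ) :=
  compCLMOfContinuousLinearEquiv ℂ (WithLp.prodContinuousLinearEquiv 2 ℝ A B).symm
    (𝓕 (compCLMOfContinuousLinearEquiv ℂ (WithLp.prodContinuousLinearEquiv 2 ℝ A B) K))

/-- The inverse Fourier transform of a Schwartz function on a product of Euclidean spaces. -/
noncomputable def fourierProdInv (K : 𝓢(A × B, ℂ)) : 𝓢(A × B, ℂ) :=
  compCLMOfContinuousLinearEquiv ℂ (WithLp.prodContinuousLinearEquiv 2 ℝ A B).symm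
    (𝓕⁻ (compCLMOfContinuousLinearEquiv ℂ (WithLp.prodContinuousLinearEquiv 2 ℝ A B) K))

lemma fourierProd_fourierProdInv (K : 𝓢(A × B, ℂ)) : fourierProd (fourierProdInv K) = K := by
  have h : ∀ f : 𝓢(WithLp 2 (A × B), ℂ),
      compCLMOfContinuousLinearEquiv ℂ (WithLp.prodContinuousLinearEquiv 2 ℝ A B)
        (compCLMOfContinuousLinearEquiv ℂ (WithLp.prodContinuousLinearEquiv 2 ℝ A B).symm f) = f :=
    fun f => by ext x; simp
  rw [fourierProd, fourierProdInv, h, FourierTransform.fourier_fourierInv_eq]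
  ext x
  simp

lemma fourierProd_apply (K : 𝓢(A × B, ℂ)) (α : A) (β : B) :
    fourierProd K (α, β) = ∫ z : A × B,
      Complex.exp (((-2 * Real.pi * (inner ℝ z.1 α + inner ℝ z.2 β) : ℝ) : ℂ) * Complex.I) * K z := by
  have h : fourierProd K (α, β) =
      (𝓕 (compCLMOfContinuousLinearEquiv ℂ (WithLp.prodContinuousLinearEquiv 2 ℝ A B) K))
        (WithLp.toLp 2 (α, β)) := rfl
  rw [h, fourier_coe, Real.fourier_eq']
  rw [← (WithLp.volume_preserving_ofLp A B).integral_comp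
    (MeasurableEquiv.toLp 2 (A × B)).symm.measurableEmbedding]
  rfl

lemma integrable_prod (K : 𝓢(A × B, ℂ)) : Integrable K (volume : Measure (A × B)) := by
  have : ((volume : Measure A).prod (volume : Measure B)).IsAddHaarMeasure := inferInstance
  rw [Measure.volume_eq_prod]
  exact K.integrable

lemma memLp_two_prod (K : 𝓢(A × B, ℂ)) : MemLp K 2 (volume : Measure (A × B)) := by
  have : ((volume : Measure A).prod (volume : Measure B)).IsAddHaarMeasure := inferInstance
  rw [Measure.volume_eq_prod]
  exact K.memLp 2 _

lemma integrable_exp_mul (K : 𝓢(A × B, ℂ)) (α : A) (β : B) :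
    Integrable (fun z : A × B => Complex.exp
      (((-2 * Real.pi * (inner ℝ z.1 α + inner ℝ z.2 β) : ℝ) : ℂ) * Complex.I) * K z)
      (volume : Measure (A × B)) := by
  refine K.integrable_prod.bdd_mul (c := 1) (Continuous.aestronglyMeasurable (by fun_prop)) ?_
  exact Filter.Eventually.of_forall fun a => by rw [Complex.norm_exp_ofReal_mul_I]

lemma integrable_fourier_sliceLeft (K : 𝓢(A × B, ℂ)) (α : A) :
    Integrable fun b => 𝓕 (fun a => K (a, b)) α := by
  have h := (integrable_exp_mul K α 0)
  rw [Measure.volume_eq_prod] at h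
  refine h.integral_prod_right.congr (Filter.Eventually.of_forall fun b => ?_)
  simp [Real.fourier_eq', smul_eq_mul]

lemma fourier_fourier_sliceLeft (K : 𝓢(A × B, ℂ)) (α : A) (β : B) :
    𝓕 (fun b => 𝓕 (fun a => K (a, b)) α) β = fourierProd K (α, β) := by
  have h := (integrable_exp_mul K α β)
  rw [fourierProd_apply]
  rw [Measure.volume_eq_prod] at h ⊢
  rw [integral_prod_symm _ h, Real.fourier_eq']
  congr 1 with b
  rw [Real.fourier_eq', smul_eq_mul, ← integral_const_mul]
  congr 1 with a
  rw [smul_eq_mul, ← mul_assoc, ← Complex.exp_add]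
  congr 2
  push_cast
  ring

lemma fourier_sliceLeft (K : 𝓢(A × B, ℂ)) (α : A) (b : B) :
    𝓕 (fun a => K (a, b)) α = 𝓕⁻ (fun β => fourierProd K (α, β)) b := by
  have hF : 𝓕 (fun b => 𝓕 (fun a => K (a, b)) α) = fun β => fourierProd K (α, β) :=
    funext fun β => fourier_fourier_sliceLeft K α β
  have h := (continuous_fourier_sliceLeft K α).fourierInv_fourier_eq
    (integrable_fourier_sliceLeft K α) (by rw [hF]; exact (sliceRight (fourierProd K) α).integrable)
  rw [hF] at h
  exact (congrFun h b).symm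

lemma fourierProd_prodSwap (K : 𝓢(A × B, ℂ)) (α : A) (β : B) :
    fourierProd (prodSwap K) (β, α) = fourierProd K (α, β) := by
  rw [fourierProd_apply, fourierProd_apply, Measure.volume_eq_prod, Measure.volume_eq_prod,
    ← integral_prod_swap]
  congr 1 with z
  rw [add_comm (inner ℝ z.swap.1 β)]
  rfl

lemma fourier_sliceRight (K : 𝓢(A × B, ℂ)) (a : A) (β : B) :
    𝓕 (fun b => K (a, b)) β = 𝓕⁻ (fun α => fourierProd K (α, β)) a := by
  have h := fourier_sliceLeft (prodSwap K) β a
  simpa only [fourierProd_prodSwap, prodSwap_apply] using h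

lemma continuous_fourier_sliceRight (K : 𝓢(A × B, ℂ)) :
    Continuous fun z : A × B => 𝓕 (fun y => K (z.1, y)) z.2 := by
  obtain ⟨u, hu, hK⟩ := integrable_bound_left (prodSwap K)
  simp_rw [Real.fourier_eq']
  refine continuous_of_dominated (bound := u) (fun z => ?_) (fun z => ?_) hu ?_
  · exact Continuous.aestronglyMeasurable (by fun_prop)
  · refine Filter.Eventually.of_forall fun y => ?_
    rw [norm_smul, Complex.norm_exp_ofReal_mul_I, one_mul]
    exact hK y z.1
  · exact Filter.Eventually.of_forall fun y => by fun_prop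

end SchwartzMap

section Weight

variable {V : Type*} [NormedAddCommGroup V] [InnerProductSpace ℝ V]

/-- The weight `⟨x⟩⁻¹`. -/
noncomputable def decayWeight (x : V) : ℝ := (1 + ‖x‖ ^ 2) ^ (-(1 : ℝ) / 2)

/-- The Schwartz function `⟨x⟩⁻¹ f(s, x)`. -/
noncomputable def weighted (f : 𝓢(ℝ × V, ℂ)) : 𝓢(ℝ × V, ℂ) :=
  smulLeftCLM ℂ (fun z : ℝ × V => decayWeight z.2) f

lemma weighted_apply (f : 𝓢(ℝ × V, ℂ)) (s : ℝ) (x : V) :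
    weighted f (s, x) = decayWeight x * f (s, x) := by
  have hm : (fun z : ℝ × V => decayWeight z.2).HasTemperateGrowth :=
    (Function.hasTemperateGrowth_one_add_norm_sq_rpow V (-(1 : ℝ) / 2)).comp
      (ContinuousLinearMap.snd ℝ ℝ V).hasTemperateGrowth
  rw [weighted, smulLeftCLM_apply_apply hm, Complex.real_smul]

end Weight

section Profile

variable {V : Type*} [NormedAddCommGroup V] [InnerProductSpace ℝ V] [FiniteDimensional ℝ V]
  [MeasurableSpace V] [BorelSpace V]

/-- The symbol of `⟨∂_s⟩^{1/4}` in the frequency normalization of the Fourier transform. -/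
noncomputable def quarterSymbol (μ : ℝ) : ℝ := (1 + (2 * Real.pi * μ) ^ 2) ^ (1 / 8 : ℝ)

lemma quarterSymbol_hasTemperateGrowth : quarterSymbol.HasTemperateGrowth := by
  have h := (Function.hasTemperateGrowth_one_add_norm_sq_rpow ℝ (1 / 8)).comp
    (show Function.HasTemperateGrowth fun μ : ℝ => 2 * Real.pi * μ by fun_prop)
  refine (congrArg Function.HasTemperateGrowth (funext fun μ => ?_)).mp h
  simp only [Function.comp, quarterSymbol, Real.norm_eq_abs, sq_abs]

/-- The Schwartz function `⟨∂_s⟩^{1/4} g`. -/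
noncomputable def quarterDeriv (g : 𝓢(ℝ × V, ℂ)) : 𝓢(ℝ × V, ℂ) :=
  fourierProdInv (smulLeftCLM ℂ (fun z : ℝ × V => quarterSymbol z.1) (fourierProd g))

lemma fourier_quarterDeriv (g : 𝓢(ℝ × V, ℂ)) (x : V) (μ : ℝ) :
    𝓕 (fun s => quarterDeriv g (s, x)) μ = quarterSymbol μ * 𝓕 (fun s => g (s, x)) μ := by
  have hm : (fun z : ℝ × V => quarterSymbol z.1).HasTemperateGrowth :=
    quarterSymbol_hasTemperateGrowth.comp (ContinuousLinearMap.fst ℝ ℝ V).hasTemperateGrowth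
  rw [fourier_sliceLeft, fourier_sliceLeft, quarterDeriv, fourierProd_fourierProdInv,
    Real.fourierInv_eq', Real.fourierInv_eq', ← integral_const_mul]
  congr 1 with β
  rw [smulLeftCLM_apply_apply hm, Complex.real_smul, smul_eq_mul, smul_eq_mul]
  ring

lemma quarterDeriv_eq_fracD {n : ℕ} (g : 𝓢(ℝ × EuclideanSpace ℝ (Fin n), ℂ)) (s : ℝ)
    (x : EuclideanSpace ℝ (Fin n)) : quarterDeriv g (s, x) = fracD ((1 : ℝ) / 4) g s x := by
  have h : 𝓕⁻ (𝓕 (sliceLeft (quarterDeriv g) x) : 𝓢(ℝ, ℂ)) = sliceLeft (quarterDeriv g) x :=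
    FourierTransform.fourierInv_fourier_eq _
  have h1 : quarterDeriv g (s, x) = 𝓕⁻ (𝓕 (fun s => quarterDeriv g (s, x))) s := by
    rw [← sliceLeft_apply, ← h, fourierInv_coe, fourier_coe]
    rfl
  rw [h1, Real.fourierInv_eq', fracD]
  simp_rw [fourier_quarterDeriv]
  set Φ : ℝ → ℂ := fun lam => Complex.exp (Complex.I * (s : ℂ) * (lam : ℂ)) *
      (((1 + lam ^ 2 : ℝ) ^ ((1 : ℝ) / 4 / 2) : ℝ) : ℂ) *
      ∫ σ : ℝ, Complex.exp (-(Complex.I * (σ : ℂ) * (lam : ℂ))) * g (σ, x) with hΦ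
  have h2 := Measure.integral_comp_mul_left Φ (2 * Real.pi)
  rw [abs_of_pos (by positivity)] at h2
  have h3 : (2 * Real.pi : ℂ)⁻¹ * ∫ lam, Φ lam = ∫ μ, Φ (2 * Real.pi * μ) := by
    rw [h2, Complex.real_smul]
    push_cast
    rfl
  rw [h3]
  congr 1 with μ
  rw [hΦ, quarterSymbol, Real.fourier_eq', smul_eq_mul]
  beta_reduce
  rw [← mul_assoc]
  congr 1
  · congr 1
    · congr 1
      simp only [RCLike.inner_apply, conj_trivial]
      push_cast
      ring
    · norm_num
  · congr 1 with σ
    rw [smul_eq_mul]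
    congr 2
    simp only [RCLike.inner_apply, conj_trivial]
    push_cast
    ring

lemma fourier_fourier_sliceRight (h : 𝓢(ℝ × V, ℂ)) (α : ℝ) (ξ : V) :
    𝓕 (fun s => 𝓕 (fun y => h (s, y)) ξ) α = fourierProd h (α, ξ) := by
  rw [← fourierProd_prodSwap, ← fourier_fourier_sliceLeft]
  rfl

lemma integrable_fourier_sliceRight (h : 𝓢(ℝ × V, ℂ)) :
    Integrable (fun z : ℝ × V => 𝓕 (fun y => h (z.1, y)) z.2)
      ((volume : Measure ℝ).prod (volume : Measure V)) := by
  have hm : (fun z : ℝ × V => 1 + z.1 ^ 2).HasTemperateGrowth := by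
    have : (fun z : ℝ × V => z.1).HasTemperateGrowth :=
      (ContinuousLinearMap.fst ℝ ℝ V).hasTemperateGrowth
    exact (Function.HasTemperateGrowth.const 1).add (this.pow 2)
  set k : 𝓢(ℝ × V, ℂ) := smulLeftCLM ℂ (fun z : ℝ × V => 1 + z.1 ^ 2) h with hk
  have hk' : ∀ s y, k (s, y) = ((1 + s ^ 2 : ℝ) : ℂ) * h (s, y) := fun s y => by
    rw [hk, smulLeftCLM_apply_apply hm, Complex.real_smul]
  have hN : Integrable fun ξ : V => ∫ α : ℝ, ‖fourierProd k (α, ξ)‖ := by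
    have := (fourierProd k).integrable_prod.norm
    rw [Measure.volume_eq_prod] at this
    exact this.integral_prod_right
  have hI := (integrable_inv_one_add_sq).mul_prod hN
  refine hI.mono' (continuous_fourier_sliceRight h).aestronglyMeasurable
    (Filter.Eventually.of_forall fun z => ?_)
  have h0 : (0 : ℝ) < 1 + z.1 ^ 2 := by positivity
  rw [inv_mul_eq_div, le_div_iff₀ h0]
  have h1 : 𝓕 (fun y => k (z.1, y)) z.2 = ((1 + z.1 ^ 2 : ℝ) : ℂ) * 𝓕 (fun y => h (z.1, y)) z.2 := by
    rw [Real.fourier_eq', Real.fourier_eq', ← integral_const_mul]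
    congr 1 with y
    rw [hk', smul_eq_mul, smul_eq_mul]
    ring
  have h2 : ‖𝓕 (fun y => k (z.1, y)) z.2‖ ≤ ∫ α : ℝ, ‖fourierProd k (α, z.2)‖ := by
    rw [fourier_sliceRight, Real.fourierInv_eq_fourier_neg]
    exact norm_fourier_le_integral_norm _ _
  rw [h1, norm_mul, Complex.norm_real, Real.norm_of_nonneg h0.le] at h2
  linarith

/-- The Fourier profile of `∫ e^{-isΔ} h(s) ds`: the space-time Fourier transform of `h`
restricted to the paraboloid. -/
noncomputable def paraboloidTrace (h : 𝓢(ℝ × V, ℂ)) (ξ : V) : ℂ :=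
  fourierProd h (-(2 * Real.pi * ‖ξ‖ ^ 2), ξ)

lemma continuous_paraboloidTrace (h : 𝓢(ℝ × V, ℂ)) : Continuous (paraboloidTrace h) :=
  (fourierProd h).continuous.comp (by fun_prop)

lemma integrable_paraboloidTrace (h : 𝓢(ℝ × V, ℂ)) : Integrable (paraboloidTrace h) := by
  obtain ⟨u, hu, hK⟩ := integrable_bound_left (prodSwap (fourierProd h))
  exact hu.mono' (continuous_paraboloidTrace h).aestronglyMeasurable
    (Filter.Eventually.of_forall fun ξ => hK ξ _)

lemma paraboloidTrace_eq_integral (h : 𝓢(ℝ × V, ℂ)) (ξ : V) :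
    paraboloidTrace h ξ =
      ∫ s : ℝ, Complex.exp (((4 * Real.pi ^ 2 * s * ‖ξ‖ ^ 2 : ℝ) : ℂ) * Complex.I) *
        𝓕 (fun y => h (s, y)) ξ := by
  rw [paraboloidTrace, ← fourier_fourier_sliceRight, Real.fourier_eq']
  congr 1 with s
  rw [smul_eq_mul]
  congr 4
  simp only [RCLike.inner_apply, conj_trivial]
  ring

lemma freeWave_paraboloidTrace {n : ℕ} (h : 𝓢(ℝ × EuclideanSpace ℝ (Fin n), ℂ)) (t : ℝ)
    (x : EuclideanSpace ℝ (Fin n)) :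
    freeWave (paraboloidTrace h) t x = ∫ s : ℝ, schrod n (t - s) (fun y => h (s, y)) x := by
  set Ψ : ℝ → EuclideanSpace ℝ (Fin n) → ℂ := fun s ξ => planeWave t x ξ *
    (Complex.exp (((4 * Real.pi ^ 2 * s * ‖ξ‖ ^ 2 : ℝ) : ℂ) * Complex.I) *
      𝓕 (fun y => h (s, y)) ξ) with hΨ
  have hc : Continuous fun z : ℝ × EuclideanSpace ℝ (Fin n) => planeWave t x z.2 :=
    continuous_planeWave.comp
      (by fun_prop : Continuous fun z : ℝ × EuclideanSpace ℝ (Fin n) => ((t, x), z.2))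
  have hint : Integrable (Function.uncurry Ψ)
      ((volume : Measure ℝ).prod (volume : Measure (EuclideanSpace ℝ (Fin n)))) := by
    refine (integrable_fourier_sliceRight h).congr' ?_ ?_
    · refine Continuous.aestronglyMeasurable (hc.mul (Continuous.mul (by fun_prop) ?_))
      exact continuous_fourier_sliceRight h
    · refine Filter.Eventually.of_forall fun z => ?_
      rw [Function.uncurry, hΨ, norm_mul, norm_mul, norm_planeWave, Complex.norm_exp_ofReal_mul_I,
        one_mul, one_mul]
  have h1 : freeWave (paraboloidTrace h) t x = ∫ ξ, ∫ s, Ψ s ξ := by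
    rw [freeWave]
    congr 1 with ξ
    rw [paraboloidTrace_eq_integral, ← integral_const_mul]
  rw [h1, ← integral_integral_swap hint]
  refine integral_congr_ae ?_
  filter_upwards [compl_mem_ae_iff.mpr (measure_singleton t)] with s hs
  have hs' : t - s ≠ 0 := fun hts => hs (by simp only [Set.mem_singleton_iff]; linarith)
  have h2 := integral_oscillatory_mul_fourier hs' (sliceRight h s).integrable
    (by rw [← fourier_coe]; exact SchwartzMap.integrable _) x
  rw [schrod, if_neg hs']
  rw [finrank_euclideanSpace_fin] at h2
  refine Eq.trans ?_ (h2.trans ?_)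
  · congr 1 with ξ
    simp only [hΨ, planeWave]
    rw [← mul_assoc, ← Complex.exp_add]
    congr 2
    push_cast
    ring
  · rfl

end Profile

lemma sq_mul_sq_decayWeight {E : Type*} [NormedAddCommGroup E] (y : E) : (1 + ‖y‖ ^ 2) * decayWeight y ^ 2 = 1 := by
  have h : 0 < 1 + ‖y‖ ^ 2 := by positivity
  have h2 : decayWeight y ^ 2 = (1 + ‖y‖ ^ 2) ^ (-1 : ℝ) := by
    rw [decayWeight, ← Real.rpow_natCast ((1 + ‖y‖ ^ 2) ^ (-(1 : ℝ) / 2)), ← Real.rpow_mul h.le]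
    norm_num
  rw [h2]
  rw [Real.rpow_neg_one, mul_inv_cancel₀ h.ne']

lemma norm_mul_decayWeight_le {E : Type*} [NormedAddCommGroup E] (y : E) : ‖y‖ * decayWeight y ≤ 1 := by
  have h := sq_mul_sq_decayWeight y
  refine le_of_sq_le_sq ?_ zero_le_one
  nlinarith [sq_nonneg (decayWeight y)]

section Smoothing

variable {V : Type*} [NormedAddCommGroup V] [InnerProductSpace ℝ V] [FiniteDimensional ℝ V]
  [MeasurableSpace V] [BorelSpace V]

/-- The spatial profile `⟨y⟩⁻¹ (𝓕_s g)(μ, y)` at time frequency `μ`. -/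
noncomputable def frequencySlice (g : 𝓢(ℝ × V, ℂ)) (μ : ℝ) (y : V) : ℂ :=
  decayWeight y * 𝓕 (fun s => g (s, y)) μ

lemma paraboloidTrace_weighted_quarterDeriv (g : 𝓢(ℝ × V, ℂ)) (ξ : V) :
    paraboloidTrace (weighted (quarterDeriv g)) ξ =
      quarterSymbol (-(2 * Real.pi * ‖ξ‖ ^ 2)) *
        𝓕 (frequencySlice g (-(2 * Real.pi * ‖ξ‖ ^ 2))) ξ := by
  rw [paraboloidTrace, ← fourier_fourier_sliceLeft, Real.fourier_eq', Real.fourier_eq',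
    ← integral_const_mul]
  congr 1 with y
  have h : 𝓕 (fun s => weighted (quarterDeriv g) (s, y)) (-(2 * Real.pi * ‖ξ‖ ^ 2)) =
      decayWeight y * 𝓕 (fun s => quarterDeriv g (s, y)) (-(2 * Real.pi * ‖ξ‖ ^ 2)) := by
    rw [Real.fourier_eq', Real.fourier_eq', ← integral_const_mul]
    congr 1 with s
    rw [weighted_apply, smul_eq_mul, smul_eq_mul]
    ring
  rw [h, fourier_quarterDeriv, smul_eq_mul, smul_eq_mul, frequencySlice]
  ring

/-- The time Fourier transform `y ↦ (𝓕_s g)(μ, y)` as a Schwartz function. -/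
noncomputable def timeFourier (g : 𝓢(ℝ × V, ℂ)) (μ : ℝ) : 𝓢(V, ℂ) :=
  𝓕⁻ (sliceRight (fourierProd g) μ)

lemma timeFourier_apply (g : 𝓢(ℝ × V, ℂ)) (μ : ℝ) (y : V) :
    timeFourier g μ y = 𝓕 (fun s => g (s, y)) μ := by
  rw [fourier_sliceLeft, timeFourier, fourierInv_coe]
  rfl

lemma frequencySlice_eq (g : 𝓢(ℝ × V, ℂ)) (μ : ℝ) :
    frequencySlice g μ = ⇑(smulLeftCLM ℂ (decayWeight : V → ℝ) (timeFourier g μ)) := by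
  have h : (decayWeight : V → ℝ).HasTemperateGrowth :=
    Function.hasTemperateGrowth_one_add_norm_sq_rpow V (-(1 : ℝ) / 2)
  ext y
  rw [smulLeftCLM_apply_apply h,
    timeFourier_apply, Complex.real_smul, frequencySlice]

lemma memLp_norm_smul_frequencySlice (g : 𝓢(ℝ × V, ℂ)) (μ : ℝ) :
    MemLp (fun y => ‖y‖ • frequencySlice g μ y) 2 := by
  refine ((timeFourier g μ).memLp 2 volume).mono ?_ (Filter.Eventually.of_forall fun y => ?_)
  · rw [frequencySlice_eq]
    exact Continuous.aestronglyMeasurable (by fun_prop)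
  · rw [timeFourier_apply, frequencySlice, norm_smul, norm_mul, norm_norm, ← mul_assoc]
    refine mul_le_of_le_one_left (norm_nonneg _) ?_
    have h : 0 ≤ decayWeight y := Real.rpow_nonneg (by positivity) _
    rw [Complex.norm_real, Real.norm_of_nonneg h]
    exact norm_mul_decayWeight_le y

lemma sphere_frequencySlice_le {n : ℕ} (hn : 3 ≤ n) (hd : Module.finrank ℝ V = n)
    (g : 𝓢(ℝ × V, ℂ)) (μ : ℝ) {ρ : ℝ} (hρ : 0 < ρ) :
    ENNReal.ofReal (ρ ^ (n - 2) * (1 + ρ)) *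
        ∫⁻ ω : Metric.sphere (0 : V) 1, ‖𝓕 (frequencySlice g μ) (ρ • (ω : V))‖ₑ ^ 2
          ∂(volume : Measure V).toSphere ≤
      ENNReal.ofReal (8 * Real.pi ^ 2) * ∫⁻ y, ‖𝓕 (fun s => g (s, y)) μ‖ₑ ^ 2 := by
  refine (lintegral_sphere_fourier_le ?_ ?_ ?_ (memLp_norm_smul_frequencySlice g μ) hn hd
    hρ).trans_eq ?_
  · rw [frequencySlice_eq]
    exact SchwartzMap.integrable _
  · rw [frequencySlice_eq]
    simpa using SchwartzMap.integrable_pow_mul volume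
      (smulLeftCLM ℂ (decayWeight : V → ℝ) (timeFourier g μ)) 1
  · rw [frequencySlice_eq]
    exact SchwartzMap.memLp _ 2 volume
  · congr 1
    refine lintegral_congr fun y => ?_
    rw [frequencySlice, enorm_mul, mul_pow, ← mul_assoc, ← ofReal_norm (decayWeight y : ℂ),
      ← ENNReal.ofReal_pow (norm_nonneg _), ← ENNReal.ofReal_mul (by positivity),
      Complex.norm_real, Real.norm_eq_abs, sq_abs, sq_mul_sq_decayWeight, ENNReal.ofReal_one,
      one_mul]

lemma quarterSymbol_sq_le {ρ : ℝ} (hρ : 0 < ρ) :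
    quarterSymbol (-(2 * Real.pi * ρ ^ 2)) ^ 2 ≤ 2 * Real.pi * (1 + ρ) := by
  have hπ := Real.pi_gt_three
  have h0 : 0 ≤ 1 + (2 * Real.pi * -(2 * Real.pi * ρ ^ 2)) ^ 2 := by positivity
  refine le_of_pow_le_pow_left₀ (n := 4) (by norm_num) (by positivity) ?_
  rw [quarterSymbol, ← pow_mul, ← Real.rpow_natCast, ← Real.rpow_mul h0]
  norm_num
  have h1 : 1 ≤ (2 * Real.pi) ^ 4 := one_le_pow₀ (by linarith)
  have h2 : 1 + ρ ^ 4 ≤ (1 + ρ) ^ 4 := by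
    have : 0 ≤ 4 * ρ + 6 * ρ ^ 2 + 4 * ρ ^ 3 := by positivity
    nlinarith
  calc 1 + (2 * Real.pi * (2 * Real.pi * ρ ^ 2)) ^ 2 = 1 + (2 * Real.pi) ^ 4 * ρ ^ 4 := by ring
    _ ≤ (2 * Real.pi) ^ 4 * (1 + ρ ^ 4) := by linarith
    _ ≤ (2 * Real.pi) ^ 4 * (1 + ρ) ^ 4 := by gcongr
    _ = (2 * Real.pi * (1 + ρ)) ^ 4 := by ring

lemma radial_paraboloidTrace_le {n : ℕ} (hn : 3 ≤ n) (hd : Module.finrank ℝ V = n)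
    (g : 𝓢(ℝ × V, ℂ)) {ρ : ℝ} (hρ : 0 < ρ) :
    ∫⁻ ω : Metric.sphere (0 : V) 1, ENNReal.ofReal (ρ ^ (Module.finrank ℝ V - 1)) *
        ‖paraboloidTrace (weighted (quarterDeriv g)) (ρ • (ω : V))‖ₑ ^ 2
          ∂(volume : Measure V).toSphere ≤
      ENNReal.ofReal (4 * Real.pi ^ 2) * (ENNReal.ofReal |-(4 * Real.pi * ρ)| *
        ∫⁻ y, ‖𝓕 (fun s => g (s, y)) (-(2 * Real.pi * ρ ^ 2))‖ₑ ^ 2) := by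
  set μ : ℝ := -(2 * Real.pi * ρ ^ 2) with hμ
  have hcont : Continuous fun ω : Metric.sphere (0 : V) 1 =>
      𝓕 (frequencySlice g μ) (ρ • (ω : V)) := by
    rw [frequencySlice_eq]
    exact (continuous_fourier_of_integrable (SchwartzMap.integrable _)).comp (by fun_prop)
  have hm : Measurable fun ω : Metric.sphere (0 : V) 1 =>
      ‖𝓕 (frequencySlice g μ) (ρ • (ω : V))‖ₑ ^ 2 := hcont.measurable.enorm.pow_const 2
  have h1 : ∀ ω : Metric.sphere (0 : V) 1, ENNReal.ofReal (ρ ^ (Module.finrank ℝ V - 1)) *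
        ‖paraboloidTrace (weighted (quarterDeriv g)) (ρ • (ω : V))‖ₑ ^ 2 =
      ENNReal.ofReal (ρ ^ (n - 1) * quarterSymbol μ ^ 2) *
        ‖𝓕 (frequencySlice g μ) (ρ • (ω : V))‖ₑ ^ 2 := fun ω => by
    have hω : ‖ρ • (ω : V)‖ = ρ := by
      rw [norm_smul, norm_eq_of_mem_sphere, mul_one, Real.norm_of_nonneg hρ.le]
    rw [paraboloidTrace_weighted_quarterDeriv, hω, hd, enorm_mul, mul_pow, ← mul_assoc,
      ENNReal.ofReal_mul (by positivity), ← ofReal_norm (quarterSymbol μ : ℂ), Complex.norm_real,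
      ← ENNReal.ofReal_pow (norm_nonneg _), Real.norm_eq_abs, sq_abs]
  have h2 : ρ ^ (n - 1) * quarterSymbol μ ^ 2 ≤
      (2 * Real.pi * ρ) * (ρ ^ (n - 2) * (1 + ρ)) := by
    have h3 : ρ ^ (n - 1) = ρ ^ (n - 2) * ρ := by
      rw [← pow_succ]
      congr 1
      omega
    rw [h3]
    have := mul_le_mul_of_nonneg_left (quarterSymbol_sq_le hρ)
      (show 0 ≤ ρ ^ (n - 2) * ρ by positivity)
    linarith
  simp_rw [h1]
  rw [lintegral_const_mul _ hm]
  refine (mul_le_mul_left (ENNReal.ofReal_le_ofReal h2) _).trans ?_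
  rw [ENNReal.ofReal_mul (by positivity), mul_assoc]
  refine (mul_le_mul_right (sphere_frequencySlice_le hn hd g μ hρ) _).trans_eq ?_
  rw [← mul_assoc, ← mul_assoc, ← ENNReal.ofReal_mul (by positivity),
    ← ENNReal.ofReal_mul (by positivity), abs_neg, abs_of_pos (by positivity)]
  congr 2
  ring

lemma lintegral_radial_comp_le (A : ℝ → ℝ≥0∞) :
    ∫⁻ ρ in Set.Ioi (0 : ℝ), ENNReal.ofReal |-(4 * Real.pi * ρ)| * A (-(2 * Real.pi * ρ ^ 2)) ≤
      ∫⁻ μ, A μ := by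
  rw [← lintegral_image_eq_lintegral_abs_deriv_mul (f := fun ρ : ℝ => -(2 * Real.pi * ρ ^ 2))
    (f' := fun ρ => -(4 * Real.pi * ρ)) measurableSet_Ioi (fun ρ _ => ?_) (fun a ha b hb hab => ?_)]
  · exact setLIntegral_le_lintegral _ _
  · have h := (((hasDerivAt_pow 2 ρ).const_mul (2 * Real.pi)).neg).hasDerivWithinAt
      (s := Set.Ioi (0 : ℝ))
    refine h.congr_deriv ?_
    push_cast
    ring
  · have h := mul_left_cancel₀ (mul_ne_zero two_ne_zero Real.pi_ne_zero) (neg_injective hab)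
    exact (sq_eq_sq₀ (le_of_lt ha) (le_of_lt hb)).mp h

lemma lintegral_time_fourier (g : 𝓢(ℝ × V, ℂ)) :
    ∫⁻ μ : ℝ, ∫⁻ y, ‖𝓕 (fun s => g (s, y)) μ‖ₑ ^ 2 = eLpNorm g 2 volume ^ 2 := by
  have hc : Continuous fun z : V × ℝ => 𝓕 (fun s => g (s, z.1)) z.2 :=
    continuous_fourier_sliceRight (prodSwap g)
  have hm : Measurable fun z : ℝ × V => ‖𝓕 (fun s => g (s, z.2)) z.1‖ₑ ^ 2 :=
    (hc.comp continuous_swap).measurable.enorm.pow_const 2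
  have hg : Measurable fun z : ℝ × V => ‖g z‖ₑ ^ 2 := g.continuous.measurable.enorm.pow_const 2
  rw [eLpNorm_two_sq, Measure.volume_eq_prod, lintegral_prod_symm _ hg.aemeasurable,
    lintegral_lintegral_swap hm.aemeasurable]
  refine lintegral_congr fun y => ?_
  exact lintegral_sq_fourier (sliceLeft g y).integrable ((sliceLeft g y).memLp 2 volume)

/-- Kato smoothing in dual form, on the Fourier side. -/
lemma lintegral_sq_paraboloidTrace_le {n : ℕ} (hn : 3 ≤ n) (hd : Module.finrank ℝ V = n)
    (g : 𝓢(ℝ × V, ℂ)) :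
    ∫⁻ ξ, ‖paraboloidTrace (weighted (quarterDeriv g)) ξ‖ₑ ^ 2 ≤
      ENNReal.ofReal (4 * Real.pi ^ 2) * eLpNorm g 2 volume ^ 2 := by
  have : Nontrivial V := Module.nontrivial_of_finrank_pos (R := ℝ) (by omega)
  have hφ := continuous_paraboloidTrace (weighted (quarterDeriv g))
  have hm : Measurable fun z : Metric.sphere (0 : V) 1 × ℝ =>
      ENNReal.ofReal (z.2 ^ (Module.finrank ℝ V - 1)) *
        ‖paraboloidTrace (weighted (quarterDeriv g)) (z.2 • (z.1 : V))‖ₑ ^ 2 := by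
    refine Measurable.mul (by fun_prop) (Measurable.pow_const (Measurable.enorm ?_) 2)
    exact (hφ.comp (by fun_prop)).measurable
  rw [lintegral_polar volume (hφ.measurable.enorm.pow_const 2),
    lintegral_lintegral_swap hm.aemeasurable]
  calc _ ≤ ∫⁻ ρ in Set.Ioi (0 : ℝ), ENNReal.ofReal (4 * Real.pi ^ 2) *
        (ENNReal.ofReal |-(4 * Real.pi * ρ)| *
          ∫⁻ y, ‖𝓕 (fun s => g (s, y)) (-(2 * Real.pi * ρ ^ 2))‖ₑ ^ 2) :=
        setLIntegral_mono' measurableSet_Ioi fun ρ hρ => radial_paraboloidTrace_le hn hd g hρ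
    _ = ENNReal.ofReal (4 * Real.pi ^ 2) * ∫⁻ ρ in Set.Ioi (0 : ℝ),
        ENNReal.ofReal |-(4 * Real.pi * ρ)| *
          ∫⁻ y, ‖𝓕 (fun s => g (s, y)) (-(2 * Real.pi * ρ ^ 2))‖ₑ ^ 2 :=
        lintegral_const_mul' _ _ ENNReal.ofReal_ne_top
    _ ≤ _ := by
        rw [← lintegral_time_fourier]
        exact mul_le_mul_right (lintegral_radial_comp_le
          (fun μ => ∫⁻ y, ‖𝓕 (fun s => g (s, y)) μ‖ₑ ^ 2)) _

end Smoothing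

end

/-- Untruncated Strichartz estimate for the quarter-derivative term: with
`h(s,x) = ⟨x⟩⁻¹ (⟨∂_s⟩^{1/4} g)(s,x)`, the integral
`∫_ℝ e^{i(t-s)Δ} h(s,·) ds` obeys `‖F‖_{L^p_t L^q_x} ≤ C ‖g‖_{L²(ℝ×ℝⁿ)}`
for every admissible pair `(p,q)`. -/
theorem strichartz_untruncated_quarter_derivative (n : ℕ) (hn : 3 ≤ n) (p q : ℝ≥0∞)
    (hp : 2 ≤ p) (hq : 2 ≤ q) (hpq : 2 / p + (n : ℝ≥0∞) / q = (n : ℝ≥0∞) / 2) :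
    ∃ C : ℝ≥0∞, C ≠ ⊤ ∧
      ∀ g : 𝓢(ℝ × EuclideanSpace ℝ (Fin n), ℂ),
        mixedNorm p q
            (fun t x =>
              ∫ s : ℝ,
                schrod n (t - s)
                  (fun y => (((1 + ‖y‖ ^ 2 : ℝ) ^ (-(1 : ℝ) / 2) : ℝ) : ℂ) *
                    fracD ((1 : ℝ) / 4) (⇑g) s y) x)
          ≤ C * eLpNorm (⇑g) 2 volume := by
  refine ⟨dualConst n ^ (1 / p.toReal) * ENNReal.ofReal (4 * Real.pi ^ 2) ^ (1 / 2 : ℝ),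
    ENNReal.mul_ne_top (ENNReal.rpow_ne_top_of_nonneg (by positivity) (dualConst_ne_top n))
      (ENNReal.rpow_ne_top_of_nonneg (by positivity) ENNReal.ofReal_ne_top), fun g => ?_⟩
  have hF : (fun (t : ℝ) (x : EuclideanSpace ℝ (Fin n)) => ∫ s : ℝ, schrod n (t - s)
      (fun y => (((1 + ‖y‖ ^ 2 : ℝ) ^ (-(1 : ℝ) / 2) : ℝ) : ℂ) *
        fracD ((1 : ℝ) / 4) (⇑g) s y) x) =
      freeWave (paraboloidTrace (weighted (quarterDeriv g))) := by
    ext t x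
    rw [freeWave_paraboloidTrace]
    simp_rw [weighted_apply, quarterDeriv_eq_fracD, decayWeight]
  have hK := lintegral_sq_paraboloidTrace_le hn finrank_euclideanSpace_fin g
  have hφ := continuous_paraboloidTrace (weighted (quarterDeriv g))
  have hφ2 : MemLp (paraboloidTrace (weighted (quarterDeriv g))) 2 := by
    refine ⟨hφ.aestronglyMeasurable, ?_⟩
    rw [← eLpNorm_two_sq] at hK
    have h := hK.trans_lt (ENNReal.mul_lt_top ENNReal.ofReal_lt_top
      (ENNReal.pow_lt_top g.memLp_two_prod.2))
    exact (ENNReal.pow_lt_top_iff.mp h).resolve_right (by norm_num)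
  rw [hF]
  refine (mixedNorm_freeWave_le hn hp hq hpq (integrable_paraboloidTrace _) hφ.measurable
    hφ2).trans ?_
  rw [mul_assoc]
  refine mul_le_mul_right ((ENNReal.rpow_le_rpow hK (by positivity)).trans_eq ?_) _
  rw [ENNReal.mul_rpow_of_nonneg _ _ (by positivity), ← ENNReal.rpow_natCast,
    ← ENNReal.rpow_mul]
  norm_num
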